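/- arXiv:2208.04801 — 9 statements merged into one kernel-verified Lean document; each statement's English description precedes it below -/
import Mathlib

section
/- Let (a_n)_{n≥0} be a sequence of positive real numbers with a_0 = 1 which grows super-exponentially (i.e., a_n/a_{n-1} → ∞ as n → ∞) and satisfies Σ_{k=1}^{n-1} a_k a_{n-k} = O(a_{n-1}) (i.e., there is a constant C with Σ_{k=1}^{n-1} a_k a_{n-k} ≤ C·a_{n-1} for all n ≥ 2). Let (b_n)_{n≥1} be the sequence of coefficients of the formal logarithm of Σ_{n≥0} a_n z^n, i.e., the unique real sequence satisfying n·a_n = Σ_{k=1}^{n} k·b_k·a_{n-k} for all n ≥ 1. Then b_n ∼ a_n, i.e., b_n/a_n → 1 as n → ∞. -/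
open Filter Finset

/-- **Bender's theorem for fast-growing coefficients.**
If `(a n)` is a positive sequence with `a 0 = 1` which grows super-exponentially
(`a n / a (n-1) → ∞`) and satisfies `∑_{k=1}^{n-1} a k * a (n-k) = O(a (n-1))`,
and `(b n)` is the coefficient sequence of the formal logarithm of `∑ a n z^n`
(characterized by `n * a n = ∑_{k=1}^{n} k * b k * a (n-k)` for `n ≥ 1`),
then `b n ∼ a n`. -/
theorem bender_log_coeff_asymptotic
    (a : ℕ → ℝ) (ha_pos : ∀ n, 0 < a n) (ha0 : a 0 = 1)
    (ha_super : Tendsto (fun n => a n / a (n - 1)) atTop atTop)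
    (ha_conv : ∃ C : ℝ, ∀ n : ℕ, 2 ≤ n →
      ∑ k ∈ Finset.Ico 1 n, a k * a (n - k) ≤ C * a (n - 1))
    (b : ℕ → ℝ)
    (hb : ∀ n : ℕ, 1 ≤ n →
      (n : ℝ) * a n = ∑ k ∈ Finset.Icc 1 n, (k : ℝ) * b k * a (n - k)) :
    Tendsto (fun n => b n / a n) atTop (nhds 1) := by
  obtain ⟨C, hC⟩ := ha_conv
  have hC0 : 0 ≤ C := by
    have h := hC 2 le_rfl
    have h1 : 0 ≤ ∑ k ∈ Finset.Ico 1 2, a k * a (2 - k) :=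
      Finset.sum_nonneg fun k _ => (mul_pos (ha_pos _) (ha_pos _)).le
    by_contra hneg
    have h2 := mul_neg_of_neg_of_pos (not_le.mp hneg) (ha_pos (2 - 1))
    linarith
  -- key estimate
  have key : ∀ (M : ℝ) (n : ℕ), 0 ≤ M → 2 ≤ n → (∀ k, 1 ≤ k → k < n → |b k| ≤ M * a k) →
      |b n - a n| ≤ M * (C * a (n - 1)) := by
    intro M n hM hn hk
    have hn0 : (0 : ℝ) < n := by exact_mod_cast (by omega : 0 < n)
    have h := hb n (by omega)
    have e : Finset.Icc 1 n = insert n (Finset.Ico 1 n) := by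
      ext x; simp; omega
    rw [e, Finset.sum_insert (by simp), Nat.sub_self, ha0, mul_one] at h
    have h2 : |∑ k ∈ Finset.Ico 1 n, (k : ℝ) * b k * a (n - k)| ≤
        n * (M * ∑ k ∈ Finset.Ico 1 n, a k * a (n - k)) := by
      refine (Finset.abs_sum_le_sum_abs _ _).trans ?_
      rw [Finset.mul_sum, Finset.mul_sum]
      refine Finset.sum_le_sum fun k hk' => ?_
      rw [Finset.mem_Ico] at hk'
      rw [abs_mul, abs_mul, abs_of_pos (ha_pos _), Nat.abs_cast]
      have h3 := hk k hk'.1 hk'.2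
      have h4 : (k : ℝ) ≤ n := by exact_mod_cast hk'.2.le
      have h5 : (k : ℝ) * |b k| ≤ n * (M * a k) :=
        mul_le_mul h4 h3 (abs_nonneg _) hn0.le
      calc (k : ℝ) * |b k| * a (n - k) ≤ n * (M * a k) * a (n - k) :=
            mul_le_mul_of_nonneg_right h5 (ha_pos _).le
        _ = _ := by ring
    have h6 : (n : ℝ) * |b n - a n| ≤ n * (M * (C * a (n - 1))) := by
      have h7 : (n : ℝ) * |b n - a n| =
          |∑ k ∈ Finset.Ico 1 n, (k : ℝ) * b k * a (n - k)| := by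
        rw [← abs_of_pos hn0, ← abs_mul, ← abs_neg]
        congr 1
        linarith
      rw [h7]
      refine h2.trans ?_
      gcongr
      exact hC n hn
    exact le_of_mul_le_mul_left h6 hn0
  obtain ⟨N, hN⟩ := eventually_atTop.mp (ha_super.eventually_ge_atTop (2 * C))
  set M : ℝ := 2 + ∑ k ∈ Finset.range (N + 2), |b k| / a k with hM
  have hnn : ∀ k ∈ Finset.range (N + 2), 0 ≤ |b k| / a k := fun k _ =>
    div_nonneg (abs_nonneg _) (ha_pos _).le
  have hM2 : 2 ≤ M := by
    have := Finset.sum_nonneg hnn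
    linarith
  have bound : ∀ n, |b n| ≤ M * a n := by
    intro n
    induction n using Nat.strong_induction_on with
    | _ n ih =>
      by_cases hn : n < N + 2
      · have h := Finset.single_le_sum hnn (Finset.mem_range.mpr hn)
        rw [← div_le_iff₀ (ha_pos n)]
        linarith
      · have h := key M n (by linarith) (by omega) (fun k _ hk => ih k hk)
        have h1 := hN n (by omega)
        rw [le_div_iff₀ (ha_pos _)] at h1
        have h2 : M * (C * a (n - 1)) ≤ M * (a n / 2) :=
          mul_le_mul_of_nonneg_left (by linarith) (by linarith)
        have h3 : |b n| ≤ |b n - a n| + a n := by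
          have := abs_add_le (b n - a n) (a n)
          rwa [sub_add_cancel, abs_of_pos (ha_pos n)] at this
        nlinarith [ha_pos n]
  have hlim : Tendsto (fun n => M * C * (a n / a (n - 1))⁻¹) atTop (nhds 0) := by
    simpa using (tendsto_inv_atTop_zero.comp ha_super).const_mul (M * C)
  rw [tendsto_iff_norm_sub_tendsto_zero]
  refine squeeze_zero' (Eventually.of_forall fun n => norm_nonneg _) ?_ hlim
  filter_upwards [eventually_ge_atTop 2] with n hn
  have h := key M n (by linarith) hn (fun k _ _ => bound k)
  have hp := ha_pos n
  have e : b n / a n - 1 = (b n - a n) / a n := by field_simp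
  rw [e, Real.norm_eq_abs, abs_div, abs_of_pos hp, inv_div, div_le_iff₀ hp]
  calc _ ≤ _ := h
    _ = _ := by field_simp
end

section
/- Let a_k = (2k)!/k! for k ≥ 1. Then there is a constant C such that Σ_{k=1}^{n-1} a_k a_{n-k} ≤ C·a_{n-1} for all n ≥ 2. -/
open Finset

lemma conv_bound_aux (b : ℕ → ℝ) (h0 : b 0 = 2) (hs : ∀ k : ℕ, b (k + 1) = (4 * k + 6) * b k)
    (m : ℕ) : ∑ p ∈ antidiagonal m, b p.1 * b p.2 ≤ 10 * b m := by
  have hpos : ∀ k, 0 < b k := by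
    intro k
    induction k with
    | zero => rw [h0]; norm_num
    | succ k ih => rw [hs]; positivity
  have hrec : ∀ m : ℕ, ∑ p ∈ antidiagonal (m + 1), b p.1 * b p.2
      = 2 * b (m + 1) + (2 * m + 6) * ∑ p ∈ antidiagonal m, b p.1 * b p.2 := by
    intro m
    rw [Finset.Nat.sum_antidiagonal_succ]
    simp only [h0]
    congr 1
    have e1 : ∑ p ∈ antidiagonal m, b (p.1 + 1) * b p.2
        = ∑ p ∈ antidiagonal m, b (p.2 + 1) * b p.1 :=
      (Finset.Nat.sum_antidiagonal_swap (n := m) (f := fun p => b (p.1 + 1) * b p.2)).symm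
    have e2 : ∑ p ∈ antidiagonal m, b (p.1 + 1) * b p.2
        + ∑ p ∈ antidiagonal m, b (p.2 + 1) * b p.1
        = (4 * m + 12) * ∑ p ∈ antidiagonal m, b p.1 * b p.2 := by
      rw [← Finset.sum_add_distrib, Finset.mul_sum]
      refine Finset.sum_congr rfl fun p hp => ?_
      have : (p.1 : ℝ) + p.2 = m := by exact_mod_cast mem_antidiagonal.mp hp
      rw [hs, hs, ← this]; ring
    linarith
  induction m with
  | zero => simp [h0]; norm_num
  | succ m ih =>
    rcases m with _ | m
    · rw [hrec, hs]; simp [h0]; norm_num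
    · rw [hrec, hs (m + 1)]
      have h1 := hpos (m + 1)
      have h2 := mul_le_mul_of_nonneg_left ih (by positivity : (0 : ℝ) ≤ 2 * ((m + 1 : ℕ) : ℝ) + 6)
      have h3 : 0 ≤ (m : ℝ) * b (m + 1) := by positivity
      push_cast at *
      nlinarith

/-- The convolution bound `∑_{k=1}^{n-1} a_k a_{n-k} = O(a_{n-1})`
for `a_k = (2k)!/k!`. -/
theorem convolution_bound_factorial_ratio :
    ∃ C : ℝ, ∀ n : ℕ, 2 ≤ n →
      ∑ k ∈ Finset.Ico 1 n,
          ((Nat.factorial (2 * k) : ℝ) / (Nat.factorial k : ℝ)) *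
            ((Nat.factorial (2 * (n - k)) : ℝ) / (Nat.factorial (n - k) : ℝ))
        ≤ C * ((Nat.factorial (2 * (n - 1)) : ℝ) / (Nat.factorial (n - 1) : ℝ)) := by
  refine ⟨10, fun n hn => ?_⟩
  obtain ⟨m, rfl⟩ : ∃ m, n = m + 2 := ⟨n - 2, by omega⟩
  have key := conv_bound_aux
    (fun k => (Nat.factorial (2 * (k + 1)) : ℝ) / (Nat.factorial (k + 1) : ℝ))
    (by norm_num [Nat.factorial]) (by
      intro k
      have h1 : 2 * (k + 1 + 1) = 2 * (k + 1) + 1 + 1 := by ring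
      have h2 : (Nat.factorial (k + 1) : ℝ) ≠ 0 := by positivity
      have h3 : (k : ℝ) + 1 + 1 ≠ 0 := by positivity
      rw [h1, Nat.factorial_succ (2 * (k + 1) + 1), Nat.factorial_succ (2 * (k + 1)),
        Nat.factorial_succ (k + 1)]
      push_cast
      field_simp
      ring) m
  rw [Finset.Nat.sum_antidiagonal_eq_sum_range_succ_mk] at key
  rw [Finset.sum_Ico_eq_sum_range]
  refine le_trans (le_of_eq ?_) key
  refine Finset.sum_congr rfl fun k hk => ?_
  have hk' : k < m + 1 := by simpa using hk
  have e : m + 2 - (1 + k) = m - k + 1 := by omega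
  rw [e, add_comm 1 k]
end

section
/- Let a_k = (2k)!/k! for k ≥ 0 (so a_0 = 1), and let (b_n)_{n≥1} be the unique real sequence satisfying n·a_n = Σ_{k=1}^{n} k·b_k·a_{n-k} for all n ≥ 1 (the coefficients of the formal logarithm of Σ_{k≥0} a_k z^k). Then b_n ∼ (2n)!/n! as n → ∞, i.e., b_n·n!/(2n)! → 1. -/
open Filter Finset

noncomputable def mapA (n : ℕ) : ℝ := (Nat.factorial (2 * n) : ℝ) / (Nat.factorial n : ℝ)

noncomputable def mapU (n : ℕ) : ℝ := ∑ k ∈ Finset.range (n + 1), mapA k * mapA (n - k)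

lemma mapA_pos (n : ℕ) : 0 < mapA n := by unfold mapA; positivity

lemma mapA_zero : mapA 0 = 1 := by simp [mapA]

lemma mapA_succ (n : ℕ) : mapA (n + 1) = (4 * n + 2) * mapA n := by
  unfold mapA
  rw [show 2 * (n + 1) = 2 * n + 1 + 1 by ring, Nat.factorial_succ, Nat.factorial_succ,
    Nat.factorial_succ n]
  have := Nat.factorial_pos n
  push_cast
  field_simp
  ring

lemma mapS (n : ℕ) :
    ∑ k ∈ Finset.range (n + 1), (k : ℝ) * (mapA k * mapA (n - k)) = n / 2 * mapU n := by
  have h := Finset.sum_range_reflect (fun k => (k : ℝ) * (mapA k * mapA (n - k))) (n + 1)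
  have h2 : ∑ k ∈ Finset.range (n + 1), (k : ℝ) * (mapA k * mapA (n - k)) +
      ∑ k ∈ Finset.range (n + 1), (k : ℝ) * (mapA k * mapA (n - k)) = n * mapU n := by
    nth_rewrite 1 [← h]
    rw [← Finset.sum_add_distrib, mapU, Finset.mul_sum]
    apply Finset.sum_congr rfl
    intro k hk
    have hk' : k ≤ n := by simpa [Nat.lt_succ_iff] using hk
    have e1 : n + 1 - 1 - k = n - k := by omega
    have e2 : n - (n - k) = k := by omega
    simp only [e1, e2]
    rw [Nat.cast_sub hk']
    ring
  linarith

lemma mapU_succ (n : ℕ) : mapU (n + 1) = (2 * n + 2) * mapU n + mapA (n + 1) := by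
  have h := mapS n
  rw [mapU, Finset.sum_range_succ']
  have : ∑ k ∈ Finset.range (n + 1), mapA (k + 1) * mapA (n + 1 - (k + 1)) =
      4 * ∑ k ∈ Finset.range (n + 1), (k : ℝ) * (mapA k * mapA (n - k)) + 2 * mapU n := by
    rw [mapU, Finset.mul_sum, Finset.mul_sum, ← Finset.sum_add_distrib]
    apply Finset.sum_congr rfl
    intro k hk
    rw [mapA_succ, show n + 1 - (k + 1) = n - k by omega]
    ring
  rw [this, h, mapA_zero]
  simp
  ring

noncomputable def mapT (n : ℕ) : ℝ := mapU n / mapA n - 2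

lemma mapT_succ (n : ℕ) : mapT (n + 1) = ((n + 1) * mapT n + 1) / (2 * n + 1) := by
  unfold mapT
  rw [mapU_succ, mapA_succ]
  have := mapA_pos n
  field_simp
  ring

lemma mapT_one : mapT 1 = 0 := by
  have : mapT 0 = -1 := by simp [mapT, mapU, mapA_zero]; norm_num
  have h := mapT_succ 0
  rw [this] at h
  simpa using h

lemma mapT_le_one (n : ℕ) : mapT (n + 1) ≤ 1 := by
  induction n with
  | zero => simp [mapT_one]
  | succ n ih =>
    rw [mapT_succ, div_le_one (by positivity)]
    push_cast
    have : (0 : ℝ) ≤ n := by positivity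
    nlinarith

lemma mapT_le (n : ℕ) : mapT (n + 4) ≤ 2 / (n + 4) := by
  induction n with
  | zero =>
    have h1 := mapT_succ 1
    have h2 := mapT_succ 2
    have h3 := mapT_succ 3
    norm_num [mapT_one] at h1 h2 h3
    rw [h1] at h2
    rw [h2] at h3
    norm_num at h3 ⊢
    rw [h3]; norm_num
  | succ n ih =>
    rw [show n + 1 + 4 = (n + 4) + 1 by ring, mapT_succ, div_le_div_iff₀ (by positivity) (by positivity)]
    rw [le_div_iff₀ (by positivity)] at ih
    push_cast
    have : (0 : ℝ) ≤ n := by positivity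
    have h : mapT (n + 4) ≤ 2 / (n + 4) := by rwa [le_div_iff₀ (by positivity)]
    calc _ ≤ (((n : ℝ) + 4 + 1) * (2 / (n + 4)) + 1) * (n + 1 + 4) := by gcongr
      _ ≤ _ := by
        rw [← sub_nonneg]
        have : 2 * (2 * ((n : ℝ) + 4) + 1) - (((n : ℝ) + 4 + 1) * (2 / (n + 4)) + 1) * (n + 1 + 4)
          = (n ^ 2 + 5 * n + 2) / (n + 4) := by field_simp; ring
        rw [this]; positivity

lemma main_bound (b : ℕ → ℝ)
    (hb : ∀ n : ℕ, 1 ≤ n →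
      (n : ℝ) * mapA n = ∑ k ∈ Finset.Icc 1 n, (k : ℝ) * b k * mapA (n - k))
    (n : ℕ) (hn : 1 ≤ n) (ih : ∀ k < n, |(k : ℝ) * b k| ≤ 2 * (k * mapA k)) :
    |(n : ℝ) * b n - n * mapA n| ≤ n * (mapT n * mapA n) := by
  have h0 : ∑ k ∈ Finset.Icc 1 n, (k : ℝ) * b k * mapA (n - k) =
      ∑ k ∈ Finset.range (n + 1), (k : ℝ) * b k * mapA (n - k) := by
    apply Finset.sum_subset
    · intro k hk
      simp at hk ⊢; omega
    · intro k hk hk'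
      simp at hk hk'
      have : k = 0 := by by_contra h; have := hk' (by omega); omega
      simp [this]
  have h1 := hb n hn
  rw [h0, Finset.sum_range_succ] at h1
  have h2 := mapS n
  rw [Finset.sum_range_succ] at h2
  simp only [Nat.sub_self, mapA_zero, mul_one] at h1 h2
  have h3 : (n : ℝ) * b n - n * mapA n = - ∑ k ∈ Finset.range n, (k : ℝ) * b k * mapA (n - k) := by
    linarith
  rw [h3, abs_neg]
  have hT : mapT n * mapA n = mapU n - 2 * mapA n := by
    have := mapA_pos n
    unfold mapT; field_simp
  calc _ ≤ ∑ k ∈ Finset.range n, |(k : ℝ) * b k * mapA (n - k)| := Finset.abs_sum_le_sum_abs _ _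
    _ ≤ ∑ k ∈ Finset.range n, 2 * ((k : ℝ) * (mapA k * mapA (n - k))) := by
      apply Finset.sum_le_sum
      intro k hk
      rw [abs_mul, abs_of_pos (mapA_pos (n - k))]
      have := mul_le_mul_of_nonneg_right (ih k (by simpa using hk)) (mapA_pos (n - k)).le
      linarith
    _ = n * (mapT n * mapA n) := by
      rw [← Finset.mul_sum, hT]
      linarith

lemma main_bound2 (b : ℕ → ℝ)
    (hb : ∀ n : ℕ, 1 ≤ n →
      (n : ℝ) * mapA n = ∑ k ∈ Finset.Icc 1 n, (k : ℝ) * b k * mapA (n - k))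
    (n : ℕ) : |(n : ℝ) * b n| ≤ 2 * (n * mapA n) := by
  induction n using Nat.strong_induction_on with
  | _ n ih =>
    rcases n with _ | n
    · simp
    · have h := main_bound b hb (n + 1) (by omega) ih
      have hA := mapA_pos (n + 1)
      have h1 : ((n + 1 : ℕ) : ℝ) * (mapT (n + 1) * mapA (n + 1)) ≤
          ((n + 1 : ℕ) : ℝ) * (1 * mapA (n + 1)) := by
        have := mapT_le_one n
        gcongr
      have h2 : 0 ≤ ((n + 1 : ℕ) : ℝ) * mapA (n + 1) := by positivity
      rw [abs_le] at h ⊢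
      constructor <;> linarith [h.1, h.2]

/-- If `b` is the coefficient sequence of the formal logarithm of
`∑_{k≥0} ((2k)!/k!) z^k`, then `b n ∼ (2n)!/n!`. -/
theorem log_coeff_asymptotic_maps
    (b : ℕ → ℝ)
    (hb : ∀ n : ℕ, 1 ≤ n →
      (n : ℝ) * ((Nat.factorial (2 * n) : ℝ) / (Nat.factorial n : ℝ)) =
        ∑ k ∈ Finset.Icc 1 n, (k : ℝ) * b k *
          ((Nat.factorial (2 * (n - k)) : ℝ) / (Nat.factorial (n - k) : ℝ))) :
    Tendsto
      (fun n => b n * (Nat.factorial n : ℝ) / (Nat.factorial (2 * n) : ℝ))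
      atTop (nhds 1) := by
  have hb' : ∀ n : ℕ, 1 ≤ n →
      (n : ℝ) * mapA n = ∑ k ∈ Finset.Icc 1 n, (k : ℝ) * b k * mapA (n - k) := hb
  have key : ∀ n : ℕ, 4 ≤ n →
      |b n * (Nat.factorial n : ℝ) / (Nat.factorial (2 * n) : ℝ) - 1| ≤ 2 / (n : ℝ) := by
    intro n hn
    have e : b n * (Nat.factorial n : ℝ) / (Nat.factorial (2 * n) : ℝ) = b n / mapA n := by
      unfold mapA
      rw [div_div_eq_mul_div]
    have hA := mapA_pos n
    have hn0 : (0 : ℝ) < n := by exact_mod_cast (by omega : 0 < n)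
    have h := main_bound b hb' n (by omega) (fun k _ => main_bound2 b hb' k)
    rw [← mul_sub, abs_mul, abs_of_pos hn0] at h
    have h' := le_of_mul_le_mul_left h hn0
    have hT : mapT n ≤ 2 / n := by
      obtain ⟨m, rfl⟩ := Nat.exists_eq_add_of_le' hn
      simpa using mapT_le m
    rw [e, div_sub_one hA.ne', abs_div, abs_of_pos hA]
    exact ((div_le_iff₀ hA).2 h').trans hT
  rw [tendsto_iff_norm_sub_tendsto_zero]
  refine squeeze_zero' (Eventually.of_forall fun n => norm_nonneg _) ?_
    (tendsto_const_div_atTop_nhds_zero_nat 2)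
  filter_upwards [eventually_ge_atTop 4] with n hn
  exact key n hn
end

section
/- Fix an integer d ≥ 2 and let a_m = (2md)! / ((2d)^m · m! · (md)!) for m ≥ 0. Then for all integers m ≥ 2 and k with 1 ≤ k ≤ m/2, one has a_k·a_{m-k} ≤ a_{k-1}·a_{m-k+1}. Consequently Σ_{k=1}^{m-1} a_k a_{m-k} = O(a_{m-1}) as m → ∞. -/
open Finset

namespace ERC

noncomputable def P (n : ℕ) (d : ℕ) : ℝ := ∏ j ∈ Finset.range d, (2 * (n : ℝ) + 2 * j + 1)

lemma P_succ (n d : ℕ) : P n (d + 1) = P n d * (2 * (n : ℝ) + 2 * d + 1) := by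
  simp [P, Finset.prod_range_succ]

lemma P_one_le (n d : ℕ) : 1 ≤ P n d := by
  induction d with
  | zero => simp [P]
  | succ d ih =>
    rw [P_succ]
    have : (1 : ℝ) ≤ 2 * (n : ℝ) + 2 * d + 1 := by
      have : (0 : ℝ) ≤ 2 * (n : ℝ) + 2 * d := by positivity
      linarith
    nlinarith

lemma P_mono {n n' : ℕ} (h : n ≤ n') (d : ℕ) : P n d ≤ P n' d := by
  unfold P
  gcongr

lemma fact_id (n d : ℕ) :
    ((2 * (n + d)).factorial : ℝ) * n.factorial
      = (2 * n).factorial * (n + d).factorial * 2 ^ d * P n d := by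
  induction d with
  | zero => simp [P]
  | succ d ih =>
    rw [P_succ, show 2 * (n + (d + 1)) = 2 * (n + d) + 1 + 1 by ring,
      show n + (d + 1) = n + d + 1 by ring, Nat.factorial_succ, Nat.factorial_succ,
      Nat.factorial_succ (n + d)]
    push_cast
    push_cast at ih
    linear_combination ((2 * ((n : ℝ) + d) + 1 + 1) * (2 * ((n : ℝ) + d) + 1)) * ih

noncomputable def r (d m : ℕ) : ℝ := 2 ^ d * P (m * d) d / (2 * d * (m + 1))

noncomputable def a (d m : ℕ) : ℝ :=
  (Nat.factorial (2 * m * d) : ℝ) /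
        ((2 * d : ℝ) ^ m * (Nat.factorial m : ℝ) * (Nat.factorial (m * d) : ℝ))

lemma a_pos {d : ℕ} (hd : 2 ≤ d) (m : ℕ) : 0 < a d m := by
  unfold a
  have : (0 : ℝ) < d := by exact_mod_cast (by omega : 0 < d)
  positivity

lemma a_succ {d : ℕ} (hd : 2 ≤ d) (m : ℕ) : a d (m + 1) = r d m * a d m := by
  have h := fact_id (m * d) d
  have : (0 : ℝ) < d := by exact_mod_cast (by omega : 0 < d)
  unfold a r
  rw [show 2 * (m + 1) * d = 2 * (m * d + d) by ring, show (m + 1) * d = m * d + d by ring,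
    show 2 * m * d = 2 * (m * d) by ring, Nat.factorial_succ]
  push_cast
  rw [div_mul_div_comm, div_eq_div_iff (by positivity) (by positivity)]
  linear_combination (2 * d * (m + 1) * (2 * d) ^ m * (m.factorial : ℝ)) * h

lemma r_step {d : ℕ} (hd : 2 ≤ d) (m : ℕ) : r d m ≤ r d (m + 1) := by
  obtain ⟨c, rfl⟩ : ∃ c, d = c + 1 := ⟨d - 1, by omega⟩
  unfold r
  rw [P_succ, P_succ, div_le_div_iff₀ (by positivity) (by positivity)]
  have h1 : P (m * (c + 1)) c ≤ P ((m + 1) * (c + 1)) c := P_mono (by gcongr; omega) c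
  have h0 := P_one_le (m * (c + 1)) c
  have h2 : (2 * ((m * (c + 1) : ℕ) : ℝ) + 2 * c + 1) * ((m + 1 : ℕ) + 1)
      ≤ (2 * (((m + 1) * (c + 1) : ℕ) : ℝ) + 2 * c + 1) * (m + 1) := by
    push_cast
    nlinarith
  have h3 := mul_le_mul h1 h2 (by positivity) (by linarith)
  have h4 : (0 : ℝ) ≤ 2 ^ (c + 1) * (2 * (c + 1 : ℕ)) := by positivity
  have h5 := mul_le_mul_of_nonneg_left h3 h4
  linarith

lemma r_mono {d : ℕ} (hd : 2 ≤ d) : Monotone (r d) := monotone_nat_of_le_succ (r_step hd)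

lemma r_ge {d : ℕ} (hd : 2 ≤ d) (m : ℕ) : (m : ℝ) ≤ r d m := by
  obtain ⟨c, rfl⟩ : ∃ c, d = c + 2 := ⟨d - 2, by omega⟩
  unfold r
  rw [P_succ, P_succ, le_div_iff₀ (by positivity)]
  have h0 := P_one_le (m * (c + 2)) c
  have hp : (1 : ℝ) ≤ 2 ^ c := one_le_pow₀ (by norm_num)
  have h1 : (1 : ℝ) ≤ 2 ^ c * P (m * (c + 2)) c := by nlinarith
  push_cast
  have hm : (0 : ℝ) ≤ m := by positivity
  have hc : (0 : ℝ) ≤ c := by positivity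
  set Q := 2 ^ c * P (m * (c + 2)) c with hQ
  have hA : (m : ℝ) ≤ 2 * (m * (c + 2)) + 2 * c + 1 := by nlinarith [mul_nonneg hm hc]
  have hB : 2 * ((c : ℝ) + 2) * (m + 1) ≤ 4 * (2 * (m * (c + 2)) + 2 * (c + 1) + 1) := by
    nlinarith [mul_nonneg hm hc]
  have hAB := mul_le_mul hA hB (by positivity) (by positivity)
  have := mul_le_mul h1 hAB (by positivity) (by linarith)
  calc _ ≤ _ := by simpa using this
    _ = _ := by rw [hQ]; ring

lemma part1 {d : ℕ} (hd : 2 ≤ d) (m k : ℕ) (hk : 1 ≤ k) (h : 2 * k ≤ m) :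
    a d k * a d (m - k) ≤ a d (k - 1) * a d (m - k + 1) := by
  obtain ⟨k, rfl⟩ : ∃ j, k = j + 1 := ⟨k - 1, by omega⟩
  rw [a_succ hd (m - (k + 1)), a_succ hd k, Nat.add_sub_cancel]
  have h1 : r d k ≤ r d (m - (k + 1)) := r_mono hd (by omega)
  have := mul_le_mul_of_nonneg_right h1 (mul_pos (a_pos hd k) (a_pos hd (m - (k + 1)))).le
  linarith

lemma mid {d : ℕ} (hd : 2 ≤ d) (m k : ℕ) (hk : 2 ≤ k) :
    2 * k ≤ m → a d k * a d (m - k) ≤ a d 2 * a d (m - 2) := by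
  induction k, hk using Nat.le_induction with
  | base => intro _; exact le_rfl
  | succ k hk ih =>
    intro h
    have h1 := part1 hd m (k + 1) (by omega) h
    rw [Nat.add_sub_cancel, show m - (k + 1) + 1 = m - k by omega] at h1
    exact h1.trans (ih (by omega))

lemma mid' {d : ℕ} (hd : 2 ≤ d) (m k : ℕ) (hk : 2 ≤ k) (h : k + 2 ≤ m) :
    a d k * a d (m - k) ≤ a d 2 * a d (m - 2) := by
  rcases le_total (2 * k) m with h' | h'
  · exact mid hd m k hk h'
  · have := mid hd m (m - k) (by omega) (by omega)
    rwa [show m - (m - k) = k by omega, mul_comm] at this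

lemma part2 {d : ℕ} (hd : 2 ≤ d) (m : ℕ) (hm : 2 ≤ m) :
    ∑ k ∈ Finset.Ico 1 m, a d k * a d (m - k) ≤ (2 * a d 1 + a d 2) * a d (m - 1) := by
  have p1 := a_pos hd 1
  have p2 := a_pos hd 2
  obtain ⟨n, rfl⟩ : ∃ n, m = n + 2 := ⟨m - 2, by omega⟩
  rcases n with _ | n
  · simp
    nlinarith
  rw [Finset.sum_Ico_succ_top (by omega), Finset.sum_eq_sum_Ico_succ_bot (by omega)]
  have hs : ∑ k ∈ Finset.Ico (1 + 1) (n + 1 + 1), a d k * a d (n + 1 + 2 - k)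
      ≤ n * (a d 2 * a d (n + 1)) := by
    have := Finset.sum_le_card_nsmul (Finset.Ico (1 + 1) (n + 1 + 1))
      (fun k => a d k * a d (n + 1 + 2 - k)) (a d 2 * a d (n + 1)) (by
        intro k hk
        rw [Finset.mem_Ico] at hk
        exact mid' hd (n + 1 + 2) k (by omega) (by omega))
    simpa using this
  have h1 : (n : ℝ) * a d (n + 1) ≤ a d (n + 2) := by
    rw [a_succ hd (n + 1)]
    have := r_ge hd (n + 1)
    push_cast at this
    exact mul_le_mul_of_nonneg_right (by linarith) (a_pos hd _).le
  have h2 := mul_le_mul_of_nonneg_left h1 p2.le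
  rw [show n + 1 + 2 - 1 = n + 2 by omega, show n + 1 + 2 - (n + 1 + 1) = 1 by omega,
    show n + 1 + 1 = n + 2 by omega] at *
  linarith

end ERC

/-- For fixed `d ≥ 2` and `a_m = (2md)! / ((2d)^m · m! · (md)!)`:
`a_k a_{m-k} ≤ a_{k-1} a_{m-k+1}` for `1 ≤ k ≤ m/2`, and consequently
`∑_{k=1}^{m-1} a_k a_{m-k} = O(a_{m-1})`. -/
theorem even_regular_convolution_bound (d : ℕ) (hd : 2 ≤ d) :
    let a : ℕ → ℝ := fun m =>
      (Nat.factorial (2 * m * d) : ℝ) /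
        ((2 * d : ℝ) ^ m * (Nat.factorial m : ℝ) * (Nat.factorial (m * d) : ℝ))
    (∀ m k : ℕ, 2 ≤ m → 1 ≤ k → 2 * k ≤ m →
        a k * a (m - k) ≤ a (k - 1) * a (m - k + 1)) ∧
      ∃ C : ℝ, ∀ m : ℕ, 2 ≤ m →
        ∑ k ∈ Finset.Ico 1 m, a k * a (m - k) ≤ C * a (m - 1) := by
  intro a
  exact ⟨fun m k _ hk h => ERC.part1 hd m k hk h,
    2 * ERC.a d 1 + ERC.a d 2, fun m hm => ERC.part2 hd m hm⟩
end

section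
/- Fix an odd integer r ≥ 3 and let a_k = (2kr)! / (r^{2k} · (2k)! · (kr)!) for k ≥ 0. Then a_n/a_{n-1} ∼ 2^{2r-2}·(nr)^{r-2} as n → ∞; in particular the sequence (a_n) grows super-exponentially. -/
open Filter

lemma factorial_step_ratio (c : ℕ) (hc : 1 ≤ c) :
    Tendsto (fun m : ℕ => (Nat.factorial ((m + 1) * c) : ℝ) / (Nat.factorial (m * c) : ℝ) /
      (((m + 1 : ℕ) : ℝ) * c) ^ c) atTop (nhds 1) := by
  have hc0 : (c : ℝ) ≠ 0 := by positivity
  have key : ∀ m : ℕ, (Nat.factorial ((m + 1) * c) : ℝ) / (Nat.factorial (m * c) : ℝ) /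
      (((m + 1 : ℕ) : ℝ) * c) ^ c =
      ∏ i ∈ Finset.range c, (1 + (((1 : ℝ) + i - c) / c) * (1 / ((m : ℝ) + 1))) := by
    intro m
    have h1 : (m + 1) * c = m * c + c := by ring
    have hf : (Nat.factorial (m * c) : ℝ) ≠ 0 := by positivity
    rw [h1, ← Nat.factorial_mul_ascFactorial, Nat.ascFactorial_eq_prod_range]
    push_cast
    rw [mul_div_cancel_left₀ _ hf]
    have h2 : (((m : ℝ) + 1) * c) ^ c = ∏ i ∈ Finset.range c, (((m : ℝ) + 1) * c) := by
      simp
    rw [h2, ← Finset.prod_div_distrib]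
    refine Finset.prod_congr rfl fun i _ => ?_
    have : (m : ℝ) + 1 ≠ 0 := by positivity
    field_simp
    ring
  simp_rw [key]
  have : (1 : ℝ) = ∏ i ∈ Finset.range c, (1 + (((1 : ℝ) + i - c) / c) * 0) := by simp
  rw [this]
  refine tendsto_finset_prod _ fun i _ => ?_
  simp only [mul_zero, add_zero, Finset.prod_const_one]
  have := ((tendsto_one_div_add_atTop_nhds_zero_nat (𝕜 := ℝ)).const_mul
    (((1 : ℝ) + i - c) / c)).const_add 1
  simpa using this

/-- For fixed odd `r ≥ 3` and `a_k = (2kr)! / (r^{2k} · (2k)! · (kr)!)`, one has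
`a_n / a_{n-1} ∼ 2^{2r-2} (nr)^{r-2}`; in particular `(a_n)` grows
super-exponentially. -/
theorem odd_regular_ratio_asymptotic (r : ℕ) (hr : 3 ≤ r) (hodd : Odd r) :
    let a : ℕ → ℝ := fun k =>
      (Nat.factorial (2 * k * r) : ℝ) /
        ((r : ℝ) ^ (2 * k) * (Nat.factorial (2 * k) : ℝ) * (Nat.factorial (k * r) : ℝ))
    Tendsto (fun n => (a n / a (n - 1)) /
        (2 ^ (2 * r - 2) * ((n * r : ℕ) : ℝ) ^ (r - 2))) atTop (nhds 1) ∧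
      Tendsto (fun n => a n / a (n - 1)) atTop atTop := by
  intro a
  have main : Tendsto (fun n => (a n / a (n - 1)) /
        (2 ^ (2 * r - 2) * ((n * r : ℕ) : ℝ) ^ (r - 2))) atTop (nhds 1) := by
    rw [← tendsto_add_atTop_iff_nat 1]
    have h := (factorial_step_ratio (2 * r) (by omega)).div
      ((factorial_step_ratio 2 (by omega)).mul (factorial_step_ratio r (by omega))) (by norm_num)
    simp only [mul_one, div_one] at h
    refine h.congr fun m => ?_
    simp only [a, Pi.div_apply, Nat.add_sub_cancel]
    have e1 : 2 * (m + 1) * r = (m + 1) * (2 * r) := by ring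
    have e2 : 2 * m * r = m * (2 * r) := by ring
    rw [e1, e2, mul_comm 2 (m + 1), mul_comm 2 m]
    have p1 : (Nat.factorial ((m + 1) * (2 * r)) : ℝ) ≠ 0 := by positivity
    have p2 : (Nat.factorial (m * (2 * r)) : ℝ) ≠ 0 := by positivity
    have p3 : (Nat.factorial ((m + 1) * 2) : ℝ) ≠ 0 := by positivity
    have p4 : (Nat.factorial (m * 2) : ℝ) ≠ 0 := by positivity
    have p5 : (Nat.factorial ((m + 1) * r) : ℝ) ≠ 0 := by positivity
    have p6 : (Nat.factorial (m * r) : ℝ) ≠ 0 := by positivity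
    generalize (Nat.factorial ((m + 1) * (2 * r)) : ℝ) = A at *
    generalize (Nat.factorial (m * (2 * r)) : ℝ) = B at *
    generalize (Nat.factorial ((m + 1) * 2) : ℝ) = C at *
    generalize (Nat.factorial (m * 2) : ℝ) = D at *
    generalize (Nat.factorial ((m + 1) * r) : ℝ) = E at *
    generalize (Nat.factorial (m * r) : ℝ) = F at *
    obtain ⟨s, rfl⟩ : ∃ s, r = s + 2 := ⟨r - 2, by omega⟩
    have q1 : 2 * (s + 2) - 2 = 2 * s + 2 := by omega
    have q2 : s + 2 - 2 = s := by omega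
    rw [q1, q2]
    have hx : ((m + 1 : ℕ) : ℝ) ≠ 0 := by positivity
    have hy : ((s + 2 : ℕ) : ℝ) ≠ 0 := by positivity
    rw [Nat.cast_mul, Nat.cast_mul]
    generalize ((m + 1 : ℕ) : ℝ) = x at *
    generalize ((s + 2 : ℕ) : ℝ) = y at *
    have t1 : (x * (((2 : ℕ) : ℝ) * y)) ^ (2 * (s + 2)) =
        2 ^ (2 * s + 2) * (x * y) ^ s * (4 * (x * y) ^ (s + 2) * (x * y) ^ 2) := by
      push_cast
      ring
    have t2 : y ^ ((m + 1) * 2) = y ^ (m * 2) * y ^ 2 := by ring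
    rw [t1, t2]
    push_cast
    have u1 : (x * y) ^ s ≠ 0 := by positivity
    have u2 : (x * y) ^ (s + 2) ≠ 0 := by positivity
    have u3 : y ^ (m * 2) ≠ 0 := by positivity
    have u4 : (2 : ℝ) ^ (2 * s + 2) ≠ 0 := by positivity
    generalize (x * y) ^ s = U at *
    generalize (x * y) ^ (s + 2) = V at *
    generalize y ^ (m * 2) = W at *
    generalize (2 : ℝ) ^ (2 * s + 2) = Z at *
    field_simp
    try ring
  refine ⟨main, ?_⟩
  have hg : Tendsto (fun n : ℕ => (2 : ℝ) ^ (2 * r - 2) * ((n * r : ℕ) : ℝ) ^ (r - 2))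
      atTop atTop := by
    refine Tendsto.const_mul_atTop (by positivity) ?_
    refine (tendsto_pow_atTop (by omega)).comp ?_
    exact tendsto_natCast_atTop_atTop.comp (tendsto_id.atTop_mul_const' (by omega))
  refine (main.pos_mul_atTop one_pos hg).congr' ?_
  filter_upwards [eventually_gt_atTop 0] with n hn
  have : (0 : ℝ) < ((n * r : ℕ) : ℝ) := by
    have : 0 < n * r := by positivity
    exact_mod_cast this
  exact div_mul_cancel₀ _ (by positivity)
end

section
/- Fix an odd integer r ≥ 3 and let a_k = (2kr)! / (r^{2k} · (2k)! · (kr)!) for k ≥ 0. Then for all integers n ≥ 2 and k with 1 ≤ k ≤ n/2, one has a_k·a_{n-k} ≤ a_{k-1}·a_{n-k+1}. Consequently Σ_{k=1}^{n-1} a_k a_{n-k} = O(a_{n-1}) as n → ∞. -/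
open Finset

lemma abs_step (a q : ℕ → ℝ) (ha : ∀ k, 0 < a k) (hq : ∀ k, a (k+1) = q k * a k)
    (hm : Monotone q) (n k : ℕ) (hk : 1 ≤ k) (hkn : 2 * k ≤ n) :
    a k * a (n - k) ≤ a (k - 1) * a (n - k + 1) := by
  obtain ⟨j, rfl⟩ : ∃ j, k = j + 1 := ⟨k - 1, by omega⟩
  obtain ⟨l, hl⟩ : ∃ l, l = n - (j + 1) := ⟨_, rfl⟩
  rw [← hl, hq j, hq l, Nat.add_sub_cancel]
  have h1 : q j ≤ q l := hm (by omega)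
  have h2 : 0 < a j * a l := mul_pos (ha j) (ha l)
  nlinarith

lemma abs_mono (a q : ℕ → ℝ) (ha : ∀ k, 0 < a k) (hq : ∀ k, a (k+1) = q k * a k)
    (hm : Monotone q) (n i k : ℕ) (hik : i ≤ k) :
    2 * k ≤ n → a k * a (n - k) ≤ a i * a (n - i) := by
  induction k, hik using Nat.le_induction with
  | base => intro _; exact le_rfl
  | succ k hk ih =>
    intro h
    have h1 := abs_step a q ha hq hm n (k+1) (by omega) h
    have e : n - (k + 1) + 1 = n - k := by omega
    rw [e, Nat.add_sub_cancel] at h1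
    exact h1.trans (ih (by omega))

lemma abs_sum (a q : ℕ → ℝ) (ha : ∀ k, 0 < a k) (hq : ∀ k, a (k+1) = q k * a k)
    (hm : Monotone q) (hl : ∀ k : ℕ, (k : ℝ) + 1 ≤ q k) (n : ℕ) (hn : 2 ≤ n) :
    ∑ k ∈ Finset.Ico 1 n, a k * a (n - k) ≤ (2 * a 1 + a 2) * a (n - 1) := by
  obtain ⟨p, rfl⟩ : ∃ p, n = p + 2 := ⟨n - 2, by omega⟩
  have e1 : p + 2 - 1 = p + 1 := by omega
  rw [e1]
  have hg : ((p : ℝ) + 1) * a p ≤ a (p + 1) := by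
    rw [hq p]; exact mul_le_mul_of_nonneg_right (hl p) (ha p).le
  have hA : 0 < a 1 * a (p+1) := mul_pos (ha _) (ha _)
  have hB : 0 < a 2 * a p := mul_pos (ha _) (ha _)
  have key : ∀ k ∈ Finset.Ico 1 (p+2), a k * a (p + 2 - k) ≤
      a 2 * a p + (if k = 1 then a 1 * a (p+1) else 0)
        + (if k = p + 1 then a 1 * a (p+1) else 0) := by
    intro k hk
    rw [Finset.mem_Ico] at hk
    by_cases h1 : k = 1
    · subst h1
      rw [e1, if_pos rfl]
      split_ifs <;> linarith
    by_cases h2 : k = p + 1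
    · subst h2
      have : p + 2 - (p + 1) = 1 := by omega
      rw [this, if_pos rfl]
      split_ifs <;> linarith
    rw [if_neg h1, if_neg h2, add_zero, add_zero]
    by_cases h3 : 2 * k ≤ p + 2
    · simpa using abs_mono a q ha hq hm (p+2) 2 k (by omega) h3
    · have := abs_mono a q ha hq hm (p+2) 2 (p + 2 - k) (by omega) (by omega)
      have e : p + 2 - (p + 2 - k) = k := by omega
      rw [e, mul_comm] at this
      simpa using this
  refine (Finset.sum_le_sum key).trans ?_
  rw [Finset.sum_add_distrib, Finset.sum_add_distrib, Finset.sum_ite_eq', Finset.sum_ite_eq',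
    Finset.sum_const, Nat.card_Ico, if_pos (by simp), if_pos (by simp), nsmul_eq_mul, e1]
  push_cast
  nlinarith [ha 2]

lemma fact_step (n j : ℕ) :
    (Nat.factorial (2 * (n + j)) : ℝ) * (Nat.factorial n : ℝ) =
      (∏ i ∈ Finset.range j, (2 * (2 * ((n : ℝ) + i) + 1))) *
        ((Nat.factorial (2 * n) : ℝ) * (Nat.factorial (n + j) : ℝ)) := by
  induction j with
  | zero => simp
  | succ j ih =>
    have e : 2 * (n + (j + 1)) = 2 * (n + j) + 1 + 1 := by ring
    rw [e, Nat.factorial_succ, Nat.factorial_succ, Finset.prod_range_succ, ← add_assoc,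
      Nat.factorial_succ (n + j)]
    push_cast
    linear_combination (2 * ((n : ℝ) + j) + 1 + 1) * (2 * ((n : ℝ) + j) + 1) * ih

lemma prod_split (f : ℕ → ℝ) (s : ℕ) :
    ∏ i ∈ Finset.range (2 * s + 3), f i =
      (∏ i ∈ Finset.range s, f (i + 1)) * f 0 * (∏ i ∈ Finset.range s, f (s + 2 + i))
        * (f (s + 1) * f (2 * s + 2)) := by
  have e : 2 * s + 3 = (s + 2 + s) + 1 := by ring
  rw [e, Finset.prod_range_succ, Finset.prod_range_add, Finset.prod_range_succ,
    Finset.prod_range_succ']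
  have e2 : s + 2 + s = 2 * s + 2 := by ring
  rw [e2]; ring

theorem odd_regular_convolution_bound (r : ℕ) (hr : 3 ≤ r) (hodd : Odd r) :
    let a : ℕ → ℝ := fun k =>
      (Nat.factorial (2 * k * r) : ℝ) /
        ((r : ℝ) ^ (2 * k) * (Nat.factorial (2 * k) : ℝ) * (Nat.factorial (k * r) : ℝ))
    (∀ n k : ℕ, 2 ≤ n → 1 ≤ k → 2 * k ≤ n →
        a k * a (n - k) ≤ a (k - 1) * a (n - k + 1)) ∧
      ∃ C : ℝ, ∀ n : ℕ, 2 ≤ n →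
        ∑ k ∈ Finset.Ico 1 n, a k * a (n - k) ≤ C * a (n - 1) := by
  intro a
  obtain ⟨s, hs⟩ : ∃ s, r = 2 * s + 3 := by
    obtain ⟨m, rfl⟩ := hodd
    exact ⟨m - 1, by omega⟩
  have hr0 : (3 : ℝ) ≤ r := by exact_mod_cast hr
  have hrp : (0 : ℝ) < r := by linarith
  have hsr : (r : ℝ) = 2 * s + 3 := by rw [hs]; push_cast; ring
  have ha : ∀ k, 0 < a k := by intro k; simp only [a]; positivity
  let f : ℕ → ℕ → ℝ := fun k i => 2 * (2 * (((k * r : ℕ) : ℝ) + i) + 1)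
  have hf1 : ∀ k i, 1 ≤ f k i := by
    intro k i
    have h1 : (0 : ℝ) ≤ ((k * r : ℕ) : ℝ) := Nat.cast_nonneg _
    have h2 : (0 : ℝ) ≤ (i : ℝ) := Nat.cast_nonneg _
    simp only [f]; linarith
  have hf0 : ∀ k i, 0 ≤ f k i := fun k i => zero_le_one.trans (hf1 k i)
  have hfm : ∀ i, Monotone (fun k => f k i) := by
    intro i k l h
    have : ((k * r : ℕ) : ℝ) ≤ ((l * r : ℕ) : ℝ) := by
      exact_mod_cast Nat.mul_le_mul_right r h
    simp only [f]; linarith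
  let g : ℕ → ℝ := fun k => 4 - 2 / (r * ((k : ℝ) + 1))
  have hg1 : ∀ k, 1 ≤ g k := by
    intro k
    have h2 : (0 : ℝ) ≤ (k : ℝ) := Nat.cast_nonneg _
    have : 2 / ((r : ℝ) * ((k : ℝ) + 1)) ≤ 1 := by
      rw [div_le_one (by positivity)]; nlinarith
    simp only [g]; linarith
  have hgm : Monotone g := by
    intro k l h
    have h' : (k : ℝ) ≤ l := by exact_mod_cast h
    simp only [g]
    gcongr
  let P : ℕ → ℝ := fun k => ∏ i ∈ Finset.range s, f k (i + 1)
  let Q : ℕ → ℝ := fun k => ∏ i ∈ Finset.range s, f k (s + 2 + i)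
  have hone : ∀ h : ℕ → ℝ, (∀ i, 1 ≤ h i) → 1 ≤ ∏ i ∈ Finset.range s, h i := by
    intro h hh
    have := Finset.prod_le_prod (s := Finset.range s) (f := fun _ => (1 : ℝ)) (g := h)
      (fun i _ => zero_le_one) (fun i _ => hh i)
    simpa using this
  have hP1 : ∀ k, 1 ≤ P k := fun k => hone _ (fun i => hf1 k _)
  have hQ1 : ∀ k, 1 ≤ Q k := fun k => hone _ (fun i => hf1 k _)
  have hPm : Monotone P := fun k l h =>
    Finset.prod_le_prod (fun i _ => hf0 _ _) (fun i _ => hfm _ h)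
  have hQm : Monotone Q := fun k l h =>
    Finset.prod_le_prod (fun i _ => hf0 _ _) (fun i _ => hfm _ h)
  let q : ℕ → ℝ := fun k => P k * f k 0 * Q k * g k
  have hm : Monotone q := by
    intro k l h
    have p1 := hP1 k
    have p2 := hQ1 k
    have p3 := hg1 k
    have p4 := hf1 k 0
    have p1' := hP1 l
    have p2' := hQ1 l
    have p4' := hf1 l 0
    have m1 := hPm h
    have m2 := hQm h
    have m3 := hgm h
    have m4 : f k 0 ≤ f l 0 := hfm 0 h
    simp only [q]
    gcongr
  have hl : ∀ k : ℕ, (k : ℝ) + 1 ≤ q k := by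
    intro k
    have h0 : (k : ℝ) + 1 ≤ f k 0 := by
      have h2 : (0 : ℝ) ≤ (k : ℝ) := Nat.cast_nonneg _
      simp only [f]; push_cast; nlinarith
    have h00 := hf0 k 0
    have p1 := hP1 k
    have p2 := hQ1 k
    have p3 := hg1 k
    calc (k : ℝ) + 1 ≤ f k 0 := h0
      _ = 1 * f k 0 * 1 * 1 := by ring
      _ ≤ P k * f k 0 * Q k * g k := by gcongr
  have hq : ∀ k, a (k+1) = q k * a k := by
    intro k
    have hfs := fact_step (k * r) r
    have hsp : ∏ i ∈ Finset.range r, (2 * (2 * (((k * r : ℕ) : ℝ) + i) + 1)) =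
        P k * f k 0 * Q k * (f k (s + 1) * f k (2 * s + 2)) := by
      have := prod_split (f k) s
      rw [← hs] at this
      exact this
    have hmid : f k (s + 1) * f k (2 * s + 2) =
        g k * ((r : ℝ) ^ 2 * (2 * k + 1) * (2 * k + 2)) := by
      have h2 : (k : ℝ) + 1 ≠ 0 := by positivity
      have e1 : f k (s + 1) = 2 * (r * (2 * k + 1)) := by
        simp only [f]; push_cast; rw [hsr]; ring
      have e2 : f k (2 * s + 2) = 2 * (r * (2 * k + 2) - 1) := by
        simp only [f]; push_cast; rw [hsr]; ring
      rw [e1, e2]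
      simp only [g]
      field_simp
      ring
    rw [hsp, hmid] at hfs
    have e1 : 2 * (k + 1) * r = 2 * (k * r + r) := by ring
    have e2 : (k + 1) * r = k * r + r := by ring
    have e3 : 2 * (k + 1) = 2 * k + 1 + 1 := by ring
    have e4 : 2 * k * r = 2 * (k * r) := by ring
    simp only [a]
    rw [e1, e2, e3, e4, Nat.factorial_succ (2 * k + 1), Nat.factorial_succ (2 * k),
      ← mul_div_assoc, div_eq_div_iff (by positivity) (by positivity)]
    simp only [q]
    push_cast
    linear_combination ((r : ℝ) ^ (2 * k) * (Nat.factorial (2 * k) : ℝ)) * hfs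
  exact ⟨fun n k _ hk hkn => abs_step a q ha hq hm n k hk hkn,
    2 * a 1 + a 2, fun n hn => abs_sum a q ha hq hm hl n hn⟩
end

section
/- The total number of rooted cubic maps with 2n vertices satisfies C_n ∼ (3/π)·n!·6^n as n → ∞, i.e., C_n·π/(3·n!·6^n) → 1. -/
open Filter Finset

section TotalCubic
open PowerSeries

noncomputable def tcD (f : PowerSeries ℝ) : PowerSeries ℝ := X * PowerSeries.derivative ℝ f

lemma tcD_coeff (f : PowerSeries ℝ) (n : ℕ) : coeff n (tcD f) = n * coeff n f := by
  unfold tcD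
  cases n with
  | zero => simp
  | succ n => rw [mul_comm X, coeff_succ_mul_X, coeff_derivative]; push_cast; ring

lemma tcD_add (f g : PowerSeries ℝ) : tcD (f + g) = tcD f + tcD g := by
  unfold tcD; rw [map_add]; ring
lemma tcD_sub (f g : PowerSeries ℝ) : tcD (f - g) = tcD f - tcD g := by
  unfold tcD; rw [map_sub]; ring
lemma tcD_mul (f g : PowerSeries ℝ) : tcD (f * g) = f * tcD g + g * tcD f := by
  unfold tcD; rw [Derivation.leibniz]; simp only [smul_eq_mul]; ring
lemma tcD_X : tcD X = X := by
  unfold tcD; simp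
lemma tcD_C (r : ℝ) : tcD (C r) = 0 := by
  unfold tcD; simp
lemma tcD_natmul (r : ℕ) (f : PowerSeries ℝ) : tcD (r * f) = r * tcD f := by
  have h := tcD_C (r : ℝ)
  rw [map_natCast] at h
  rw [tcD_mul, h]; ring
lemma tcD_three (f : PowerSeries ℝ) : tcD (3 * f) = 3 * tcD f := tcD_natmul 3 f
lemma tcD_six (f : PowerSeries ℝ) : tcD (6 * f) = 6 * tcD f := tcD_natmul 6 f
lemma tcD_four (f : PowerSeries ℝ) : tcD (4 * f) = 4 * tcD f := tcD_natmul 4 f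
lemma tcD_eight (f : PowerSeries ℝ) : tcD (8 * f) = 8 * tcD f := tcD_natmul 8 f
lemma tcD_one : tcD (1 : PowerSeries ℝ) = 0 := by
  have := tcD_C 1
  rwa [map_one] at this

noncomputable def tcv : ℕ → ℝ
  | 0 => 1
  | (n+1) => (6 * n + 1) * (6 * n + 5) / (6 * (n + 1)) * tcv n

lemma tcv_pos (n : ℕ) : 0 < tcv n := by
  induction n with
  | zero => simp [tcv]
  | succ n ih => rw [tcv]; positivity

noncomputable def tcV : PowerSeries ℝ := PowerSeries.mk tcv

lemma tcV_ode : X * (36 * tcD (tcD tcV) + 36 * tcD tcV + 5 * tcV) = 6 * tcD tcV := by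
  have e36 : (36 : PowerSeries ℝ) = C 36 := (map_ofNat _ _).symm
  have e5 : (5 : PowerSeries ℝ) = C 5 := (map_ofNat _ _).symm
  have e6 : (6 : PowerSeries ℝ) = C 6 := (map_ofNat _ _).symm
  rw [e36, e5, e6]
  ext n
  cases n with
  | zero =>
    have hz : coeff 0 (C 6 * tcD tcV) = 0 := by rw [coeff_C_mul, tcD_coeff]; simp
    rw [hz]; simp
  | succ n =>
    rw [mul_comm X, coeff_succ_mul_X]
    simp only [map_add, coeff_C_mul, tcD_coeff, tcV, coeff_mk]
    rw [tcv]
    push_cast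
    field_simp
    ring

noncomputable def tcA : PowerSeries ℝ := 1 + 6 * (tcD tcV * tcV⁻¹)
noncomputable def tcB : PowerSeries ℝ := X * tcA - C (1/2)

lemma tcV_const : constantCoeff tcV ≠ 0 := by
  rw [← coeff_zero_eq_constantCoeff_apply]; simp [tcV, tcv]
lemma tcV_ne : tcV ≠ 0 := by
  intro h; apply tcV_const; rw [h]; simp

lemma tcA_mul : tcA * tcV = tcV + 6 * tcD tcV := by
  have := PowerSeries.inv_mul_cancel _ tcV_const
  unfold tcA
  linear_combination (6 * tcD tcV) * this

lemma tcC_half : (2 : PowerSeries ℝ) * C (1/2) = 1 := by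
  have e2 : (2 : PowerSeries ℝ) = C 2 := (map_ofNat _ _).symm
  rw [e2, ← map_mul]; norm_num

lemma tcA_ric : tcA = 1 + 6 * X * tcD tcA + 4 * X * tcA + X * tcA ^ 2 := by
  have h1 := tcA_mul
  have h2 := congrArg tcD h1
  rw [tcD_mul, tcD_add, tcD_six] at h2
  have h3 := tcV_ode
  have hv : tcV ^ 2 ≠ 0 := pow_ne_zero _ tcV_ne
  apply mul_left_cancel₀ hv
  linear_combination (tcV + 6 * X * tcD tcV - 4 * X * tcV - X * (tcA * tcV + tcV + 6 * tcD tcV)) * h1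
    - 6 * X * tcV * h2 - tcV * h3

lemma tcB_ric : 4 * tcB ^ 2 + 8 * X * (3 * tcD tcB - tcB) = 1 := by
  have h := tcA_ric
  have hc := tcC_half
  have hD : tcD tcB = X * tcD tcA + tcA * X := by
    unfold tcB; rw [tcD_sub, tcD_mul, tcD_X, tcD_C]; ring
  rw [hD]; unfold tcB
  linear_combination (-4 * X) * h + (2 * C (1/2) + 1 - 4 * X * tcA + 4 * X) * hc

lemma tcB_ne : tcB ≠ 0 := by
  intro h
  have := tcB_ric
  rw [h] at this
  have h2 := congrArg (coeff 0) this
  simp [tcD] at h2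

lemma tcB_ode : tcD tcB = 4 * (X ^ 2 * (9 * tcD (tcD (tcD tcB)) + 9 * tcD (tcD tcB) - tcD tcB - tcB)
    + X * (3 * tcD tcB - tcB) ^ 2) := by
  have h := tcB_ric
  have h8 : (8 : PowerSeries ℝ) ≠ 0 := by
    have e8 : (8 : PowerSeries ℝ) = C 8 := (map_ofNat _ _).symm
    rw [e8]; intro h0
    have := congrArg (coeff 0) h0
    simp at this
  have h1 : tcB * tcD tcB + X * (3 * tcD (tcD tcB) + 2 * tcD tcB - tcB) = 0 := by
    have h1 := congrArg tcD h
    rw [tcD_add, tcD_four, pow_two, tcD_mul, mul_assoc 8, tcD_eight, tcD_mul, tcD_X, tcD_sub,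
      tcD_three, tcD_one] at h1
    apply mul_left_cancel₀ h8
    linear_combination h1
  have h2 : tcD tcB ^ 2 + tcB * tcD (tcD tcB) +
      X * (3 * tcD (tcD (tcD tcB)) + 5 * tcD (tcD tcB) + tcD tcB - tcB) = 0 := by
    have h2 := congrArg tcD h1
    have e : (2 : PowerSeries ℝ) * tcD tcB = tcD tcB + tcD tcB := by ring
    have z : tcD (0 : PowerSeries ℝ) = 0 := by simp [tcD]
    rw [e, tcD_add, tcD_mul, tcD_mul, tcD_X, tcD_sub, tcD_add, tcD_add, tcD_three, z] at h2
    linear_combination h2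
  linear_combination -12 * X * h2 + (8 * X + 4 * tcB) * h1 - tcD tcB * h

lemma tcB_rec (q : ℕ) : ((q : ℝ) + 2) * coeff (q+2) tcB =
    4 * ((q + 1) * (3 * q + 1) * ((3 * q - 1) * coeff q tcB) +
      ∑ p ∈ antidiagonal (q + 1), ((3 * p.1 - 1) * coeff p.1 tcB) * ((3 * p.2 - 1) * coeff p.2 tcB)) := by
  have h := congrArg (coeff (q+2)) tcB_ode
  have e4 : (4 : PowerSeries ℝ) = C 4 := (map_ofNat _ _).symm
  have e3 : (3 : PowerSeries ℝ) = C 3 := (map_ofNat _ _).symm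
  have e9 : (9 : PowerSeries ℝ) = C 9 := (map_ofNat _ _).symm
  have hG : ∀ j, coeff j (3 * tcD tcB - tcB) = (3 * j - 1) * coeff j tcB := by
    intro j; rw [e3, map_sub, coeff_C_mul, tcD_coeff]; ring
  rw [tcD_coeff, e4, coeff_C_mul, map_add, mul_comm (X ^ 2), coeff_mul_X_pow, mul_comm X,
    coeff_succ_mul_X, pow_two, coeff_mul] at h
  simp only [hG] at h
  rw [e9] at h
  simp only [map_add, map_sub, coeff_C_mul, tcD_coeff] at h
  push_cast at h
  rw [h]; ring

lemma tcA_coeff (n : ℕ) : coeff (n+1) tcB = coeff n tcA := by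
  unfold tcB
  rw [map_sub, mul_comm X, coeff_succ_mul_X, coeff_C]; simp

lemma tcA_conv (n : ℕ) : ∑ p ∈ antidiagonal n, coeff p.1 tcA * tcv p.2 = (1 + 6 * n) * tcv n := by
  have h := congrArg (coeff n) tcA_mul
  have e6 : (6 : PowerSeries ℝ) = C 6 := (map_ofNat _ _).symm
  rw [coeff_mul, map_add, e6, coeff_C_mul, tcD_coeff] at h
  simp only [tcV, coeff_mk] at h
  rw [h]; ring

lemma tcA_zero : coeff 0 tcA = 1 := by
  have := tcA_conv 0
  simpa [tcv] using this

lemma tcB_zero : coeff 0 tcB = -1/2 := by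
  unfold tcB
  rw [map_sub, mul_comm X]; simp; norm_num

lemma tcA_conv' (N : ℕ) : coeff (N+1) tcA + ∑ k ∈ range N, coeff (k+1) tcA * tcv (N - k) =
    6 * (N + 1) * tcv (N + 1) := by
  have h := tcA_conv (N+1)
  rw [Finset.Nat.sum_antidiagonal_eq_sum_range_succ (fun i j => coeff i tcA * tcv j),
    sum_range_succ, sum_range_succ', tcA_zero] at h
  simp only [Nat.sub_self, Nat.sub_zero, Nat.add_sub_add_right] at h
  rw [show tcv 0 = 1 from rfl] at h
  push_cast at h
  linarith

/-- Uniqueness. -/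
lemma tc_unique (t : ℕ → ℝ) (h0 : t 0 = 1/2) (h1 : t 1 = 2)
    (hr : ∀ q : ℕ, t (q+2) = 4 * (q+1) * (3*q+5) * (3*q+1) / (q+2) * t q +
      4 * (3*q+5) / (q+2) * ∑ p ∈ antidiagonal (q + 1), t p.1 * t p.2) (m : ℕ) :
    t m = (3 * m - 1) * coeff m tcB := by
  induction m using Nat.strong_induction_on with
  | _ m ih =>
    match m, ih with
    | 0, _ => rw [h0, tcB_zero]; norm_num
    | 1, _ => rw [h1, tcA_coeff, tcA_zero]; norm_num
    | q+2, ih =>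
      have hs : ∑ p ∈ antidiagonal (q + 1), t p.1 * t p.2 = ∑ p ∈ antidiagonal (q + 1),
          ((3 * p.1 - 1) * coeff p.1 tcB) * ((3 * p.2 - 1) * coeff p.2 tcB) := by
        apply sum_congr rfl
        rintro ⟨i, j⟩ hp
        rw [Finset.HasAntidiagonal.mem_antidiagonal] at hp
        dsimp only at hp ⊢
        rw [ih i (by omega), ih j (by omega)]
      have := tcB_rec q
      have hq : (q : ℝ) + 2 ≠ 0 := by positivity
      rw [hr, hs, ih q (by omega)]
      have e : coeff (q+2) tcB = 4 * ((q + 1) * (3 * q + 1) * ((3 * q - 1) * coeff q tcB) +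
        ∑ p ∈ antidiagonal (q + 1), ((3 * p.1 - 1) * coeff p.1 tcB) *
          ((3 * p.2 - 1) * coeff p.2 tcB)) / (q + 2) := by
        rw [← this]; field_simp
      rw [e]; push_cast; field_simp; ring

lemma tc_nonneg (n : ℕ) : 0 ≤ coeff n tcA := by
  induction n using Nat.strong_induction_on with
  | _ n ih =>
    match n, ih with
    | 0, _ => rw [tcA_zero]; norm_num
    | n+1, ih =>
      have h := congrArg (coeff (n+1)) tcA_ric
      have e4 : (4 : PowerSeries ℝ) = C 4 := (map_ofNat _ _).symm
      have e6 : (6 : PowerSeries ℝ) = C 6 := (map_ofNat _ _).symm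
      rw [e4, e6, show (1 + C 6 * X * tcD tcA + C 4 * X * tcA + X * tcA ^ 2 : PowerSeries ℝ)
        = 1 + (C 6 * tcD tcA + C 4 * tcA + tcA * tcA) * X by ring, map_add, coeff_succ_mul_X,
        coeff_one, map_add, map_add, coeff_C_mul, coeff_C_mul, tcD_coeff, coeff_mul] at h
      rw [h]
      have : 0 ≤ ∑ p ∈ antidiagonal n, coeff p.1 tcA * coeff p.2 tcA := by
        apply sum_nonneg
        rintro ⟨i, j⟩ hp
        rw [Finset.HasAntidiagonal.mem_antidiagonal] at hp
        dsimp only at hp ⊢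
        exact mul_nonneg (ih i (by omega)) (ih j (by omega))
      have := ih n (by omega)
      simp only [Nat.succ_ne_zero, if_false]
      positivity

lemma tcv_prod (n : ℕ) : tcv n * n.factorial = 6 ^ n * ((∏ j ∈ range n, ((1/6 : ℝ) + j)) *
    ∏ j ∈ range n, ((5/6 : ℝ) + j)) := by
  induction n with
  | zero => simp [tcv]
  | succ n ih =>
    rw [prod_range_succ, prod_range_succ, tcv, Nat.factorial_succ]
    push_cast
    have : (n : ℝ) + 1 ≠ 0 := by positivity
    have e : (6 * (n : ℝ) + 1) * (6 * n + 5) / (6 * (n + 1)) * tcv n * ((n + 1) * n.factorial) =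
        6 * ((1/6 + n) * (5/6 + n)) * (tcv n * n.factorial) := by
      field_simp
      ring
    rw [e, ih]
    ring

lemma tcv_lim : Tendsto (fun n : ℕ => tcv n * n / (6 ^ n * n.factorial)) atTop
    (nhds (1 / (2 * Real.pi))) := by
  have h1 := Real.GammaSeq_tendsto_Gamma (1/6)
  have h2 := Real.GammaSeq_tendsto_Gamma (5/6)
  have hg : Real.Gamma (1/6) * Real.Gamma (5/6) = 2 * Real.pi := by
    have := Real.Gamma_mul_Gamma_one_sub (1/6)
    rw [show (1 : ℝ) - 1/6 = 5/6 by norm_num, show Real.pi * (1/6) = Real.pi / 6 by ring,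
      Real.sin_pi_div_six] at this
    rw [this]; field_simp
  have h3 := h1.mul h2
  rw [hg] at h3
  have hc : ∀ c : ℝ, Tendsto (fun n : ℕ => (n : ℝ) / (n + c)) atTop (nhds 1) := fun c =>
    tendsto_natCast_div_add_atTop c
  have h4 := ((hc (1/6)).mul (hc (5/6))).div h3 (by positivity)
  rw [one_mul] at h4
  refine h4.congr' ?_
  filter_upwards [eventually_ge_atTop 1] with n hn
  have hn' : (0 : ℝ) < n := by exact_mod_cast hn
  have hv := tcv_prod n
  have hp1 : 0 < ∏ j ∈ range n, ((1/6 : ℝ) + j) := prod_pos (fun j _ => by positivity)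
  have hp2 : 0 < ∏ j ∈ range n, ((5/6 : ℝ) + j) := prod_pos (fun j _ => by positivity)
  have hx : (n : ℝ) ^ (1/6 : ℝ) * (n : ℝ) ^ (5/6 : ℝ) = n := by
    rw [← Real.rpow_add hn']; norm_num
  have hf : (0 : ℝ) < n.factorial := by exact_mod_cast n.factorial_pos
  have hv' : tcv n = 6 ^ n * ((∏ j ∈ range n, ((1/6 : ℝ) + j)) *
    ∏ j ∈ range n, ((5/6 : ℝ) + j)) / n.factorial := by rw [← hv]; field_simp
  simp only [Pi.div_apply]
  unfold Real.GammaSeq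
  rw [prod_range_succ, prod_range_succ, hv']
  generalize (∏ j ∈ range n, ((1/6 : ℝ) + j)) = P at *
  generalize (∏ j ∈ range n, ((5/6 : ℝ) + j)) = Q at *
  have hg' : (n : ℝ) ^ (1/6 : ℝ) * n.factorial / (P * (1/6 + n)) *
      ((n : ℝ) ^ (5/6 : ℝ) * n.factorial / (Q * (5/6 + n))) =
      n * (n.factorial * n.factorial) / ((P * (1/6 + n)) * (Q * (5/6 + n))) := by
    rw [div_mul_div_comm, mul_mul_mul_comm, hx]
  rw [hg']
  field_simp
  try ring

lemma tc_fact (i j : ℕ) : (i+1).factorial * (j+1).factorial ≤ (i+j+1).factorial := by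
  induction j with
  | zero => simp
  | succ j ih =>
    rw [Nat.factorial_succ (j+1), show i + (j+1) + 1 = (i+j+1)+1 by ring, Nat.factorial_succ (i+j+1)]
    calc _ = (j+1+1) * ((i+1).factorial * (j+1).factorial) := by ring
      _ ≤ _ := Nat.mul_le_mul (by omega) ih

lemma tcA_lim : Tendsto (fun n : ℕ => coeff n tcA / (6 ^ n * n.factorial)) atTop
    (nhds (3 / Real.pi)) := by
  obtain ⟨K, hK⟩ := tcv_lim.bddAbove_range
  have hK' : ∀ n : ℕ, tcv n * n ≤ K * (6 ^ n * n.factorial) := by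
    intro n
    have : tcv n * n / (6 ^ n * n.factorial) ≤ K := hK ⟨n, rfl⟩
    rwa [div_le_iff₀ (by positivity)] at this
  have hK0 : 0 ≤ K := by
    have := hK' 0
    simpa using this
  have hS0 : ∀ N, 0 ≤ ∑ k ∈ range N, coeff (k+1) tcA * tcv (N - k) := fun N =>
    sum_nonneg (fun k _ => mul_nonneg (tc_nonneg _) (tcv_pos _).le)
  have hA : ∀ k : ℕ, coeff (k+1) tcA ≤ 6 * K * (6 ^ (k+1) * (k+1).factorial) := by
    intro k
    have h1 := tcA_conv' k
    have h2 := hS0 k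
    have h3 := hK' (k+1)
    push_cast at h3 ⊢
    linarith
  have hv : ∀ j : ℕ, tcv (j+1) ≤ K * (6 ^ (j+1) * j.factorial) := by
    intro j
    have h3 := hK' (j+1)
    rw [Nat.factorial_succ] at h3
    push_cast at h3
    have : (0 : ℝ) < j + 1 := by positivity
    refine le_of_mul_le_mul_right ?_ this
    linarith
  have hterm : ∀ k j : ℕ, coeff (k+1) tcA * tcv (j+1) ≤
      6 * K ^ 2 * 6 ^ (k + j + 2) * ((k+1).factorial * j.factorial) := by
    intro k j
    calc _ ≤ (6 * K * (6 ^ (k+1) * (k+1).factorial)) * (K * (6 ^ (j+1) * j.factorial)) :=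
          mul_le_mul (hA k) (hv j) (tcv_pos _).le (by positivity)
      _ = _ := by ring
  have hS : ∀ M : ℕ, ∑ k ∈ range (M+1), coeff (k+1) tcA * tcv (M + 1 - k) ≤
      12 * K ^ 2 * (6 ^ (M + 2) * (M+1).factorial) := by
    intro M
    rw [sum_range_succ]
    have h1 : coeff (M+1) tcA * tcv (M + 1 - M) ≤ 6 * K ^ 2 * 6 ^ (M + 2) * (M+1).factorial := by
      have := hterm M 0
      simpa [show M + 1 - M = 0 + 1 by omega] using this
    have h2 : ∑ k ∈ range M, coeff (k+1) tcA * tcv (M + 1 - k) ≤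
        ∑ k ∈ range M, 6 * K ^ 2 * 6 ^ (M + 2) * (M.factorial : ℝ) := by
      apply sum_le_sum
      intro k hk
      rw [mem_range] at hk
      obtain ⟨j, rfl⟩ : ∃ j, M = k + j + 1 := ⟨M - k - 1, by omega⟩
      have h3 := hterm k (j+1)
      rw [show k + j + 1 + 1 - k = j + 1 + 1 by omega]
      refine h3.trans ?_
      rw [show k + (j+1) + 2 = k + j + 1 + 2 by ring]
      apply mul_le_mul_of_nonneg_left _ (by positivity)
      exact_mod_cast tc_fact k j
    rw [sum_const, card_range, nsmul_eq_mul] at h2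
    have h4 : (M : ℝ) * (6 * K ^ 2 * 6 ^ (M + 2) * (M.factorial : ℝ)) ≤
        6 * K ^ 2 * 6 ^ (M + 2) * (M+1).factorial := by
      rw [Nat.factorial_succ]; push_cast
      have : 0 ≤ 6 * K ^ 2 * 6 ^ (M + 2) * (M.factorial : ℝ) := by positivity
      linarith
    linarith
  rw [← tendsto_add_atTop_iff_nat 2]
  have hw := (tendsto_add_atTop_iff_nat 2).2 tcv_lim
  have hE : Tendsto (fun M : ℕ => (∑ k ∈ range (M+1), coeff (k+1) tcA * tcv (M + 1 - k)) /
      (6 ^ (M+2) * (M+2).factorial)) atTop (nhds 0) := by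
    have hz : Tendsto (fun M : ℕ => 12 * K ^ 2 / (((M + 2 : ℕ) : ℝ))) atTop (nhds 0) :=
      (tendsto_add_atTop_iff_nat 2).2 (tendsto_const_div_atTop_nhds_zero_nat (12 * K ^ 2))
    refine squeeze_zero (fun M => div_nonneg (hS0 (M+1)) (by positivity)) (fun M => ?_) hz
    rw [div_le_div_iff₀ (by positivity) (by positivity), Nat.factorial_succ (M+1)]
    have := mul_le_mul_of_nonneg_right (hS M) (show (0 : ℝ) ≤ ((M + 2 : ℕ) : ℝ) by positivity)
    push_cast at this ⊢
    linarith
  have hfin := (hw.const_mul 6).sub hE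
  have e : 6 * (1 / (2 * Real.pi)) - 0 = 3 / Real.pi := by
    have := Real.pi_ne_zero
    field_simp; norm_num
  rw [e] at hfin
  refine hfin.congr (fun M => ?_)
  have h := tcA_conv' (M+1)
  rw [eq_sub_of_add_eq h, sub_div]
  push_cast
  ring
end TotalCubic
lemma tc_int_sum (a : ℤ) (N : ℕ) (f : ℤ → ℚ) :
    ∑ k ∈ Finset.Icc a (a + N), f k = ∑ i ∈ range (N+1), f (a + i) := by
  symm
  apply Finset.sum_bij (fun (i : ℕ) _ => a + (i : ℤ))
  · intro i hi; rw [mem_range] at hi; rw [Finset.mem_Icc]; omega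
  · intro i _ j _ h; omega
  · intro k hk
    rw [Finset.mem_Icc] at hk
    exact ⟨(k - a).toNat, by rw [mem_range]; omega, by omega⟩
  · intros; rfl

lemma tc_vanish (H : ℤ → ℤ → ℚ)
    (hH1 : ∀ g : ℤ, H (-1) g = if g = 0 then 1/2 else 0)
    (hH2 : ∀ g : ℤ, H 0 g = if g = 0 then 2 else 0)
    (hHrec : ∀ n g : ℤ, 1 ≤ n → 0 ≤ g →
      H n g = (4*n*(3*n+2)*(3*n-2)/(n+1)) * H (n-2) (g-1)
        + (4*(3*n+2)/(n+1)) *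
          ∑ k ∈ Finset.Icc (-1 : ℤ) (n-1), ∑ i ∈ Finset.Icc (0 : ℤ) g,
            H k i * H (n-2-k) (g-i)) (m : ℕ) :
    ∀ g : ℤ, (m : ℤ) + 1 < 2 * g → H ((m : ℤ) - 1) g = 0 := by
  induction m using Nat.strong_induction_on with
  | _ m ih =>
    intro g hg
    match m, ih, hg with
    | 0, _, hg =>
      have := hH1 g
      rw [if_neg (by omega)] at this
      simpa using this
    | 1, _, hg =>
      have := hH2 g
      rw [if_neg (by omega)] at this
      simpa using this
    | q+2, ih, hg =>
      have ih' : ∀ k : ℤ, -1 ≤ k → k ≤ q → ∀ g : ℤ, k + 2 < 2 * g → H k g = 0 := by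
        intro k hk1 hk2 g hg
        have := ih (k+1).toNat (by omega) g (by omega)
        rwa [show (((k+1).toNat : ℕ) : ℤ) - 1 = k by omega] at this
      rw [hHrec _ _ (by omega) (by omega)]
      rw [ih' _ (by omega) (by omega) _ (by omega), mul_zero, zero_add]
      rw [sum_eq_zero, mul_zero]
      intro k hk
      rw [Finset.mem_Icc] at hk
      apply sum_eq_zero
      intro i hi
      by_cases h : k + 2 < 2 * i
      · rw [ih' _ (by omega) (by omega) _ h, zero_mul]
      · rw [ih' (((q+2 : ℕ) : ℤ) - 1 - 2 - k) (by omega) (by omega) _ (by omega), mul_zero]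

section Reduce
open Polynomial

noncomputable def tcP (H : ℤ → ℤ → ℚ) (m : ℕ) : ℚ[X] :=
  ∑ g ∈ range (m+1), C (H ((m : ℤ) - 1) g) * X ^ g

lemma tcP_eval (H : ℤ → ℤ → ℚ) (m : ℕ) :
    (tcP H m).eval 1 = ∑ g ∈ range (m+1), H ((m : ℤ) - 1) g := by
  unfold tcP; rw [eval_finsetSum]; simp

lemma tc_reduce (H : ℤ → ℤ → ℚ)
    (hH1 : ∀ g : ℤ, H (-1) g = if g = 0 then 1/2 else 0)
    (hH2 : ∀ g : ℤ, H 0 g = if g = 0 then 2 else 0)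
    (hH3 : ∀ n g : ℤ, g < 0 → H n g = 0)
    (hHrec : ∀ n g : ℤ, 1 ≤ n → 0 ≤ g →
      H n g = (4*n*(3*n+2)*(3*n-2)/(n+1)) * H (n-2) (g-1)
        + (4*(3*n+2)/(n+1)) *
          ∑ k ∈ Finset.Icc (-1 : ℤ) (n-1), ∑ i ∈ Finset.Icc (0 : ℤ) g,
            H k i * H (n-2-k) (g-i)) (q : ℕ) :
    (tcP H (q+2)).eval 1 = 4 * (q+1) * (3*q+5) * (3*q+1) / (q+2) * (tcP H q).eval 1 +
      4 * (3*q+5) / (q+2) *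
        ∑ p ∈ antidiagonal (q + 1), (tcP H p.1).eval 1 * (tcP H p.2).eval 1 := by
  have hv := tc_vanish H hH1 hH2 hHrec
  have hc : ∀ m g : ℕ, (tcP H m).coeff g = H ((m : ℤ) - 1) g := by
    intro m g
    unfold tcP
    rw [finsetSum_coeff]
    simp only [coeff_C_mul_X_pow]
    rw [Finset.sum_ite_eq]
    split_ifs with h
    · rfl
    · rw [mem_range] at h
      rw [hv m g (by omega)]
  have key : tcP H (q+2) = C (4 * (q+1) * (3*q+5) * (3*q+1) / (q+2) : ℚ) * (tcP H q * X) +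
      C (4 * (3*q+5) / (q+2) : ℚ) * ∑ p ∈ antidiagonal (q + 1), tcP H p.1 * tcP H p.2 := by
    ext g
    rw [coeff_add, coeff_C_mul, coeff_C_mul, finsetSum_coeff, hc, hHrec _ _ (by omega) (by omega)]
    congr 1
    · have : (tcP H q * X).coeff g = H (((q + 2 : ℕ) : ℤ) - 1 - 2) ((g : ℤ) - 1) := by
        cases g with
        | zero => rw [coeff_mul_X_zero, hH3 _ _ (by norm_num)]
        | succ g =>
          rw [coeff_mul_X, hc]; congr 1 <;> push_cast <;> ring
      rw [this]
      congr 1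
      push_cast
      congr 1 <;> ring
    · congr 1
      · push_cast; congr 1 <;> ring
      · rw [show ((q + 2 : ℕ) : ℤ) - 1 - 1 = -1 + ((q + 1 : ℕ) : ℤ) by push_cast; ring, tc_int_sum,
          Finset.Nat.sum_antidiagonal_eq_sum_range_succ (fun i j => (tcP H i * tcP H j).coeff g)]
        apply sum_congr rfl
        intro k hk
        rw [mem_range] at hk
        have h0 := tc_int_sum 0 g (fun i => H (-1 + (k : ℤ)) i *
          H (((q + 2 : ℕ) : ℤ) - 1 - 2 - (-1 + (k : ℤ))) ((g : ℤ) - i))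
        rw [zero_add] at h0
        rw [h0, coeff_mul, Finset.Nat.sum_antidiagonal_eq_sum_range_succ
          (fun i j => (tcP H k).coeff i * (tcP H (q + 1 - k)).coeff j)]
        apply sum_congr rfl
        intro i hi
        rw [mem_range] at hi
        rw [hc, hc]
        congr 2 <;> omega
  rw [key]
  simp [eval_finsetSum]
end Reduce

/-- The total number of rooted cubic maps with `2n` vertices satisfies
`C_n ∼ (3/π) n! 6^n`, where `C_n = ∑_{g=0}^n H(n,g)/(3n+2)` and `H` is the
Goulden–Jackson sequence. -/
theorem total_cubic_maps_asymptotic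
    (H : ℤ → ℤ → ℚ)
    (hH1 : ∀ g : ℤ, H (-1) g = if g = 0 then 1/2 else 0)
    (hH2 : ∀ g : ℤ, H 0 g = if g = 0 then 2 else 0)
    (hH3 : ∀ n g : ℤ, g < 0 → H n g = 0)
    (hHrec : ∀ n g : ℤ, 1 ≤ n → 0 ≤ g →
      H n g = (4*n*(3*n+2)*(3*n-2)/(n+1)) * H (n-2) (g-1)
        + (4*(3*n+2)/(n+1)) *
          ∑ k ∈ Finset.Icc (-1 : ℤ) (n-1), ∑ i ∈ Finset.Icc (0 : ℤ) g,
            H k i * H (n-2-k) (g-i)) :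
    Tendsto
      (fun n : ℕ =>
        ((∑ g ∈ Finset.Icc (0 : ℤ) (n : ℤ),
            H (n : ℤ) g / (3 * (n : ℚ) + 2) : ℚ) : ℝ) * Real.pi /
          (3 * (Nat.factorial n : ℝ) * 6 ^ n))
      atTop (nhds 1) := by
  have hred := tc_reduce H hH1 hH2 hH3 hHrec
  have hu := tc_unique (fun m => (((tcP H m).eval 1 : ℚ) : ℝ))
    (by simp [tcP_eval, hH1]) (by simp [tcP_eval, hH2, sum_range_succ]) (by
      intro q
      have := congrArg (fun x : ℚ => (x : ℝ)) (hred q)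
      rw [this]; push_cast; ring)
  have hlim := tcA_lim.mul_const (Real.pi / 3)
  have e : 3 / Real.pi * (Real.pi / 3) = 1 := by
    have := Real.pi_ne_zero
    field_simp
  rw [e] at hlim
  refine hlim.congr (fun n => ?_)
  have h1 := hu (n+1)
  rw [tcA_coeff, tcP_eval, sum_range_succ] at h1
  have hz := tc_vanish H hH1 hH2 hHrec (n+1) ((n+1 : ℕ) : ℤ)
  have hlast : H (((n+1 : ℕ) : ℤ) - 1) ((n+1 : ℕ) : ℤ) = 0 ∨ n = 0 := by
    rcases Nat.eq_zero_or_pos n with h | h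
    · right; exact h
    · left; exact hz (by push_cast; omega)
  have hlast' : H (((n+1 : ℕ) : ℤ) - 1) ((n+1 : ℕ) : ℤ) = 0 := by
    rcases hlast with h | h
    · exact h
    · subst h
      have := hH2 1
      simpa using this
  rw [hlast', add_zero] at h1
  have h2 := tc_int_sum 0 n (fun g => H n g / (3 * (n : ℚ) + 2))
  rw [zero_add] at h2
  rw [h2, ← sum_div]
  have h3 : ∑ i ∈ range (n+1), H (n : ℤ) (0 + (i : ℤ)) =
      ∑ g ∈ range (n+1), H (((n+1 : ℕ) : ℤ) - 1) g := by
    apply sum_congr rfl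
    intro i _
    congr 1 <;> push_cast <;> ring
  rw [h3, Rat.cast_div, h1]
  push_cast
  have : (3 * (n : ℝ) + 2) ≠ 0 := by positivity
  have e2 : (3 * ((n : ℝ) + 1) - 1) = 3 * n + 2 := by ring
  rw [e2, mul_div_cancel_left₀ _ this]
  field_simp
end

section
/- The genus distribution of cubic graphs is asymptotically normal with mean (n − ln n)/2 and standard deviation (√(ln n))/2: for every real number t, (1/C_n)·Σ_{g : 0 ≤ g ≤ (n − ln n)/2 + t·√(ln n)/2} C(n,g) → Φ(t) as n → ∞, where Φ(t) = (1/√(2π)) ∫_{-∞}^{t} e^{-x²/2} dx. -/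
open Filter Finset MeasureTheory


lemma split_anti {R : Type*} [CommRing R] (p : ℕ → R) (m : ℕ) :
    ∑ ij ∈ antidiagonal (m+3), p ij.1 * p ij.2 =
      2 * p 0 * p (m+3) + 2 * p 1 * p (m+2) + ∑ j ∈ range m, p (j+2) * p (m+1-j) := by
  rw [Finset.Nat.sum_antidiagonal_eq_sum_range_succ (fun i j => p i * p j)]
  rw [Finset.sum_range_succ', Finset.sum_range_succ', Finset.sum_range_succ, Finset.sum_range_succ]
  have h1 : m + 3 - (m+1+1+1) = 0 := by omega
  have h2 : m + 3 - (m+1+1) = 1 := by omega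
  have h3 : ∀ j, m + 3 - (j+1+1) = m+1-j := by intro j; omega
  simp only [h1, h2, h3, Nat.sub_zero, zero_add, Nat.add_succ_sub_one]
  ring_nf

/-- The recursion satisfied by the total counts. -/
def PRec (p : ℕ → ℝ) : Prop :=
  p 0 = 1/2 ∧ p 1 = 2 ∧ ∀ m : ℕ, ((m:ℝ)+2) * p (m+2) =
    4 * (m+1) * (3*m+5) * (3*m+1) * p m
      + 4 * (3*m+5) * ∑ ij ∈ antidiagonal (m+1), p ij.1 * p ij.2

/-- the convolution tail -/
noncomputable def tailS (p : ℕ → ℝ) (m : ℕ) : ℝ := ∑ j ∈ range m, p (j+2) * p (m+1-j)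

/-- normalized counts -/
noncomputable def xs (p : ℕ → ℝ) (n : ℕ) : ℝ := p n / (6^n * n.factorial)

lemma p_eq_xs (p : ℕ → ℝ) (n : ℕ) : p n = 6^n * n.factorial * xs p n := by
  unfold xs; field_simp


lemma rec4 {p : ℕ → ℝ} (hp : PRec p) (m : ℕ) : ((m:ℝ)+4) * p (m+4) =
    4 * (3*m+11) * (((m+3)*(3*m+7)+4) * p (m+2) + p (m+3) + tailS p m) := by
  have h := hp.2.2 (m+2)
  rw [split_anti p m, hp.1, hp.2.1] at h
  unfold tailS
  push_cast at h
  rw [show m+2+2 = m+4 from rfl] at h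
  linear_combination h

lemma p_pos {p : ℕ → ℝ} (hp : PRec p) (n : ℕ) : 0 < p n := by
  induction n using Nat.strong_induction_on with
  | _ n ih =>
    match n, ih with
    | 0, _ => rw [hp.1]; norm_num
    | 1, _ => rw [hp.2.1]; norm_num
    | m+2, ih =>
      have h := hp.2.2 m
      have h1 : 0 < p m := ih m (by omega)
      have h2 : 0 ≤ ∑ ij ∈ antidiagonal (m+1), p ij.1 * p ij.2 := by
        apply Finset.sum_nonneg
        intro ij hij
        rw [Finset.HasAntidiagonal.mem_antidiagonal] at hij
        exact mul_nonneg (ih _ (by omega)).le (ih _ (by omega)).le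
      have h3 : 0 < ((m:ℝ)+2) * p (m+2) := by rw [h]; positivity
      exact pos_of_mul_pos_right h3 (by positivity)

lemma tailS_nonneg {p : ℕ → ℝ} (hp : PRec p) (m : ℕ) : 0 ≤ tailS p m :=
  Finset.sum_nonneg fun _ _ => mul_nonneg (p_pos hp _).le (p_pos hp _).le

lemma xs_rec {p : ℕ → ℝ} (hp : PRec p) (m : ℕ) : 9*((m:ℝ)+4)^2*(m+3) * xs p (m+4) =
    (3*m+11) * (((m+3)*(3*m+7)+4) * xs p (m+2) + 6*(m+3)* xs p (m+3)
      + tailS p m / (6^(m+2) * (m+2).factorial)) := by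
  have h := rec4 hp m
  rw [p_eq_xs p (m+4), p_eq_xs p (m+3), p_eq_xs p (m+2)] at h
  have f3 : ((m+3).factorial : ℝ) = (m+3) * (m+2).factorial := by
    rw [Nat.factorial_succ]; push_cast; ring
  have f4 : ((m+4).factorial : ℝ) = (m+4) * ((m+3) * (m+2).factorial) := by
    rw [Nat.factorial_succ, Nat.cast_mul, f3]; push_cast; ring
  rw [f3, f4] at h
  have hF : (0:ℝ) < 6^(m+2) * (m+2).factorial := by positivity
  have e4 : (6:ℝ)^(m+4) = 36 * 6^(m+2) := by ring
  have e3 : (6:ℝ)^(m+3) = 6 * 6^(m+2) := by ring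
  rw [e3, e4] at h
  field_simp
  linear_combination h/4


lemma p_vals {p : ℕ → ℝ} (hp : PRec p) : p 2 = 25 ∧ p 3 = 480 ∧ p 4 = 12155 ∧ p 5 = 379680 ∧ p 6 = 14080250 ∧
   p 7 = 604416000 ∧ p 8 = 29486725075 ∧ p 9 = 1611975206400 ∧ p 10 = 97641876068750 := by
  have h0 := hp.1
  have h1 := hp.2.1
  have h2 : p 2 = 25 := by
    have := hp.2.2 0
    simp [Finset.Nat.antidiagonal_succ, h0, h1] at this
    linarith
  have h3 : p 3 = 480 := by
    have := hp.2.2 1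
    simp [Finset.Nat.antidiagonal_succ, h0, h1, h2] at this
    linarith
  have h4 : p 4 = 12155 := by
    have := rec4 hp 0
    simp [tailS, h2, h3] at this
    linarith
  have h5 : p 5 = 379680 := by
    have := rec4 hp 1
    norm_num [tailS, Finset.sum_range_succ, h2, h3, h4] at this
    linarith
  have h6 : p 6 = 14080250 := by
    have := rec4 hp 2
    norm_num [tailS, Finset.sum_range_succ, h2, h3, h4, h5] at this
    linarith
  have h7 : p 7 = 604416000 := by
    have := rec4 hp 3
    norm_num [tailS, Finset.sum_range_succ, h2, h3, h4, h5, h6] at this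
    linarith
  have h8 : p 8 = 29486725075 := by
    have := rec4 hp 4
    norm_num [tailS, Finset.sum_range_succ, h2, h3, h4, h5, h6, h7] at this
    linarith
  have h9 : p 9 = 1611975206400 := by
    have := rec4 hp 5
    norm_num [tailS, Finset.sum_range_succ, h2, h3, h4, h5, h6, h7, h8] at this
    linarith
  have h10 : p 10 = 97641876068750 := by
    have := rec4 hp 6
    norm_num [tailS, Finset.sum_range_succ, h2, h3, h4, h5, h6, h7, h8, h9] at this
    linarith
  exact ⟨h2, h3, h4, h5, h6, h7, h8, h9, h10⟩

lemma fact_le (c L : ℕ) (hL : c ≤ L) (j : ℕ) :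
    (c + j).factorial * L.factorial ≤ c.factorial * (L + j).factorial := by
  induction j with
  | zero => simp
  | succ j ih =>
    rw [← add_assoc, ← add_assoc, Nat.factorial_succ, Nat.factorial_succ (L+j)]
    calc (c+j+1) * (c+j).factorial * L.factorial = (c+j+1) * ((c+j).factorial * L.factorial) := by ring
      _ ≤ (L+j+1) * (c.factorial * (L+j).factorial) := by gcongr
      _ = _ := by ring

lemma fact_sum (m : ℕ) : ∑ j ∈ range m, ((j+2).factorial * (m+1-j).factorial : ℝ) ≤ 10 * (m+1).factorial := by
  have key : ∀ j ∈ range m, ((j+2).factorial * (m+1-j).factorial : ℝ) ≤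
      (if j = 0 then 2 * ((m+1).factorial : ℝ) else 0) + (if j = m-1 then 2 * ((m+1).factorial : ℝ) else 0)
        + 6 * (m.factorial : ℝ) := by
    intro j hj
    rw [mem_range] at hj
    have hp1 : (0:ℝ) ≤ 2 * ((m+1).factorial : ℝ) := by positivity
    have hp2 : (0:ℝ) ≤ 6 * (m.factorial : ℝ) := by positivity
    by_cases h0 : j = 0
    · subst h0
      simp only [if_true]
      have : (0:ℝ) ≤ if 0 = m-1 then 2 * ((m+1).factorial : ℝ) else 0 := by split_ifs <;> simp
      norm_num [Nat.factorial]
      norm_num [Nat.factorial] at this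
      linarith
    by_cases h1 : j = m-1
    · subst h1
      have e1 : m - 1 + 2 = m+1 := by omega
      have e2 : m + 1 - (m-1) = 2 := by omega
      rw [e1, e2, if_neg h0]
      simp only [if_true]
      norm_num [Nat.factorial]
      norm_num [Nat.factorial] at hp2
      linarith
    · rw [if_neg h0, if_neg h1]
      have := fact_le 3 (m+1-j) (by omega) (j-1)
      have e1 : 3 + (j-1) = j+2 := by omega
      have e2 : m+1-j+(j-1) = m := by omega
      rw [e1, e2] at this
      have h' : (((j+2).factorial * (m+1-j).factorial : ℕ):ℝ) ≤ ((Nat.factorial 3 * m.factorial : ℕ) : ℝ) := by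
        exact_mod_cast this
      push_cast at h'
      norm_num [Nat.factorial] at h' ⊢
      linarith
  refine (Finset.sum_le_sum key).trans ?_
  rw [Finset.sum_add_distrib, Finset.sum_add_distrib, Finset.sum_ite_eq', Finset.sum_ite_eq']
  simp only [sum_const, card_range, nsmul_eq_mul]
  have hA : (if 0 ∈ range m then 2 * ((m+1).factorial : ℝ) else 0) ≤ 2 * ((m+1).factorial : ℝ) := by
    split_ifs <;> simp
  have hB : (if m-1 ∈ range m then 2 * ((m+1).factorial : ℝ) else 0) ≤ 2 * ((m+1).factorial : ℝ) := by
    split_ifs <;> simp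
  have hC : (m:ℝ) * (6 * m.factorial) ≤ 6 * ((m+1).factorial : ℝ) := by
    rw [Nat.factorial_succ]; push_cast
    have : (0:ℝ) < m.factorial := by positivity
    nlinarith
  linarith


lemma xs_lower {p : ℕ → ℝ} (hp : PRec p) (n : ℕ) : 1/3 ≤ xs p n := by
  obtain ⟨h2, h3, -⟩ := p_vals hp
  induction n using Nat.strong_induction_on with
  | _ n ih =>
    match n, ih with
    | 0, _ => simp [xs, hp.1]; norm_num
    | 1, _ => simp [xs, hp.2.1]; norm_num
    | 2, _ => norm_num [xs, h2, Nat.factorial]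
    | 3, _ => norm_num [xs, h3, Nat.factorial]
    | m+4, ih =>
      have h := xs_rec hp m
      have i2 := ih (m+2) (by omega)
      have i3 := ih (m+3) (by omega)
      have hs : 0 ≤ tailS p m / (6^(m+2) * (m+2).factorial) := by
        have := tailS_nonneg hp m; positivity
      have hm : (0:ℝ) ≤ m := by positivity
      have : 9*((m:ℝ)+4)^2*(m+3) * (1/3) ≤ 9*((m:ℝ)+4)^2*(m+3) * xs p (m+4) := by
        rw [h]
        calc 9*((m:ℝ)+4)^2*(m+3) * (1/3) ≤ (3*m+11) * (((m+3)*(3*m+7)+4) * (1/3) + 6*(m+3)* (1/3) + 0) := by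
              nlinarith
          _ ≤ _ := by gcongr
      exact le_of_mul_le_mul_left this (by positivity)

lemma tail_bound {p : ℕ → ℝ} (hp : PRec p) (m : ℕ) (hx : ∀ k, 2 ≤ k → k ≤ m+1 → xs p k ≤ 2/3) :
    tailS p m / (6^(m+2) * (m+2).factorial) ≤ 27 / (m+2) := by
  have h1 : tailS p m ≤ (4/9) * 6^(m+3) * (10 * (m+1).factorial) := by
    refine le_trans ?_ (mul_le_mul_of_nonneg_left (fact_sum m) (by positivity))
    unfold tailS
    rw [Finset.mul_sum]
    apply Finset.sum_le_sum
    intro j hj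
    rw [mem_range] at hj
    have a1 := hx (j+2) (by omega) (by omega)
    have a2 := hx (m+1-j) (by omega) (by omega)
    have b1 := xs_lower hp (j+2)
    have b2 := xs_lower hp (m+1-j)
    rw [p_eq_xs p (j+2), p_eq_xs p (m+1-j)]
    have e : (6:ℝ)^(m+3) = 6^(j+2) * 6^(m+1-j) := by rw [← pow_add]; congr 1; omega
    rw [e]
    have : xs p (j+2) * xs p (m+1-j) ≤ 2/3*(2/3) := by gcongr
    calc _ = 6^(j+2) * 6^(m+1-j) * ((j+2).factorial * (m+1-j).factorial) * (xs p (j+2) * xs p (m+1-j)) := by ring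
      _ ≤ 6^(j+2) * 6^(m+1-j) * ((j+2).factorial * (m+1-j).factorial) * (2/3*(2/3)) := by gcongr
      _ = _ := by ring
  have f2 : ((m+2).factorial : ℝ) = (m+2) * (m+1).factorial := by
    rw [Nat.factorial_succ]; push_cast; ring
  rw [f2, div_le_div_iff₀ (by positivity) (by positivity)]
  have : (0:ℝ) ≤ (m+2) * (6^(m+2) * (m+1).factorial) := by positivity
  calc tailS p m * (m+2) ≤ ((4/9) * 6^(m+3) * (10 * (m+1).factorial)) * (m+2) := by gcongr
    _ = (80/3) * ((m+2) * (6^(m+2) * (m+1).factorial)) := by ring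
    _ ≤ 27 * ((m+2) * (6^(m+2) * (m+1).factorial)) := by gcongr; norm_num
    _ = _ := by ring

lemma xs_upper_aux {p : ℕ → ℝ} (hp : PRec p) (n : ℕ) (hn : 2 ≤ n) : xs p n ≤ 2/3 ∧ (9 ≤ n → xs p n ≤ 2/3 * (1 - 27/10/n)) := by
  obtain ⟨h2, h3, h4, h5, h6, h7, h8, h9, h10⟩ := p_vals hp
  induction n using Nat.strong_induction_on with
  | _ n ih =>
    by_cases hsm : n ≤ 10
    · interval_cases n <;> norm_num [xs, h2, h3, h4, h5, h6, h7, h8, h9, h10, Nat.factorial]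
    · obtain ⟨m, rfl⟩ : ∃ m, n = m+4 := ⟨n-4, by omega⟩
      suffices h : xs p (m+4) ≤ 2/3 * (1 - 27/10/((m+4 : ℕ):ℝ)) by
        refine ⟨h.trans ?_, fun _ => h⟩
        have : (0:ℝ) ≤ 27/10/((m+4 : ℕ):ℝ) := by positivity
        linarith
      have hm : (7:ℝ) ≤ m := by exact_mod_cast (by omega : 7 ≤ m)
      have i2 := (ih (m+2) (by omega) (by omega)).2 (by omega)
      have i3 := (ih (m+3) (by omega) (by omega)).2 (by omega)
      have ht := tail_bound hp m (fun k hk hk2 => (ih k (by omega) hk).1)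
      have h := xs_rec hp m
      have i2' : xs p (m+2) ≤ 2/3 * (1 - 27/10/((m+3 : ℕ):ℝ)) := by
        refine i2.trans ?_
        gcongr
        norm_num
      push_cast at i3 i2' ⊢
      set M := 2/3 * (1 - 27/10/((m:ℝ)+3)) with hM
      have h' : 9*((m:ℝ)+4)^2*(m+3) * xs p (m+4) ≤ 9*((m:ℝ)+4)^2*(m+3) * (2/3 * (1 - 27/10/((m:ℝ)+4))) := by
        rw [h]
        calc _ ≤ (3*(m:ℝ)+11) * (((m+3)*(3*m+7)+4) * M + 6*(m+3)* M + 27/(m+2)) := by gcongr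
          _ ≤ _ := by
            rw [hM, ← sub_nonneg]
            obtain ⟨y, hy, hy0⟩ : ∃ y : ℝ, (m:ℝ) = y + 7 ∧ 0 ≤ y := ⟨m-7, by ring, by linarith⟩
            rw [hy]
            field_simp
            ring_nf
            positivity
      exact le_of_mul_le_mul_left h' (by positivity)


lemma xs_upper {p : ℕ → ℝ} (hp : PRec p) (n : ℕ) : xs p n ≤ 2/3 := by
  match n with
  | 0 => simp [xs, hp.1]; norm_num
  | 1 => simp [xs, hp.2.1]; norm_num
  | n+2 => exact (xs_upper_aux hp (n+2) (by omega)).1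

lemma xs_diff {p : ℕ → ℝ} (hp : PRec p) (n : ℕ) : |xs p (n+3) - xs p (n+2)| ≤ 100 / (n+3) := by
  induction n with
  | zero =>
    have a := xs_upper hp 3
    have b := xs_upper hp 2
    have c := xs_lower hp 3
    have d := xs_lower hp 2
    rw [abs_le]; norm_num; constructor <;> linarith
  | succ m ih =>
    have h := xs_rec hp m
    have ht := tail_bound hp m (fun k _ _ => xs_upper hp k)
    have ht0 : 0 ≤ tailS p m / (6^(m+2) * (m+2).factorial) := by
      have := tailS_nonneg hp m; positivity
    set s := tailS p m / (6^(m+2) * (m+2).factorial) with hs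
    have u3 := xs_upper hp (m+3)
    have l3 := xs_lower hp (m+3)
    have hm : (0:ℝ) ≤ m := by positivity
    have key : 9*((m:ℝ)+4)^2*(m+3) * (xs p (m+4) - xs p (m+3)) =
       -((3*m+11) * ((m+3)*(3*m+7)+4) * (xs p (m+3) - xs p (m+2))) + ((11*m+41) * xs p (m+3) + (3*m+11)*s) := by
      linear_combination h
    have key2 : 9*((m:ℝ)+4)^2*(m+3) * |xs p (m+4) - xs p (m+3)| ≤
        (3*m+11) * ((m+3)*(3*m+7)+4) * (100/(m+3)) + ((11*m+41) * (2/3) + (3*m+11)*(27/(m+2))) := by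
      rw [← abs_of_pos (show (0:ℝ) < 9*((m:ℝ)+4)^2*(m+3) by positivity), ← abs_mul, key]
      refine (abs_add_le _ _).trans ?_
      rw [abs_neg, abs_mul, abs_of_pos (show (0:ℝ) < (3*m+11) * ((m+3)*(3*m+7)+4) by positivity),
        abs_of_nonneg (show (0:ℝ) ≤ ((11*m+41) * xs p (m+3) + (3*m+11)*s) by positivity)]
      gcongr
    have key3 : (3*m+11) * ((m+3)*(3*m+7)+4) * (100/(m+3)) + ((11*m+41) * (2/3) + (3*m+11)*(27/(m+2)))
       ≤ 9*((m:ℝ)+4)^2*(m+3) * (100/(m+4)) := by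
      rw [← sub_nonneg]
      have : (0:ℝ) < m+2 := by positivity
      have : (0:ℝ) < m+3 := by positivity
      have : (0:ℝ) < m+4 := by positivity
      field_simp
      ring_nf
      positivity
    have := le_of_mul_le_mul_left (key2.trans key3) (by positivity)
    refine this.trans (le_of_eq ?_)
    push_cast; ring

lemma estA {p : ℕ → ℝ} (hp : PRec p) (m : ℕ) :
    |4*(3*m+11)/((m:ℝ)+4) * p (m+3) - 2 * p (m+4) / (m+4)| ≤ 1000 * p (m+4) / (m+4)^2 ∧
    tailS p m ≤ 1000 * p (m+4) / (m+4)^3 ∧ p (m+2) ≤ 1000 * p (m+4) / (m+4)^2 := by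
  have f3 : ((m+3).factorial : ℝ) = (m+3) * (m+2).factorial := by
    rw [Nat.factorial_succ]; push_cast; ring
  have f4 : ((m+4).factorial : ℝ) = (m+4) * ((m+3) * (m+2).factorial) := by
    rw [Nat.factorial_succ, Nat.cast_mul, f3]; push_cast; ring
  have hF : (0:ℝ) < 6^(m+2) * (m+2).factorial := by positivity
  have ht := tail_bound hp m (fun k _ _ => xs_upper hp k)
  have hd := xs_diff hp (m+1)
  have u3 := xs_upper hp (m+3)
  have l3 := xs_lower hp (m+3)
  have u2 := xs_upper hp (m+2)
  have l4 := xs_lower hp (m+4)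
  have e4 : p (m+4) = 36 * (m+4)*(m+3) * (6^(m+2) * (m+2).factorial) * xs p (m+4) := by
    rw [p_eq_xs p (m+4), f4]; ring
  have e3 : p (m+3) = 6 * (m+3) * (6^(m+2) * (m+2).factorial) * xs p (m+3) := by
    rw [p_eq_xs p (m+3), f3]; ring
  have e2 : p (m+2) = (6^(m+2) * (m+2).factorial) * xs p (m+2) := by
    rw [p_eq_xs p (m+2)]
  rw [e2, e3, e4]
  rw [div_le_iff₀ hF] at ht
  set F : ℝ := 6^(m+2) * (m+2).factorial
  have hm : (0:ℝ) ≤ m := by positivity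
  have c : ((m+1:ℕ):ℝ) + 3 = m+4 := by push_cast; ring
  rw [c] at hd
  change |xs p (m+4) - xs p (m+3)| ≤ _ at hd
  set x4 := xs p (m+4)
  set x3 := xs p (m+3)
  set x2 := xs p (m+2)
  refine ⟨?_, ?_, ?_⟩
  · have id : 4*(3*m+11)/((m:ℝ)+4) * (6 * (m+3) * F * x3) - 2 * (36 * (m+4)*(m+3) * F * x4) / (m+4)
       = -(36 * (m+3) * F) * (2 * (x4 - x3) + 2/3 * x3/(m+4)) := by
      field_simp; ring
    rw [id, abs_mul, abs_neg, abs_of_pos (by positivity)]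
    have : |2 * (x4 - x3) + 2/3 * x3/(m+4)| ≤ 201/(m+4) := by
      refine (abs_add_le _ _).trans ?_
      rw [abs_mul, abs_of_pos (show (0:ℝ) < 2 by norm_num), abs_of_pos (show 0 < 2/3 * x3/(m+4) by positivity)]
      calc 2 * |x4 - x3| + 2/3 * x3/(m+4) ≤ 2 * (100/(m+4)) + 2/3*(2/3)/(m+4) := by gcongr
        _ = (200+4/9)/(m+4) := by ring
        _ ≤ _ := by gcongr; norm_num
    calc _ ≤ 36 * (m+3) * F * (201/(m+4)) := by gcongr
      _ ≤ 36 * (m+3) * F * (1000 * x4/(m+4)) := by gcongr; linarith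
      _ = _ := by field_simp
  · refine ht.trans ?_
    have : 27/((m:ℝ)+2) ≤ 1000 * (36 * (m+4)*(m+3) * (1/3)) / (m+4)^3 := by
      rw [div_le_div_iff₀ (by positivity) (by positivity), ← sub_nonneg]
      ring_nf
      positivity
    calc 27/((m:ℝ)+2) * F ≤ 1000 * (36 * (m+4)*(m+3) * (1/3)) / (m+4)^3 * F := by gcongr
      _ = 1000 * (36 * (m+4)*(m+3) * F * (1/3)) / (m+4)^3 := by ring
      _ ≤ _ := by gcongr
  · have : 2/3 ≤ 1000 * (36 * ((m:ℝ)+4)*(m+3) * (1/3)) / (m+4)^2 := by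
      rw [div_le_div_iff₀ (by positivity) (by positivity), ← sub_nonneg]
      ring_nf
      positivity
    calc F * x2 ≤ F * (2/3) := by gcongr
      _ ≤ F * (1000 * (36 * ((m:ℝ)+4)*(m+3) * (1/3)) / (m+4)^2) := by gcongr
      _ = 1000 * (36 * (m+4)*(m+3) * F * (1/3)) / (m+4)^2 := by ring
      _ ≤ _ := by gcongr

/-- The comparison sequence: generating function of cycles of permutations. -/
noncomputable def Rn (v : ℂ) (n : ℕ) : ℂ := ∏ j ∈ range n, (1 + v / ((j:ℂ)+1))

lemma Rn_succ (v : ℂ) (n : ℕ) : Rn v (n+1) = Rn v n * (1 + v / ((n:ℂ)+1)) := by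
  unfold Rn; rw [Finset.prod_range_succ]

lemma Rn_norm_le (u : ℂ) (hu : ‖u‖ = 1) (n : ℕ) : ‖Rn (u-1) n‖ ≤ 1 := by
  unfold Rn
  rw [norm_prod]
  apply Finset.prod_le_one (fun _ _ => norm_nonneg _)
  intro j _
  have hj : ((j:ℂ)+1) ≠ 0 := by exact_mod_cast Nat.succ_ne_zero j
  have : 1 + (u-1)/((j:ℂ)+1) = (j + u)/((j:ℂ)+1) := by field_simp; ring
  rw [this, norm_div]
  have h2 : ‖(j:ℂ)+1‖ = (j:ℝ)+1 := by
    have : ((j:ℂ)+1) = ((j+1:ℕ):ℂ) := by push_cast; rfl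
    rw [this, Complex.norm_natCast]; push_cast; rfl
  rw [h2, div_le_one (by positivity)]
  refine (norm_add_le _ _).trans ?_
  rw [hu, Complex.norm_natCast]

lemma norm_natCast_succ (j : ℕ) : ‖(j:ℂ)+1‖ = (j:ℝ)+1 := by
  have : ((j:ℂ)+1) = ((j+1:ℕ):ℂ) := by push_cast; rfl
  rw [this, Complex.norm_natCast]; push_cast; rfl

lemma Rn_sub_one (u : ℂ) (hu : ‖u‖ = 1) (n : ℕ) : ‖Rn (u-1) n - 1‖ ≤ n * ‖u-1‖ := by
  induction n with
  | zero => simp [Rn]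
  | succ n ih =>
    rw [Rn_succ]
    have e : Rn (u-1) n * (1 + (u-1)/((n:ℂ)+1)) - 1 = (Rn (u-1) n - 1) + Rn (u-1) n * ((u-1)/((n:ℂ)+1)) := by ring
    rw [e]
    refine (norm_add_le _ _).trans ?_
    have h1 : ‖Rn (u-1) n * ((u-1)/((n:ℂ)+1))‖ ≤ 1 * ‖u-1‖ := by
      rw [norm_mul, norm_div, norm_natCast_succ]
      gcongr
      · exact Rn_norm_le u hu n
      · apply div_le_self (norm_nonneg _); linarith [(Nat.cast_nonneg n : (0:ℝ) ≤ n)]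
    push_cast
    linarith

lemma tail_diff {p : ℕ → ℝ} (hpos : ∀ n, 0 < p n) (u : ℂ) (hu : ‖u‖ = 1) (P : ℕ → ℂ)
    (hle : ∀ n, ‖P n‖ ≤ p n) (hlin : ∀ n, ‖P n - p n‖ ≤ (3*n+1) * ‖u-1‖ * p n) (m : ℕ) :
    ‖∑ j ∈ range m, P (j+2) * P (m+1-j) - (tailS p m : ℂ) * Rn (u-1) (m+4)‖
      ≤ 4 * (m+4) * ‖u-1‖ * tailS p m := by
  unfold tailS
  push_cast
  rw [Finset.sum_mul, ← Finset.sum_sub_distrib, Finset.mul_sum]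
  refine (norm_sum_le _ _).trans (Finset.sum_le_sum ?_)
  intro j hj
  rw [mem_range] at hj
  have hkl : ((j+2:ℕ):ℝ) + ((m+1-j:ℕ):ℝ) = m+3 := by
    have : (j+2) + (m+1-j) = m+3 := by omega
    exact_mod_cast this
  generalize j+2 = k at *
  generalize m+1-j = l at *
  have e : P k * P l - (p k : ℂ) * p l * Rn (u-1) (m+4) = P k * (P l - p l) + (P k - p k) * p l
     - (p k : ℂ) * p l * (Rn (u-1) (m+4) - 1) := by ring
  rw [e]
  have n1 : ‖P k * (P l - p l)‖ ≤ p k * ((3*l+1) * ‖u-1‖ * p l) := by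
    rw [norm_mul]
    have := hle k; have := hlin l
    have := (hpos k).le
    gcongr
  have n2 : ‖(P k - p k) * p l‖ ≤ ((3*k+1) * ‖u-1‖ * p k) * p l := by
    rw [norm_mul, Complex.norm_real, Real.norm_of_nonneg (hpos l).le]
    have := (hpos l).le
    gcongr
    exact hlin k
  have n3 : ‖(p k : ℂ) * p l * (Rn (u-1) (m+4) - 1)‖ ≤ p k * p l * ((m+4) * ‖u-1‖) := by
    rw [norm_mul, norm_mul, Complex.norm_real, Real.norm_of_nonneg (hpos k).le, Complex.norm_real, Real.norm_of_nonneg (hpos l).le]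
    have h1 := (hpos l).le
    have h2 := (hpos k).le
    have := Rn_sub_one u hu (m+4)
    push_cast at this
    gcongr
  refine (norm_sub_le _ _).trans ?_
  have := norm_add_le (P k * (P l - p l)) ((P k - p k) * p l)
  have hx : 0 ≤ p k * p l * ‖u-1‖ := mul_nonneg (mul_nonneg (hpos k).le (hpos l).le) (norm_nonneg _)
  have : p k * ((3*l+1) * ‖u-1‖ * p l) + ((3*k+1) * ‖u-1‖ * p k) * p l + p k * p l * ((m+4) * ‖u-1‖)
    = (3 * (k + l) + 2 + (m+4)) * (p k * p l * ‖u-1‖) := by ring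
  have : (3 * (k + l) + 2 + (m+4)) * (p k * p l * ‖u-1‖) ≤ (4*(m+4)) * (p k * p l * ‖u-1‖) := by
    rw [hkl]
    gcongr
    linarith
  linarith

set_option maxHeartbeats 2000000 in
lemma estB {p : ℕ → ℝ} (hp : PRec p) (u : ℂ) (hu : ‖u‖ = 1) (P : ℕ → ℂ)
    (hP0 : P 0 = u/2) (hP1 : P 1 = 2*u^2)
    (hrec : ∀ m : ℕ, ((m:ℂ)+2) * P (m+2) = 4 * (m+1) * (3*m+5) * (3*m+1) * P m
      + 4 * (3*m+5) * ∑ ij ∈ antidiagonal (m+1), P ij.1 * P ij.2)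
    (hle : ∀ n, ‖P n‖ ≤ p n) (hlin : ∀ n, ‖P n - p n‖ ≤ (3*n+1) * ‖u-1‖ * p n) (n : ℕ) :
    ‖P n - p n * Rn (u-1) n‖ ≤ 400000 * (2 - 1/((n:ℝ)+1)) * ‖u-1‖ * p n := by
  have hpos := p_pos hp
  induction n using Nat.strong_induction_on with
  | _ n ih =>
  by_cases hn : n < 4
  · have e : P n - p n * Rn (u-1) n = (P n - p n) - p n * (Rn (u-1) n - 1) := by ring
    rw [e]
    refine (norm_sub_le _ _).trans ?_
    have h1 := hlin n
    have h2 : ‖(p n : ℂ) * (Rn (u-1) n - 1)‖ ≤ p n * (n * ‖u-1‖) := by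
      rw [norm_mul, Complex.norm_real, Real.norm_of_nonneg (hpos n).le]
      have := (hpos n).le
      gcongr
      exact Rn_sub_one u hu n
    have h3 : (n:ℝ) ≤ 3 := by exact_mod_cast (by omega : n ≤ 3)
    have h4 : 1/((n:ℝ)+1) ≤ 1 := by
      rw [div_le_one (by positivity)]; linarith [(Nat.cast_nonneg n : (0:ℝ) ≤ n)]
    have hx : 0 ≤ ‖u-1‖ * p n := mul_nonneg (norm_nonneg _) (hpos n).le
    have h5 : (4*(n:ℝ)+1) * (‖u-1‖ * p n) ≤ (400000 * (2 - 1/((n:ℝ)+1))) * (‖u-1‖ * p n) := by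
      apply mul_le_mul_of_nonneg_right _ hx
      linarith
    linarith
  · obtain ⟨m, rfl⟩ : ∃ m, n = m+4 := ⟨n-4, by omega⟩
    have i3 := ih (m+3) (by omega)
    have i2 := ih (m+2) (by omega)
    obtain ⟨a1, a2, a3⟩ := estA hp m
    have htl := tail_diff hpos u hu P hle hlin m
    have r4 := rec4 hp m
    have hN0 : (m:ℂ) + 4 ≠ 0 := by exact_mod_cast (by omega : m+4 ≠ 0)
    have hN1 : (m:ℂ) + 3 ≠ 0 := by exact_mod_cast (by omega : m+3 ≠ 0)
    have hm : (0:ℝ) ≤ m := by positivity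
    have hv := norm_nonneg (u-1)
    have hs0 := tailS_nonneg hp m
    have p2 := hpos (m+2)
    have p3 := hpos (m+3)
    have p4 := hpos (m+4)
    -- complex recursion
    have R4 : ((m:ℂ)+4) * P (m+4) = 4 * (3*m+11) * (((m+3)*(3*m+7)+4*u^2) * P (m+2) + u * P (m+3)
        + ∑ j ∈ range m, P (j+2) * P (m+1-j)) := by
      have h := hrec (m+2)
      rw [split_anti P m, hP0, hP1] at h
      push_cast at h
      rw [show m+2+2 = m+4 from rfl] at h
      linear_combination h
    set S : ℂ := ∑ j ∈ range m, P (j+2) * P (m+1-j) with hS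
    set s : ℝ := tailS p m with hs
    set c : ℝ := 4*(3*m+11)/((m:ℝ)+4) with hc
    have hc0 : 0 < c := by positivity
    have hc12 : c ≤ 12 := by
      rw [hc, div_le_iff₀ (by positivity)]; linarith
    set A : ℝ := c * ((m+3)*(3*m+7)+4) * p (m+2) with hA
    set B : ℝ := c * p (m+3) with hB
    have hA0 : 0 ≤ A := by positivity
    have hB0 : 0 ≤ B := by positivity
    have hsum : p (m+4) = A + B + c * s := by
      rw [hA, hB, hc]; field_simp; linear_combination r4
    have hPsum : P (m+4) = c * (((m+3)*(3*m+7)+4*u^2) * P (m+2) + u * P (m+3) + S) := by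
      rw [hc]; push_cast; field_simp; linear_combination R4
    have hR3 : Rn (u-1) (m+3) = Rn (u-1) (m+2) * (1 + (u-1)/(m+3)) := by
      have := Rn_succ (u-1) (m+2)
      push_cast at this
      rw [show m+2+1 = m+3 from rfl] at this
      rw [this]; ring
    have hR4 : Rn (u-1) (m+4) = Rn (u-1) (m+2) * (1 + (u-1)/(m+3)) * (1 + (u-1)/(m+4)) := by
      have := Rn_succ (u-1) (m+3)
      push_cast at this
      rw [show m+3+1 = m+4 from rfl] at this
      rw [this, hR3]; ring
    set R := Rn (u-1) (m+2) with hR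
    have hRn : ‖R‖ ≤ 1 := Rn_norm_le u hu _
    have key : P (m+4) - p (m+4) * Rn (u-1) (m+4) =
        (c * ((m+3)*(3*m+7)+4) : ℝ) * (P (m+2) - p (m+2) * Rn (u-1) (m+2))
        + c * u * (P (m+3) - p (m+3) * Rn (u-1) (m+3))
        - (u-1) * R * ((2 * A / (m+4) - B : ℝ) + (A/((m+4)*(m+3)) : ℝ) * u + (B/(m+4) : ℝ) * (2-u))
        + c * 4 * (u^2-1) * P (m+2)
        + c * (S - s * Rn (u-1) (m+4)) := by
      rw [hPsum, hsum, ← hR]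
      rw [hR3, hR4, hA, hB]
      push_cast
      field_simp
      ring
    set w : ℝ := p (m+4) / (m+4)^2 with hw
    have hw0 : 0 < w := by positivity
    set M : ℝ := 400000 * (2 - 1/((m:ℝ)+4)) with hM
    have hM0 : 0 ≤ M := by
      have : 1/((m:ℝ)+4) ≤ 1 := by rw [div_le_one (by positivity)]; linarith
      rw [hM]; linarith
    have hNw : p (m+4) / (m+4) = (m+4) * w := by rw [hw]; field_simp
    have a1' : |B - 2 * ((m+4) * w)| ≤ 1000 * w := by
      have e1 : 2 * ((m+4) * w) = 2 * p (m+4) / (m+4) := by rw [← hNw]; ring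
      have e2 : 1000 * w = 1000 * p (m+4) / (m+4)^2 := by rw [hw]; ring
      rw [e1, e2]; exact a1
    have a2' : (m+4) * s ≤ 1000 * w := by
      calc ((m:ℝ)+4) * s ≤ (m+4) * (1000 * p (m+4) / (m+4)^3) := by gcongr
        _ = 1000 * w := by rw [hw]; field_simp
    have a3' : p (m+2) ≤ 1000 * w := by
      refine a3.trans (le_of_eq ?_); rw [hw]; ring
    have hBN : B ≤ 252 * ((m+4) * w) := by
      have h1 := (abs_le.1 a1').2
      have h3 : 4 * w ≤ (m+4) * w := by gcongr; linarith
      linarith only [h1, h3]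
    have t1 : ‖((c * ((m+3)*(3*m+7)+4) : ℝ) : ℂ) * (P (m+2) - p (m+2) * Rn (u-1) (m+2))‖ ≤ A * M * ‖u-1‖ := by
      rw [norm_mul, Complex.norm_real, Real.norm_of_nonneg (by positivity)]
      have : ‖P (m+2) - p (m+2) * Rn (u-1) (m+2)‖ ≤ M * ‖u-1‖ * p (m+2) := by
        refine i2.trans ?_
        have e : ((m+2:ℕ):ℝ) + 1 = m + 3 := by push_cast; ring
        have hle1 : 1/((m:ℝ)+4) ≤ 1/(m+3) := by gcongr; norm_num
        have hle2 : 400000 * (2 - 1/((m:ℝ)+3)) ≤ M := by rw [hM]; linarith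
        rw [e]
        gcongr
      calc _ ≤ (c * ((m+3)*(3*m+7)+4)) * (M * ‖u-1‖ * p (m+2)) := by gcongr
        _ = _ := by rw [hA]; ring
    have t2 : ‖(c:ℂ) * u * (P (m+3) - p (m+3) * Rn (u-1) (m+3))‖ ≤ B * M * ‖u-1‖ := by
      rw [norm_mul, norm_mul, hu, Complex.norm_real, Real.norm_of_nonneg (by positivity)]
      have : ‖P (m+3) - p (m+3) * Rn (u-1) (m+3)‖ ≤ M * ‖u-1‖ * p (m+3) := by
        refine i3.trans (le_of_eq ?_)
        rw [hM]
        push_cast; ring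
      calc _ ≤ c * 1 * (M * ‖u-1‖ * p (m+3)) := by gcongr
        _ = _ := by rw [hB]; ring
    have q1 : |2 * A / (m+4) - B| ≤ 8000 * w := by
      have e : 2 * A / (m+4) - B = -(B - 2 * ((m+4)*w)) - 2/(m+4) * (B + c * s) := by
        rw [← hNw, hsum]; ring
      rw [e]
      refine (abs_sub _ _).trans ?_
      rw [abs_neg, abs_of_nonneg (show 0 ≤ 2/((m:ℝ)+4) * (B + c * s) by positivity)]
      have hcs : c * s ≤ 3000 * ((m+4) * w) := by
        have h0 : 4 * s ≤ (m+4) * s := by gcongr; linarith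
        have h2 : c * s ≤ 12 * s := by gcongr
        have h3 : 4 * w ≤ (m+4) * w := by gcongr; linarith
        linarith only [h0, h2, h3, a2', hw0]
      calc _ ≤ 1000 * w + 2/((m:ℝ)+4) * (252 * ((m+4) * w) + 3000 * ((m+4) * w)) := by gcongr
        _ = 7504 * w := by field_simp; ring
        _ ≤ _ := by linarith
    have hAp : A ≤ p (m+4) := by
      have : 0 ≤ c * s := by positivity
      linarith
    have q2 : A/((m+4)*(m+3)) ≤ 2 * w := by
      calc A/((m+4)*(m+3)) ≤ p (m+4)/((m+4)*((m+4)/2)) := by gcongr; linarith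
        _ = 2 * w := by rw [hw]; field_simp
    have q3 : B/(m+4) ≤ 252 * w := by
      rw [div_le_iff₀ (by positivity)]; linarith
    have n2u : ‖2-u‖ ≤ 3 := by
      refine (norm_sub_le _ _).trans ?_
      rw [hu]; norm_num
    have t3 : ‖(u-1) * R * ((2 * A / (m+4) - B : ℝ) + (A/((m+4)*(m+3)) : ℝ) * u + (B/(m+4) : ℝ) * (2-u))‖
        ≤ ‖u-1‖ * (10000 * w) := by
      rw [norm_mul, norm_mul]
      have : ‖((2 * A / (m+4) - B : ℝ):ℂ) + (A/((m+4)*(m+3)) : ℝ) * u + (B/(m+4) : ℝ) * (2-u)‖ ≤ 10000 * w := by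
        refine (norm_add_le _ _).trans ?_
        refine (add_le_add_left (norm_add_le _ _) _).trans ?_
        rw [norm_mul, norm_mul, hu, Complex.norm_real, Complex.norm_real, Complex.norm_real,
          Real.norm_eq_abs, Real.norm_of_nonneg (show 0 ≤ A/(((m:ℝ)+4)*(m+3)) by positivity),
          Real.norm_of_nonneg (show 0 ≤ B/((m:ℝ)+4) by positivity)]
        calc _ ≤ 8000 * w + 2 * w * 1 + 252 * w * 3 := by gcongr
          _ ≤ _ := by linarith
      calc _ ≤ ‖u-1‖ * 1 * (10000 * w) := by gcongr
        _ = _ := by ring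
    have t4 : ‖(c:ℂ) * 4 * (u^2-1) * P (m+2)‖ ≤ ‖u-1‖ * (96000 * w) := by
      have e : u^2 - 1 = (u-1) * (u+1) := by ring
      rw [e, norm_mul, norm_mul, norm_mul, norm_mul, Complex.norm_real, Real.norm_of_nonneg hc0.le]
      have h1 : ‖u+1‖ ≤ 2 := by
        refine (norm_add_le _ _).trans ?_
        rw [hu]; norm_num
      have h2 : ‖P (m+2)‖ ≤ 1000 * w := (hle _).trans a3'
      have h4 : ‖(4:ℂ)‖ = 4 := by norm_num
      rw [h4]
      calc _ ≤ 12 * 4 * (‖u-1‖ * 2) * (1000 * w) := by gcongr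
        _ = _ := by ring
    have t5 : ‖(c:ℂ) * (S - s * Rn (u-1) (m+4))‖ ≤ ‖u-1‖ * (48000 * w) := by
      rw [norm_mul, Complex.norm_real, Real.norm_of_nonneg hc0.le]
      calc _ ≤ 12 * (4 * (m+4) * ‖u-1‖ * s) := by gcongr
        _ = 48 * ‖u-1‖ * ((m+4) * s) := by ring
        _ ≤ 48 * ‖u-1‖ * (1000 * w) := by gcongr
        _ = _ := by ring
    have hfin : ‖P (m+4) - p (m+4) * Rn (u-1) (m+4)‖ ≤ (A+B) * M * ‖u-1‖ + ‖u-1‖ * (160000 * w) := by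
      rw [key]
      refine (norm_add_le _ _).trans ?_
      refine (add_le_add_left (norm_add_le _ _) _).trans ?_
      refine (add_le_add_left (add_le_add_left (norm_sub_le _ _) _) _).trans ?_
      refine (add_le_add_left (add_le_add_left (add_le_add_left (norm_add_le _ _) _) _) _).trans ?_
      have : 0 ≤ ‖u-1‖ * w := by positivity
      linarith
    refine hfin.trans ?_
    have hAB : A + B ≤ p (m+4) := by
      have : 0 ≤ c * s := by positivity
      linarith
    have hstep : M * p (m+4) + 160000 * w ≤ 400000 * (2 - 1/((m:ℝ)+4+1)) * p (m+4) := by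
      have e : p (m+4) = (m+4)^2 * w := by rw [hw]; field_simp
      rw [e, hM, ← sub_nonneg]
      have : 400000 * (2 - 1/((m:ℝ)+4+1)) * ((m+4)^2 * w) - (400000 * (2 - 1/((m:ℝ)+4)) * ((m+4)^2 * w) + 160000 * w)
        = w * ((240000 * (m+4) - 160000) / (m+5)) := by
        have : (m:ℝ)+4+1 = m+5 := by ring
        rw [this]
        field_simp; ring
      rw [this]
      apply mul_nonneg hw0.le
      apply div_nonneg <;> linarith
    calc (A+B) * M * ‖u-1‖ + ‖u-1‖ * (160000 * w) ≤ p (m+4) * M * ‖u-1‖ + ‖u-1‖ * (160000 * w) := by gcongr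
      _ = (M * p (m+4) + 160000 * w) * ‖u-1‖ := by ring
      _ ≤ (400000 * (2 - 1/((m:ℝ)+4+1)) * p (m+4)) * ‖u-1‖ := by gcongr
      _ = _ := by push_cast; ring

lemma Rn_log (v : ℂ) (hv : ‖v‖ ≤ 1/2) (n : ℕ) :
    ∃ e : ℂ, Rn v n = Complex.exp (v * ((harmonic n : ℚ) : ℝ) + e) ∧ ‖e‖ ≤ 4 * ‖v‖^2 := by
  suffices h : ∃ e : ℂ, Rn v n = Complex.exp (v * ((harmonic n : ℚ) : ℝ) + e) ∧
      ‖e‖ ≤ (4 - 2/((n:ℝ)+1)) * ‖v‖^2 by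
    obtain ⟨e, h1, h2⟩ := h
    refine ⟨e, h1, h2.trans ?_⟩
    gcongr
    have : (0:ℝ) ≤ 2/((n:ℝ)+1) := by positivity
    linarith
  induction n with
  | zero => exact ⟨0, by simp [Rn], by norm_num⟩
  | succ n ih =>
    obtain ⟨e, h1, h2⟩ := ih
    have hz : ‖v/((n:ℂ)+1)‖ = ‖v‖/((n:ℝ)+1) := by rw [norm_div, norm_natCast_succ]
    have hn : (0:ℝ) ≤ n := by positivity
    have hz2 : ‖v/((n:ℂ)+1)‖ ≤ 1/2 := by
      rw [hz]; exact (div_le_self (norm_nonneg _) (by linarith)).trans hv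
    have hl := Complex.norm_log_one_add_sub_self_le (z := v/((n:ℂ)+1)) (by linarith)
    have hne : 1 + v/((n:ℂ)+1) ≠ 0 := by
      intro h0
      have : v/((n:ℂ)+1) = -1 := by linear_combination h0
      rw [this] at hz2; norm_num at hz2
    refine ⟨e + (Complex.log (1 + v/((n:ℂ)+1)) - v/((n:ℂ)+1)), ?_, ?_⟩
    · rw [Rn_succ, h1, harmonic_succ]
      nth_rewrite 1 [← Complex.exp_log hne]
      rw [← Complex.exp_add]
      congr 1
      push_cast
      ring
    · refine (norm_add_le _ _).trans ?_
      have h3 : ‖Complex.log (1 + v/((n:ℂ)+1)) - v/((n:ℂ)+1)‖ ≤ (‖v‖/((n:ℝ)+1))^2 := by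
        refine hl.trans ?_
        rw [hz] at hz2 ⊢
        have h4 : (1 - ‖v‖/((n:ℝ)+1))⁻¹ ≤ 2 := by
          rw [inv_le_comm₀ (by linarith) (by norm_num)]; linarith
        calc _ ≤ (‖v‖/((n:ℝ)+1))^2 * 2 / 2 := by gcongr
          _ = _ := by ring
      have h5 : (4 - 2/((n:ℝ)+1)) + 1/((n:ℝ)+1)^2 ≤ 4 - 2/((n:ℝ)+1+1) := by
        rw [← sub_nonneg]
        have : 4 - 2/((n:ℝ)+1+1) - ((4 - 2/((n:ℝ)+1)) + 1/((n:ℝ)+1)^2) = n / ((n+1)^2*(n+2)) := by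
          have : (n:ℝ)+1+1 = n+2 := by ring
          rw [this]; field_simp; ring
        rw [this]; positivity
      calc _ ≤ (4 - 2/((n:ℝ)+1)) * ‖v‖^2 + (‖v‖/((n:ℝ)+1))^2 := add_le_add h2 h3
        _ = ((4 - 2/((n:ℝ)+1)) + 1/((n:ℝ)+1)^2) * ‖v‖^2 := by field_simp
        _ ≤ (4 - 2/((n:ℝ)+1+1)) * ‖v‖^2 := by gcongr
        _ = _ := by push_cast; ring

lemma harm_lim : Tendsto (fun n : ℕ => ((harmonic (n+1) : ℚ) : ℝ) - Real.log n) atTop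
    (nhds Real.eulerMascheroniConstant) := by
  have h := Real.tendsto_harmonic_sub_log
  have h2 : Tendsto (fun n : ℕ => ((1:ℝ) / ((n:ℝ)+1))) atTop (nhds 0) := tendsto_one_div_add_atTop_nhds_zero_nat
  have := h.add h2
  rw [add_zero] at this
  refine this.congr fun n => ?_
  rw [harmonic_succ]; push_cast; ring

lemma sqrt_log_tendsto : Tendsto (fun n : ℕ => Real.sqrt (Real.log n)) atTop atTop :=
  Real.tendsto_sqrt_atTop.comp (Real.tendsto_log_atTop.comp tendsto_natCast_atTop_atTop)

lemma u_tendsto (s : ℝ) : Tendsto (fun n : ℕ =>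
    ‖Complex.exp (Complex.I * (-s / Real.sqrt (Real.log n) : ℝ)) - 1‖) atTop (nhds 0) := by
  have h1 : Tendsto (fun n : ℕ => -s / Real.sqrt (Real.log n)) atTop (nhds 0) :=
    sqrt_log_tendsto.const_div_atTop _
  have hc : Continuous (fun x : ℝ => ‖Complex.exp (Complex.I * (x:ℂ)) - 1‖) := by fun_prop
  have h2 := (hc.tendsto 0).comp h1
  have h3 : ‖Complex.exp (Complex.I * ((0:ℝ):ℂ)) - 1‖ = 0 := by simp
  rw [h3] at h2
  exact h2

lemma Rn_lim (s : ℝ) : Tendsto (fun n : ℕ =>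
    Complex.exp (Complex.I * (s * (2 + Real.log n) / Real.sqrt (Real.log n) : ℝ)) *
      Rn (Complex.exp (Complex.I * (-s / Real.sqrt (Real.log n) : ℝ)) - 1) (n+1)) atTop
    (nhds (Complex.exp (-(s:ℂ)^2/2))) := by
  have hv0 := u_tendsto s
  set x : ℕ → ℂ := fun n => Complex.I * (-s / Real.sqrt (Real.log n) : ℝ) with hx
  set v : ℕ → ℂ := fun n => Complex.exp (x n) - 1 with hv
  have hv0' : Tendsto (fun n => ‖v n‖) atTop (nhds 0) := hv0
  have hvsmall : ∀ᶠ n in atTop, ‖v n‖ ≤ 1/2 := hv0'.eventually_le_const (by norm_num)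
  have hex : ∀ n, ∃ e : ℂ, ‖v n‖ ≤ 1/2 → Rn (v n) (n+1) = Complex.exp (v n * ((harmonic (n+1) : ℚ) : ℝ) + e) ∧ ‖e‖ ≤ 4 * ‖v n‖^2 := by
    intro n
    by_cases h : ‖v n‖ ≤ 1/2
    · obtain ⟨e, he⟩ := Rn_log (v n) h (n+1)
      exact ⟨e, fun _ => he⟩
    · exact ⟨0, fun h' => absurd h' h⟩
  choose e he using hex
  have he0 : Tendsto e atTop (nhds 0) := by
    have hb : Tendsto (fun n => 4 * ‖v n‖^2) atTop (nhds 0) := by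
      have := (hv0'.pow 2).const_mul 4
      simpa using this
    refine squeeze_zero_norm' ?_ hb
    filter_upwards [hvsmall] with n hn using (he n hn).2
  have hinv : Tendsto (fun n : ℕ => |s| / Real.sqrt (Real.log n)) atTop (nhds 0) :=
    sqrt_log_tendsto.const_div_atTop _
  have hxn : ∀ n, ‖x n‖ = |s| / Real.sqrt (Real.log n) := by
    intro n
    simp only [hx]
    rw [norm_mul, Complex.norm_I, one_mul, Complex.norm_real, Real.norm_eq_abs, abs_div, abs_neg,
      abs_of_nonneg (Real.sqrt_nonneg _)]
  have hLpos : ∀ᶠ n : ℕ in atTop, 0 < Real.sqrt (Real.log n) := sqrt_log_tendsto.eventually_gt_atTop 0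
  -- the quadratic remainder
  have hq : Tendsto (fun n : ℕ => (v n - x n - (x n)^2/2) * (Real.log n : ℂ)) atTop (nhds 0) := by
    have hb : Tendsto (fun n : ℕ => |s|^2 * (|s| / Real.sqrt (Real.log n))) atTop (nhds 0) := by
      have := hinv.const_mul (|s|^2)
      rwa [mul_zero] at this
    refine squeeze_zero_norm' ?_ hb
    have hx1 : ∀ᶠ n in atTop, ‖x n‖ ≤ 1 := by
      simp only [hxn]
      exact hinv.eventually_le_const (by norm_num)
    filter_upwards [hx1, hLpos] with n hn hL
    have h := Complex.exp_bound hn (n := 3) (by norm_num)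
    have e1 : Complex.exp (x n) - ∑ m ∈ range 3, (x n)^m / (m.factorial : ℂ) = v n - x n - (x n)^2/2 := by
      simp [Finset.sum_range_succ, hv, Nat.factorial]
      ring
    rw [e1] at h
    have hlog : Real.log n = Real.sqrt (Real.log n) ^ 2 := by
      rw [Real.sq_sqrt]
      by_contra hneg
      rw [Real.sqrt_eq_zero_of_nonpos (by linarith)] at hL
      exact lt_irrefl _ hL
    rw [norm_mul, Complex.norm_real, Real.norm_eq_abs]
    have h' : ‖v n - x n - (x n)^2/2‖ ≤ ‖x n‖^3 := by
      refine h.trans ?_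
      have : 0 ≤ ‖x n‖^3 := by positivity
      norm_num [Nat.factorial]
      linarith
    rw [hxn] at h'
    generalize Real.sqrt (Real.log n) = r at *
    rw [hlog, abs_of_nonneg (by positivity)]
    calc _ ≤ (|s| / r)^3 * r ^ 2 := by gcongr
      _ = _ := by field_simp
  have hvc : Tendsto v atTop (nhds 0) := tendsto_zero_iff_norm_tendsto_zero.2 hv0'
  have hharm : Tendsto (fun n : ℕ => v n * ((((harmonic (n+1) : ℚ) : ℝ) - Real.log n : ℝ) : ℂ)) atTop (nhds 0) := by
    have h1 := (Complex.continuous_ofReal.tendsto _).comp harm_lim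
    have := hvc.mul h1
    simpa using this
  have h2s : Tendsto (fun n : ℕ => -2 * x n) atTop (nhds 0) := by
    have : Tendsto x atTop (nhds 0) := by
      rw [tendsto_zero_iff_norm_tendsto_zero]
      simpa only [hxn] using hinv
    simpa using this.const_mul (-2)
  have htot : Tendsto (fun n : ℕ => -2 * x n + v n * ((((harmonic (n+1) : ℚ) : ℝ) - Real.log n : ℝ) : ℂ)
      + (v n - x n - (x n)^2/2) * (Real.log n : ℂ) + e n + (-(s:ℂ)^2/2)) atTop (nhds (-(s:ℂ)^2/2)) := by
    have := (((h2s.add hharm).add hq).add he0).add_const (-(s:ℂ)^2/2)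
    simpa using this
  have hexp := (Complex.continuous_exp.tendsto _).comp htot
  refine hexp.congr' ?_
  filter_upwards [hvsmall, hLpos] with n hn hL
  change _ = _ * Rn (v n) (n+1)
  rw [(he n hn).1, ← Complex.exp_add]
  simp only [Function.comp]
  congr 1
  have hlog : Real.log n = Real.sqrt (Real.log n) ^ 2 := by
    rw [Real.sq_sqrt]
    by_contra hneg
    rw [Real.sqrt_eq_zero_of_nonpos (by linarith)] at hL
    exact lt_irrefl _ hL
  have hLc : ((Real.sqrt (Real.log n) : ℝ) : ℂ) ≠ 0 := by exact_mod_cast hL.ne'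
  simp only [hx]
  generalize Real.sqrt (Real.log n) = r at *
  rw [hlog]
  push_cast
  field_simp
  rw [Complex.I_sq]
  ring

/-- The hypotheses on `H`, re-indexed by natural numbers (`h N g = H (N-1) g`). -/
structure HRec (h : ℕ → ℕ → ℝ) : Prop where
  h0 : ∀ g, h 0 g = if g = 0 then 1/2 else 0
  h1 : ∀ g, h 1 g = if g = 0 then 2 else 0
  hrec : ∀ m g : ℕ, ((m:ℝ)+2) * h (m+2) g =
    4 * (m+1) * (3*m+5) * (3*m+1) * (if g = 0 then 0 else h m (g-1))
      + 4 * (3*m+5) * ∑ ij ∈ antidiagonal (m+1), ∑ ab ∈ antidiagonal g, h ij.1 ab.1 * h ij.2 ab.2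

lemma sum_Icc_int {M : Type*} [AddCommMonoid M] (f : ℤ → M) (a : ℤ) (n : ℕ) :
    ∑ k ∈ Finset.Icc a (a + n - 1), f k = ∑ i ∈ range n, f (a + i) := by
  refine Finset.sum_nbij' (fun k => (k - a).toNat) (fun i => a + i) ?_ ?_ ?_ ?_ ?_
  · intro k hk; simp only [Finset.mem_Icc] at hk; simp only [Finset.mem_range]; omega
  · intro k hk; simp only [Finset.mem_range] at hk; simp only [Finset.mem_Icc]; omega
  · intro k hk; simp only [Finset.mem_Icc] at hk; omega
  · intro k hk; omega
  · intro k hk; simp only [Finset.mem_Icc] at hk; congr 1; omega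

lemma HRec_of (H : ℤ → ℤ → ℚ)
    (hH1 : ∀ g : ℤ, H (-1) g = if g = 0 then 1/2 else 0)
    (hH2 : ∀ g : ℤ, H 0 g = if g = 0 then 2 else 0)
    (hH3 : ∀ n g : ℤ, g < 0 → H n g = 0)
    (hHrec : ∀ n g : ℤ, 1 ≤ n → 0 ≤ g →
      H n g = (4*n*(3*n+2)*(3*n-2)/(n+1)) * H (n-2) (g-1)
        + (4*(3*n+2)/(n+1)) *
          ∑ k ∈ Finset.Icc (-1 : ℤ) (n-1), ∑ i ∈ Finset.Icc (0 : ℤ) g,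
            H k i * H (n-2-k) (g-i)) :
    HRec (fun N g => ((H ((N:ℤ)-1) g : ℚ) : ℝ)) := by
  refine ⟨?_, ?_, ?_⟩
  · intro g
    have := hH1 g
    simp only [Nat.cast_eq_zero] at this
    simp only [Nat.cast_zero, zero_sub, this]
    split_ifs <;> norm_num
  · intro g
    have := hH2 g
    simp only [Nat.cast_eq_zero] at this
    simp only [Nat.cast_one, sub_self, this]
    split_ifs <;> norm_num
  · intro m g
    have h := hHrec ((m:ℤ)+1) g (by omega) (by omega)
    have e1 : (m:ℤ)+1-1 = -1 + ((m+2:ℕ):ℤ) - 1 := by push_cast; ring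
    have e2 : (g:ℤ) = 0 + ((g+1:ℕ):ℤ) - 1 := by push_cast; ring
    rw [e1, sum_Icc_int] at h
    have e3 : ∑ i ∈ range (m+2), ∑ j ∈ Finset.Icc (0:ℤ) g, H (-1 + i) j * H ((m:ℤ)+1-2-(-1+i)) (g-j)
       = ∑ ij ∈ antidiagonal (m+1), ∑ ab ∈ antidiagonal g, H ((ij.1:ℤ)-1) ab.1 * H ((ij.2:ℤ)-1) ab.2 := by
      rw [Finset.Nat.sum_antidiagonal_eq_sum_range_succ_mk]
      apply Finset.sum_congr rfl
      intro i hi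
      rw [mem_range] at hi
      rw [Finset.Nat.sum_antidiagonal_eq_sum_range_succ_mk]
      have := sum_Icc_int (fun j => H (-1 + i) j * H ((m:ℤ)+1-2-(-1+i)) (g-j)) 0 (g+1)
      rw [← e2] at this
      rw [this]
      apply Finset.sum_congr rfl
      intro j hj
      rw [mem_range] at hj
      congr 2 <;> omega
    rw [e3] at h
    have e4 : H ((m:ℤ)+1-2) ((g:ℤ)-1) = if g = 0 then 0 else H ((m:ℤ)-1) ((g-1:ℕ):ℤ) := by
      split_ifs with hg
      · subst hg; exact hH3 _ _ (by norm_num)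
      · rw [show (m:ℤ)+1-2 = m-1 by ring]
        congr 1
        omega
    rw [e4] at h
    have e5 : (((m+2:ℕ):ℤ)-1) = (m:ℤ)+1 := by push_cast; ring
    simp only [e5]
    have hQ : ((m:ℚ)+2) * H ((m:ℤ)+1) g = 4 * (m+1) * (3*m+5) * (3*m+1) * (if g = 0 then 0 else H ((m:ℤ)-1) ((g-1:ℕ):ℤ))
      + 4 * (3*m+5) * ∑ ij ∈ antidiagonal (m+1), ∑ ab ∈ antidiagonal g, H ((ij.1:ℤ)-1) ab.1 * H ((ij.2:ℤ)-1) ab.2 := by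
      rw [h]
      push_cast
      have : (m:ℚ)+1+1 ≠ 0 := by positivity
      field_simp
      ring
    have hR := congrArg (fun q : ℚ => (q:ℝ)) hQ
    push_cast at hR
    rw [hR]
    congr 2
    split_ifs <;> simp

lemma h_nonneg {h : ℕ → ℕ → ℝ} (hh : HRec h) (N : ℕ) : ∀ g, 0 ≤ h N g := by
  induction N using Nat.strong_induction_on with
  | _ N ih =>
    match N, ih with
    | 0, _ => intro g; rw [hh.h0]; split_ifs <;> norm_num
    | 1, _ => intro g; rw [hh.h1]; split_ifs <;> norm_num
    | m+2, ih =>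
      intro g
      have e := hh.hrec m g
      have h1 : 0 ≤ (if g = 0 then 0 else h m (g-1)) := by
        split_ifs
        · exact le_rfl
        · exact ih m (by omega) _
      have h2 : 0 ≤ ∑ ij ∈ antidiagonal (m+1), ∑ ab ∈ antidiagonal g, h ij.1 ab.1 * h ij.2 ab.2 := by
        refine Finset.sum_nonneg fun ij hij => Finset.sum_nonneg fun ab _ => ?_
        rw [Finset.HasAntidiagonal.mem_antidiagonal] at hij
        exact mul_nonneg (ih _ (by omega) _) (ih _ (by omega) _)
      have h3 : 0 ≤ ((m:ℝ)+2) * h (m+2) g := by rw [e]; positivity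
      exact nonneg_of_mul_nonneg_right h3 (by positivity)

lemma h_vanish {h : ℕ → ℕ → ℝ} (hh : HRec h) (N : ℕ) : ∀ g, N ≤ g → 1 ≤ g → h N g = 0 := by
  induction N using Nat.strong_induction_on with
  | _ N ih =>
    match N, ih with
    | 0, _ => intro g _ hg; rw [hh.h0, if_neg (by omega)]
    | 1, _ => intro g _ hg; rw [hh.h1, if_neg (by omega)]
    | m+2, ih =>
      intro g hg1 hg2
      have e := hh.hrec m g
      rw [if_neg (by omega), ih m (by omega) (g-1) (by omega) (by omega)] at e
      have h2 : ∑ ij ∈ antidiagonal (m+1), ∑ ab ∈ antidiagonal g, h ij.1 ab.1 * h ij.2 ab.2 = 0 := by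
        refine Finset.sum_eq_zero fun ij hij => Finset.sum_eq_zero fun ab hab => ?_
        rw [Finset.HasAntidiagonal.mem_antidiagonal] at hij hab
        by_cases hc : ij.1 ≤ ab.1 ∧ 1 ≤ ab.1
        · rw [ih _ (by omega) _ hc.1 hc.2, zero_mul]
        · rw [ih ij.2 (by omega) ab.2 (by omega) (by omega), mul_zero]
      rw [h2] at e
      have h3 : ((m:ℝ)+2) * h (m+2) g = 0 := by rw [e]; ring
      have : (m:ℝ)+2 ≠ 0 := by positivity
      exact (mul_eq_zero.1 h3).resolve_left this

open Polynomial in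
/-- Genus polynomials. -/
noncomputable def Gp (h : ℕ → ℕ → ℝ) (N : ℕ) : Polynomial ℝ := ∑ g ∈ range (N+1), C (h N g) * X^g

open Polynomial in
lemma Gp_coeff {h : ℕ → ℕ → ℝ} (hh : HRec h) (N g : ℕ) : (Gp h N).coeff g = h N g := by
  unfold Gp
  simp only [finsetSum_coeff, coeff_C_mul, coeff_X_pow, mul_ite, mul_one, mul_zero]
  rw [Finset.sum_ite_eq]
  split_ifs with hg
  · rfl
  · rw [mem_range] at hg
    exact (h_vanish hh N g (by omega) (by omega)).symm

open Polynomial in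
lemma Gp_rec {h : ℕ → ℕ → ℝ} (hh : HRec h) (m : ℕ) : C ((m:ℝ)+2) * Gp h (m+2) =
    C (4 * ((m:ℝ)+1) * (3*m+5) * (3*m+1)) * (X * Gp h m)
      + C (4 * (3*(m:ℝ)+5)) * ∑ ij ∈ antidiagonal (m+1), Gp h ij.1 * Gp h ij.2 := by
  ext g
  rw [coeff_add, coeff_C_mul, coeff_C_mul, coeff_C_mul, finsetSum_coeff, Gp_coeff hh, hh.hrec]
  congr 2
  · cases g with
    | zero => simp
    | succ g => rw [coeff_X_mul, Gp_coeff hh]; simp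
  · apply Finset.sum_congr rfl
    intro ij _
    rw [coeff_mul]
    simp only [Gp_coeff hh]

/-- total counts -/
noncomputable def pt (h : ℕ → ℕ → ℝ) (N : ℕ) : ℝ := ∑ g ∈ range (N+1), h N g

lemma pt_eq (h : ℕ → ℕ → ℝ) (N : ℕ) : pt h N = (Gp h N).eval 1 := by
  unfold pt Gp
  simp [Polynomial.eval_finsetSum]

lemma pt_PRec {h : ℕ → ℕ → ℝ} (hh : HRec h) : PRec (pt h) := by
  refine ⟨?_, ?_, ?_⟩
  · simp [pt, hh.h0]
  · simp [pt, hh.h1, Finset.sum_range_succ]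
  · intro m
    have := congrArg (Polynomial.eval 1) (Gp_rec hh m)
    simp only [Polynomial.eval_add, Polynomial.eval_mul, Polynomial.eval_C, Polynomial.eval_X,
      Polynomial.eval_finsetSum, one_mul] at this
    simp only [pt_eq]
    exact this

/-- face generating function at `u` -/
noncomputable def Pu (h : ℕ → ℕ → ℝ) (u : ℂ) (N : ℕ) : ℂ :=
  u^(N+1) * Polynomial.aeval ((u⁻¹)^2) (Gp h N)

lemma Pu_eq (h : ℕ → ℕ → ℝ) (u : ℂ) (N : ℕ) :
    Pu h u N = ∑ g ∈ range (N+1), (h N g : ℂ) * (u^(N+1) * (u⁻¹)^(2*g)) := by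
  unfold Pu Gp
  simp only [map_sum, map_mul, Polynomial.aeval_C, map_pow, Polynomial.aeval_X, Complex.coe_algebraMap]
  rw [Finset.mul_sum]
  apply Finset.sum_congr rfl
  intro g _
  ring

lemma Pu_rec {h : ℕ → ℕ → ℝ} (hh : HRec h) (u : ℂ) (hu : u ≠ 0) (m : ℕ) :
    ((m:ℂ)+2) * Pu h u (m+2) = 4 * (m+1) * (3*m+5) * (3*m+1) * Pu h u m
      + 4 * (3*m+5) * ∑ ij ∈ antidiagonal (m+1), Pu h u ij.1 * Pu h u ij.2 := by
  have := congrArg (Polynomial.aeval ((u⁻¹)^2)) (Gp_rec hh m)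
  simp only [map_add, map_mul, Polynomial.aeval_C, map_sum, Polynomial.aeval_X, Complex.coe_algebraMap] at this
  push_cast at this
  have e : ∑ ij ∈ antidiagonal (m+1), Pu h u ij.1 * Pu h u ij.2 =
    u^(m+3) * ∑ ij ∈ antidiagonal (m+1), Polynomial.aeval ((u⁻¹)^2) (Gp h ij.1) * Polynomial.aeval ((u⁻¹)^2) (Gp h ij.2) := by
    rw [Finset.mul_sum]
    apply Finset.sum_congr rfl
    intro ij hij
    rw [Finset.HasAntidiagonal.mem_antidiagonal] at hij
    unfold Pu
    have : u^(m+3) = u^(ij.1+1) * u^(ij.2+1) := by rw [← pow_add]; congr 1; omega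
    rw [this]; ring
  rw [e]
  unfold Pu
  have e2 : u^(m+2+1) * (u⁻¹)^2 = u^(m+1) := by
    rw [show m+2+1 = (m+1)+2 by ring, pow_add]; field_simp
  rw [← e2]
  linear_combination u^(m+3) * this

lemma pow_sub_one_le (w : ℂ) (hw : ‖w‖ = 1) (k : ℕ) : ‖w^k - 1‖ ≤ k * ‖w-1‖ := by
  induction k with
  | zero => simp
  | succ k ih =>
    have : w^(k+1) - 1 = w * (w^k - 1) + (w - 1) := by ring
    rw [this]
    refine (norm_add_le _ _).trans ?_
    rw [norm_mul, hw]; push_cast; linarith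

lemma Pu_le {h : ℕ → ℕ → ℝ} (hh : HRec h) (u : ℂ) (hu : ‖u‖ = 1) (N : ℕ) : ‖Pu h u N‖ ≤ pt h N := by
  rw [Pu_eq]
  refine (norm_sum_le _ _).trans (le_of_eq ?_)
  unfold pt
  apply Finset.sum_congr rfl
  intro g _
  rw [norm_mul, norm_mul, norm_pow, norm_pow, norm_inv, hu, Complex.norm_real,
    Real.norm_of_nonneg (h_nonneg hh N g)]
  simp

lemma Pu_lin {h : ℕ → ℕ → ℝ} (hh : HRec h) (u : ℂ) (hu : ‖u‖ = 1) (N : ℕ) :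
    ‖Pu h u N - pt h N‖ ≤ (3*N+1) * ‖u-1‖ * pt h N := by
  have hui : ‖u⁻¹‖ = 1 := by rw [norm_inv, hu, inv_one]
  have hu0 : u ≠ 0 := by intro h0; rw [h0] at hu; simp at hu
  have hinv : ‖u⁻¹ - 1‖ = ‖u - 1‖ := by
    have : u⁻¹ - 1 = - (u⁻¹ * (u - 1)) := by field_simp; ring
    rw [this, norm_neg, norm_mul, hui, one_mul]
  rw [Pu_eq]
  unfold pt
  push_cast
  rw [← Finset.sum_sub_distrib, Finset.mul_sum]
  refine (norm_sum_le _ _).trans (Finset.sum_le_sum ?_)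
  intro g hg
  rw [mem_range] at hg
  have e : (h N g : ℂ) * (u^(N+1) * (u⁻¹)^(2*g)) - h N g = h N g * (u^(N+1) * ((u⁻¹)^(2*g) - 1) + (u^(N+1) - 1)) := by ring
  rw [e, norm_mul, Complex.norm_real, Real.norm_of_nonneg (h_nonneg hh N g), mul_comm]
  apply mul_le_mul_of_nonneg_right _ (h_nonneg hh N g)
  refine (norm_add_le _ _).trans ?_
  rw [norm_mul, norm_pow, hu, one_pow, one_mul]
  have h1 := pow_sub_one_le u hu (N+1)
  have h2 := pow_sub_one_le u⁻¹ hui (2*g)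
  rw [hinv] at h2
  have h3 : (g:ℝ) ≤ N := by exact_mod_cast (by omega : g ≤ N)
  push_cast at h1 h2
  nlinarith [norm_nonneg (u-1)]

lemma Pu_est {h : ℕ → ℕ → ℝ} (hh : HRec h) (u : ℂ) (hu : ‖u‖ = 1) (N : ℕ) :
    ‖Pu h u N / pt h N - Rn (u-1) N‖ ≤ 800000 * ‖u-1‖ := by
  have hu0 : u ≠ 0 := by intro h0; rw [h0] at hu; simp at hu
  have hp := pt_PRec hh
  have hpos := p_pos hp N
  have hB := estB hp u hu (Pu h u) (by simp [Pu_eq, hh.h0]; ring)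
    (by simp [Pu_eq, hh.h1, Finset.sum_range_succ])
    (Pu_rec hh u hu0) (Pu_le hh u hu) (Pu_lin hh u hu) N
  have hpc : (pt h N : ℂ) ≠ 0 := by exact_mod_cast hpos.ne'
  have e : Pu h u N / pt h N - Rn (u-1) N = (Pu h u N - pt h N * Rn (u-1) N) / pt h N := by
    field_simp
  rw [e, norm_div, Complex.norm_real, Real.norm_of_nonneg hpos.le, div_le_iff₀ hpos]
  refine hB.trans ?_
  have : (0:ℝ) ≤ 1/((N:ℝ)+1) := by positivity
  gcongr
  linarith

/-- The rescaled genus. -/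
noncomputable def yg (n g : ℕ) : ℝ := (2 * g - n + Real.log n) / √(Real.log n)

/-- The law of the rescaled genus. -/
noncomputable def gm (h : ℕ → ℕ → ℝ) (n : ℕ) : Measure ℝ :=
  ∑ g ∈ range (n+2), ENNReal.ofReal (h (n+1) g / pt h (n+1)) • Measure.dirac (yg n g)

lemma w_nonneg {h : ℕ → ℕ → ℝ} (hh : HRec h) (n g : ℕ) : 0 ≤ h (n+1) g / pt h (n+1) :=
  div_nonneg (h_nonneg hh _ _) (p_pos (pt_PRec hh) _).le

lemma gm_prob {h : ℕ → ℕ → ℝ} (hh : HRec h) (n : ℕ) : IsProbabilityMeasure (gm h n) := by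
  constructor
  unfold gm
  simp only [Measure.coe_finsetSum, Finset.sum_apply, Measure.smul_apply, measure_univ, smul_eq_mul, mul_one]
  rw [← ENNReal.ofReal_sum_of_nonneg (fun g _ => w_nonneg hh n g), ← Finset.sum_div]
  have : ∑ g ∈ range (n+2), h (n+1) g = pt h (n+1) := rfl
  rw [this, div_self (p_pos (pt_PRec hh) _).ne', ENNReal.ofReal_one]

lemma gm_Iic {h : ℕ → ℕ → ℝ} (hh : HRec h) (n : ℕ) (t : ℝ) :
    (gm h n (Set.Iic t)).toReal = (∑ g ∈ range (n+2), if yg n g ≤ t then h (n+1) g else 0) / pt h (n+1) := by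
  unfold gm
  simp only [Measure.coe_finsetSum, Finset.sum_apply, Measure.smul_apply, smul_eq_mul,
    Measure.dirac_apply' _ measurableSet_Iic]
  rw [ENNReal.toReal_sum, Finset.sum_div]
  · apply Finset.sum_congr rfl
    intro g _
    rw [ENNReal.toReal_mul, ENNReal.toReal_ofReal (w_nonneg hh n g)]
    by_cases hc : yg n g ≤ t
    · simp [hc]
    · simp [hc]
  · intro g _
    by_cases hc : yg n g ≤ t
    · simp [hc]
    · simp [hc]

lemma gm_charFun {h : ℕ → ℕ → ℝ} (hh : HRec h) (n : ℕ) (s : ℝ) (hn : 0 < √(Real.log n)) :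
    charFun (gm h n) s = Complex.exp (Complex.I * (s*(2+Real.log n)/√(Real.log n) : ℝ)) *
      (Pu h (Complex.exp (Complex.I * (-s/√(Real.log n) : ℝ))) (n+1) / pt h (n+1)) := by
  rw [charFun_apply_real]
  unfold gm
  rw [integral_finsetSum_measure]
  · rw [Pu_eq, Finset.sum_div, Finset.mul_sum]
    apply Finset.sum_congr rfl
    intro g hg
    rw [integral_smul_measure, integral_dirac, ENNReal.toReal_ofReal (w_nonneg hh n g)]
    rw [← Complex.exp_neg, ← Complex.exp_nat_mul, ← Complex.exp_nat_mul, ← Complex.exp_add]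
    rw [Complex.real_smul]
    have e : ∀ a b c d : ℂ, a * (b * c / d) = (b / d) * (a * c) := by intros; ring
    rw [e, ← Complex.exp_add]
    push_cast
    congr 2
    unfold yg
    have h0 : ((√(Real.log n) : ℝ) : ℂ) ≠ 0 := by exact_mod_cast hn.ne'
    push_cast
    field_simp
    ring
  · intro g hg
    refine Integrable.smul_measure ?_ ENNReal.ofReal_ne_top
    exact integrable_dirac (by simp)

lemma gm_lim {h : ℕ → ℕ → ℝ} (hh : HRec h) (s : ℝ) :
    Tendsto (fun n : ℕ => charFun (gm h n) s) atTop (nhds (Complex.exp (-(s:ℂ)^2/2))) := by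
  have h1 := Rn_lim s
  have h2 : Tendsto (fun n : ℕ => 800000 * ‖Complex.exp (Complex.I * (-s/√(Real.log n) : ℝ)) - 1‖) atTop (nhds 0) := by
    simpa using (u_tendsto s).const_mul 800000
  have hpos : ∀ᶠ n : ℕ in atTop, 0 < √(Real.log n) := sqrt_log_tendsto.eventually_gt_atTop 0
  have h3 : Tendsto (fun n : ℕ => charFun (gm h n) s -
      Complex.exp (Complex.I * (s*(2+Real.log n)/√(Real.log n) : ℝ)) *
        Rn (Complex.exp (Complex.I * (-s/√(Real.log n) : ℝ)) - 1) (n+1)) atTop (nhds 0) := by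
    refine squeeze_zero_norm' ?_ h2
    filter_upwards [hpos] with n hn
    rw [gm_charFun hh n s hn, ← mul_sub, norm_mul, Complex.norm_exp_I_mul_ofReal, one_mul]
    exact Pu_est hh _ (Complex.norm_exp_I_mul_ofReal _) _
  simpa using h3.add h1

lemma gm_tendsto {h : ℕ → ℕ → ℝ} (hh : HRec h) (t : ℝ) :
    Tendsto (fun n : ℕ => (gm h n (Set.Iic t)).toReal) atTop
      (nhds ((Real.sqrt (2 * Real.pi))⁻¹ * ∫ x in Set.Iic t, Real.exp (-x ^ 2 / 2))) := by
  let μs : ℕ → ProbabilityMeasure ℝ := fun n => ⟨gm h n, gm_prob hh n⟩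
  let μ0 : ProbabilityMeasure ℝ := ⟨ProbabilityTheory.gaussianReal 0 1, inferInstance⟩
  have hlim : Tendsto μs atTop (nhds μ0) := by
    rw [ProbabilityMeasure.tendsto_iff_tendsto_charFun]
    intro s
    have e : charFun (μ0 : Measure ℝ) s = Complex.exp (-(s:ℂ)^2/2) := by
      change charFun (ProbabilityTheory.gaussianReal 0 1) s = _
      rw [ProbabilityTheory.charFun_gaussianReal]
      congr 1
      simp
      ring
    rw [e]
    exact gm_lim hh s
  have hna : NullSingletonClass (ProbabilityTheory.gaussianReal 0 1) :=
    ProbabilityTheory.nullSingletonClass_gaussianReal one_ne_zero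
  have key := ProbabilityMeasure.tendsto_measure_of_null_frontier_of_tendsto' hlim
    (E := Set.Iic t) (by
      rw [frontier_Iic]
      exact hna.measure_singleton t)
  have key2 := (ENNReal.tendsto_toReal (measure_ne_top (μ0 : Measure ℝ) (Set.Iic t))).comp key
  have e : ((μ0 : Measure ℝ) (Set.Iic t)).toReal =
      (Real.sqrt (2 * Real.pi))⁻¹ * ∫ x in Set.Iic t, Real.exp (-x ^ 2 / 2) := by
    change (ProbabilityTheory.gaussianReal 0 1 (Set.Iic t)).toReal = _
    rw [ProbabilityTheory.gaussianReal_apply_eq_integral 0 one_ne_zero, ENNReal.toReal_ofReal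
      (integral_nonneg (fun x => ProbabilityTheory.gaussianPDFReal_nonneg _ _ _)),
      ← integral_const_mul]
    congr 1
    ext x
    simp [ProbabilityTheory.gaussianPDFReal]
  rw [e] at key2
  exact key2


/-- **Asymptotic normality of the genus distribution of cubic graphs.**
With `C(n,g) = H(n,g)/(3n+2)` (the number of rooted cubic maps with `2n`
vertices and genus `g`) and `C_n = ∑_{g=0}^n C(n,g)`, for every real `t`,
`(1/C_n) ∑_{g ≤ (n - ln n)/2 + t √(ln n)/2} C(n,g) → Φ(t)`. -/
theorem genus_distribution_asymptotically_normal
    (H : ℤ → ℤ → ℚ)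
    (hH1 : ∀ g : ℤ, H (-1) g = if g = 0 then 1/2 else 0)
    (hH2 : ∀ g : ℤ, H 0 g = if g = 0 then 2 else 0)
    (hH3 : ∀ n g : ℤ, g < 0 → H n g = 0)
    (hHrec : ∀ n g : ℤ, 1 ≤ n → 0 ≤ g →
      H n g = (4*n*(3*n+2)*(3*n-2)/(n+1)) * H (n-2) (g-1)
        + (4*(3*n+2)/(n+1)) *
          ∑ k ∈ Finset.Icc (-1 : ℤ) (n-1), ∑ i ∈ Finset.Icc (0 : ℤ) g,
            H k i * H (n-2-k) (g-i))
    (t : ℝ) :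
    Tendsto
      (fun n : ℕ =>
        (∑ g ∈ Finset.Icc (0 : ℤ) (n : ℤ),
            if (g : ℝ) ≤ ((n : ℝ) - Real.log n) / 2 + t * Real.sqrt (Real.log n) / 2
            then ((H (n : ℤ) g / (3 * (n : ℚ) + 2) : ℚ) : ℝ) else 0) /
          ((∑ g ∈ Finset.Icc (0 : ℤ) (n : ℤ),
            H (n : ℤ) g / (3 * (n : ℚ) + 2) : ℚ) : ℝ))
      atTop
      (nhds ((Real.sqrt (2 * Real.pi))⁻¹ * ∫ x in Set.Iic t, Real.exp (-x ^ 2 / 2))) := by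
  have hh := HRec_of H hH1 hH2 hH3 hHrec
  refine (gm_tendsto hh t).congr' ?_
  filter_upwards [sqrt_log_tendsto.eventually_gt_atTop 0] with n hn
  rw [gm_Iic hh]
  have hv := h_vanish hh (n+1) (n+1) le_rfl (by omega)
  have hc : (0:ℝ) < 3 * n + 2 := by positivity
  unfold pt
  rw [Finset.sum_range_succ, Finset.sum_range_succ _ (n+1)]
  simp only [hv, ite_self, add_zero]
  have en : (((n+1:ℕ):ℤ) - 1) = n := by push_cast; ring
  simp only [en]
  have er : (n:ℤ) = 0 + ((n+1:ℕ):ℤ) - 1 := by push_cast; ring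
  have e1 := sum_Icc_int (fun g : ℤ => if (g : ℝ) ≤ ((n : ℝ) - Real.log n) / 2 + t * Real.sqrt (Real.log n) / 2
            then ((H (n : ℤ) g / (3 * (n : ℚ) + 2) : ℚ) : ℝ) else 0) 0 (n+1)
  have e2 := sum_Icc_int (fun g : ℤ => H (n : ℤ) g / (3 * (n : ℚ) + 2)) 0 (n+1)
  rw [← er] at e1 e2
  rw [e1, e2]
  push_cast
  simp only [zero_add]
  rw [← Finset.sum_div]
  have e3 : ∀ g : ℕ, (if (((g:ℤ)) : ℝ) ≤ ((n : ℝ) - Real.log n) / 2 + t * Real.sqrt (Real.log n) / 2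
            then ((H (n : ℤ) g : ℝ) / (3 * (n : ℝ) + 2)) else 0)
       = (if yg n g ≤ t then (H (n : ℤ) g : ℝ) else 0) / (3 * (n : ℝ) + 2) := by
    intro g
    have : ((((g:ℤ)) : ℝ) ≤ ((n : ℝ) - Real.log n) / 2 + t * Real.sqrt (Real.log n) / 2) ↔ yg n g ≤ t := by
      unfold yg
      rw [div_le_iff₀ hn]
      push_cast
      constructor <;> intro h <;> linarith
    simp only [this]
    split_ifs
    · rfl
    · rw [zero_div]
  have e4 := Finset.sum_congr (rfl : range (n+1) = range (n+1)) (fun g _ => e3 g)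
  push_cast at e4
  rw [e4, ← Finset.sum_div, div_div_div_cancel_right₀ hc.ne']
end

section
/- The mean genus of a uniformly random rooted cubic map with 2n vertices satisfies μ_n := (1/C_n)·Σ_{g=0}^{n} g·C(n,g) ∼ (n − ln n)/2 as n → ∞. -/
open Filter Finset

namespace MG

noncomputable def A (n : ℕ) : ℝ := 4*((n:ℝ)+2)*(3*((n:ℝ)+2)+2)*(3*((n:ℝ)+2)-2)/((n:ℝ)+2+1)
noncomputable def B (n : ℕ) : ℝ := 4*(3*((n:ℝ)+2)+2)/((n:ℝ)+2+1)

noncomputable def W (n k : ℕ) : ℝ := ((k+1).factorial : ℝ) * ((n-k+1).factorial : ℝ) / ((n+1).factorial : ℝ)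

noncomputable def S (n : ℕ) : ℝ := ∑ k ∈ range (n+1), W n k

lemma W_nonneg (n k : ℕ) : 0 ≤ W n k := by unfold W; positivity

lemma W_zero (n : ℕ) : W n 0 = 1 := by
  unfold W
  have : ((n+1).factorial : ℝ) ≠ 0 := by positivity
  simp [this]

lemma W_self (n : ℕ) : W n n = 1 := by
  unfold W
  have : ((n+1).factorial : ℝ) ≠ 0 := by positivity
  simp [this]

lemma W_step (n k : ℕ) (h : k ≤ n) :
    W (n+1) (k+1) + W (n+1) k = ((n:ℝ)+4)/((n:ℝ)+2) * W n k := by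
  obtain ⟨j, rfl⟩ := Nat.exists_eq_add_of_le h
  unfold W
  have e1 : k + j + 1 - (k+1) = j := by omega
  have e2 : k + j + 1 - k = j + 1 := by omega
  have e3 : k + j - k = j := by omega
  rw [e1, e2, e3]
  have h1 : ((k+1+1).factorial : ℝ) = (k+2) * (k+1).factorial := by
    rw [Nat.factorial_succ]; push_cast; ring
  have h2 : ((j+1+1).factorial : ℝ) = (j+2) * (j+1).factorial := by
    rw [Nat.factorial_succ]; push_cast; ring
  have h3 : ((k+j+1+1).factorial : ℝ) = (k+j+2) * (k+j+1).factorial := by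
    rw [Nat.factorial_succ]; push_cast; ring
  rw [h1, h2, h3]
  have : ((k+j+1).factorial : ℝ) ≠ 0 := by positivity
  have : ((k:ℝ)+j+2) ≠ 0 := by positivity
  push_cast
  field_simp
  ring

lemma S_succ (n : ℕ) : S (n+1) = (1/2 + 1/((n:ℝ)+2)) * S n + 1 := by
  have h : ∑ k ∈ range (n+1), (W (n+1) (k+1) + W (n+1) k)
      = ((n:ℝ)+4)/((n:ℝ)+2) * S n := by
    unfold S
    rw [mul_sum]
    refine sum_congr rfl fun k hk => W_step n k ?_
    have := mem_range.1 hk; omega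
  rw [sum_add_distrib] at h
  have h1 : S (n+1) = ∑ k ∈ range (n+1), W (n+1) (k+1) + 1 := by
    unfold S; rw [sum_range_succ', W_zero]
  have h2 : S (n+1) = ∑ k ∈ range (n+1), W (n+1) k + 1 := by
    unfold S; rw [sum_range_succ, W_self]
  have : ((n:ℝ)+2) ≠ 0 := by positivity
  have h3 : ((n:ℝ)+4)/((n:ℝ)+2) = 2 * (1/2 + 1/((n:ℝ)+2)) := by field_simp; ring
  rw [h3] at h
  linarith

lemma S_le (n : ℕ) : S n ≤ 2 + 8/((n:ℝ)+2) := by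
  have s0 : S 0 = 1 := by simp [S, W_zero]
  have s1 := S_succ 0
  have s2 := S_succ 1
  have s3 := S_succ 2
  have s4 := S_succ 3
  have s5 := S_succ 4
  have s6 := S_succ 5
  rw [s0] at s1; norm_num at s1
  rw [s1] at s2; norm_num at s2
  rw [s2] at s3; norm_num at s3
  rw [s3] at s4; norm_num at s4
  rw [s4] at s5; norm_num at s5
  rw [s5] at s6; norm_num at s6
  by_cases hn : n < 6
  · interval_cases n
    · rw [s0]; norm_num
    · rw [s1]; norm_num
    · rw [s2]; norm_num
    · rw [s3]; norm_num
    · rw [s4]; norm_num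
    · rw [s5]; norm_num
  · obtain ⟨m, rfl⟩ := Nat.exists_eq_add_of_le (not_lt.1 hn)
    clear hn
    induction m with
    | zero => rw [s6]; norm_num
    | succ m ih =>
      have e := S_succ (6+m)
      rw [show 6 + (m+1) = 6 + m + 1 by ring, e]
      have hm : (0:ℝ) ≤ m := by positivity
      calc _ ≤ (1/2 + 1/(((6+m:ℕ):ℝ)+2)) * (2 + 8/(((6+m:ℕ):ℝ)+2)) + 1 := by gcongr
        _ ≤ _ := by
          push_cast
          rw [← sub_nonneg]
          have : 2 + 8 / (6 + (m:ℝ) + 1 + 2) - ((1/2 + 1/((6:ℝ)+m+2)) * (2 + 8/((6:ℝ)+m+2)) + 1)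
            = (2*(m:ℝ)^2+18*m+8) / ((m+8)^2*(m+9)) := by
            field_simp; ring
          rw [this]; positivity

lemma S_le4 (n : ℕ) : S n ≤ 4 := by
  have := S_le n
  by_cases h : n < 2
  · have s0 : S 0 = 1 := by simp [S, W_zero]
    have s1 := S_succ 0
    rw [s0] at s1; norm_num at s1
    interval_cases n
    · rw [s0]; norm_num
    · rw [s1]; norm_num
  · have h2 : (2:ℝ) ≤ n := by exact_mod_cast not_lt.1 h
    have : 8/((n:ℝ)+2) ≤ 2 := by rw [div_le_iff₀ (by positivity)]; linarith
    linarith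

structure IsF (F : ℕ → ℝ) : Prop where
  h0 : F 0 = 2
  h1 : F 1 = 25
  hr : ∀ n, F (n+2) = A n * F n + B n * (F (n+1) + ∑ k ∈ range (n+1), F k * F (n-k))

lemma A_pos (n : ℕ) : 0 < A n := by
  unfold A
  have : 0 < 3*((n:ℝ)+2)-2 := by have : (0:ℝ) ≤ n := by positivity
                                 linarith
  positivity
lemma B_pos (n : ℕ) : 0 < B n := by unfold B; positivity
lemma B_le (n : ℕ) : B n ≤ 12 := by
  unfold B; rw [div_le_iff₀ (by positivity)]; linarith

noncomputable def G (F : ℕ → ℝ) (n : ℕ) : ℝ := F n / (6^n * (n+1).factorial)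

lemma F_eq (F : ℕ → ℝ) (n : ℕ) : F n = 6^n * (n+1).factorial * G F n := by
  unfold G
  have : ((n+1).factorial : ℝ) ≠ 0 := by positivity
  field_simp

lemma conv_eq (F : ℕ → ℝ) (n : ℕ) : ∑ k ∈ range (n+1), F k * F (n-k) =
    6^n * (n+1).factorial * ∑ k ∈ range (n+1), G F k * G F (n-k) * W n k := by
  rw [mul_sum]
  refine sum_congr rfl fun k hk => ?_
  have hk : k ≤ n := by have := mem_range.1 hk; omega
  rw [F_eq F k, F_eq F (n-k)]
  unfold W
  have : ((n+1).factorial : ℝ) ≠ 0 := by positivity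
  have e : (6:ℝ)^n = 6^k * 6^(n-k) := by rw [← pow_add]; congr 1; omega
  rw [e]
  field_simp

lemma fac2 (n : ℕ) : ((n+2+1).factorial : ℝ) = ((n:ℝ)+2)*(n+3) * (n+1).factorial := by
  rw [Nat.factorial_succ, Nat.factorial_succ]; push_cast; ring
lemma fac1 (n : ℕ) : ((n+1+1).factorial : ℝ) = ((n:ℝ)+2) * (n+1).factorial := by
  rw [Nat.factorial_succ]; push_cast; ring

lemma G_rec {F : ℕ → ℝ} (h : IsF F) (n : ℕ) :
    36*((n:ℝ)+2)*((n:ℝ)+3) * G F (n+2) = A n * G F n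
      + B n * (6*((n:ℝ)+2) * G F (n+1) + ∑ k ∈ range (n+1), G F k * G F (n-k) * W n k) := by
  have e := h.hr n
  rw [conv_eq, F_eq F (n+2), F_eq F n, F_eq F (n+1), fac2, fac1] at e
  have p : (0:ℝ) < 6^n * (n+1).factorial := by positivity
  apply mul_left_cancel₀ p.ne'
  rw [pow_add, pow_add] at e
  linear_combination e

lemma G_ge {F : ℕ → ℝ} (h : IsF F) (n : ℕ) : 2 ≤ G F n := by
  induction n using Nat.strong_induction_on with
  | _ n ih =>
    match n with
    | 0 => simp [G, h.h0]
    | 1 => simp [G, h.h1, Nat.factorial]; norm_num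
    | n+2 =>
      have e := G_rec h n
      have g0 := ih n (by omega)
      have g1 := ih (n+1) (by omega)
      have hs : 4 ≤ ∑ k ∈ range (n+1), G F k * G F (n-k) * W n k := by
        calc (4:ℝ) ≤ G F 0 * G F (n-0) * W n 0 := by
              rw [W_zero]
              have := ih 0 (by omega)
              simp only [Nat.sub_zero]
              nlinarith
          _ ≤ _ := by
              apply single_le_sum (f := fun k => G F k * G F (n-k) * W n k) _ (by simp)
              intro k hk
              have hk := mem_range.1 hk
              have a1 := ih k (by omega)
              have a2 := ih (n-k) (by omega)
              have := W_nonneg n k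
              have : 0 ≤ G F k := by linarith
              have : 0 ≤ G F (n-k) := by linarith
              positivity
      have hA := A_pos n
      have hB := B_pos n
      have hm : (0:ℝ) ≤ n := by positivity
      have key : 36*((n:ℝ)+2)*((n:ℝ)+3) * 2 ≤ 36*((n:ℝ)+2)*((n:ℝ)+3) * G F (n+2) := by
        rw [e]
        calc _ ≤ A n * 2 + B n * (6*((n:ℝ)+2)*2 + 4) := by
              unfold A B
              rw [← sub_nonneg]
              have : 4 * ((n:ℝ) + 2) * (3 * ((n:ℝ) + 2) + 2) * (3 * ((n:ℝ) + 2) - 2) / ((n:ℝ) + 2 + 1) * 2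
                + 4 * (3 * ((n:ℝ) + 2) + 2) / ((n:ℝ) + 2 + 1) * (6 * ((n:ℝ) + 2) * 2 + 4) -
                36 * ((n:ℝ) + 2) * ((n:ℝ) + 3) * 2 = (40*n+112) / (n+3) := by
                field_simp; ring
              rw [this]; positivity
          _ ≤ _ := by gcongr
      exact le_of_mul_le_mul_left key (by positivity)

lemma F_pos {F : ℕ → ℝ} (h : IsF F) (n : ℕ) : 0 < F n := by
  rw [F_eq F n]
  have := G_ge h n
  have : 0 < G F n := by linarith
  positivity

lemma G_small {F : ℕ → ℝ} (h : IsF F) : (∀ k < 8, G F k ≤ 4) ∧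
    G F 6 ≤ 4 - 10/8 ∧ G F 7 ≤ 4 - 10/9 := by
  have f0 := h.h0
  have f1 := h.h1
  have f2 : F 2 = 480 := by
    rw [h.hr 0]; simp only [sum_range_succ, sum_range_zero, A, B, f0, f1]; norm_num
    try simp only [f0, f1]
    try norm_num
  have f3 : F 3 = 12155 := by
    rw [h.hr 1]; norm_num [sum_range_succ, A, B, f0, f1, f2]
  have f4 : F 4 = 379680 := by
    rw [h.hr 2]; norm_num [sum_range_succ, A, B, f0, f1, f2, f3]
  have f5 : F 5 = 14080250 := by
    rw [h.hr 3]; norm_num [sum_range_succ, A, B, f0, f1, f2, f3, f4]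
  have f6 : F 6 = 604416000 := by
    rw [h.hr 4]; norm_num [sum_range_succ, A, B, f0, f1, f2, f3, f4, f5]
  have f7 : F 7 = 29486725075 := by
    rw [h.hr 5]; norm_num [sum_range_succ, A, B, f0, f1, f2, f3, f4, f5, f6]
  refine ⟨?_, ?_, ?_⟩
  · intro k hk
    interval_cases k <;>
    norm_num [G, f0, f1, f2, f3, f4, f5, f6, f7, Nat.factorial]
  · norm_num [G, f6, Nat.factorial]
  · norm_num [G, f7, Nat.factorial]

lemma conv_le {F : ℕ → ℝ} (h : IsF F) (n : ℕ) (hb : ∀ k ≤ n, G F k ≤ 4) :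
    ∑ k ∈ range (n+1), G F k * G F (n-k) * W n k ≤ 16 * S n := by
  unfold S
  rw [mul_sum]
  refine sum_le_sum fun k hk => ?_
  have hk := mem_range.1 hk
  have a1 := hb k (by omega)
  have a2 := hb (n-k) (by omega)
  have b1 := G_ge h k
  have b2 := G_ge h (n-k)
  have := W_nonneg n k
  have : G F k * G F (n-k) ≤ 16 := by nlinarith
  gcongr

lemma G_le_aux {F : ℕ → ℝ} (h : IsF F) (n : ℕ) :
    G F n ≤ 4 ∧ (6 ≤ n → G F n ≤ 4 - 10/((n:ℝ)+2)) := by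
  obtain ⟨hs, h6, h7⟩ := G_small h
  induction n using Nat.strong_induction_on with
  | _ n ih =>
    by_cases hn : n < 8
    · refine ⟨hs n hn, fun h => ?_⟩
      interval_cases n
      · convert h6 using 2; norm_num
      · convert h7 using 2; norm_num
    · obtain ⟨m, rfl⟩ := Nat.exists_eq_add_of_le (not_lt.1 hn)
      have e := G_rec h (6+m)
      have g0 := (ih (6+m) (by omega)).2 (by omega)
      have g1 := (ih (6+m+1) (by omega)).2 (by omega)
      have hc := conv_le h (6+m) (fun k hk => (ih k (by omega)).1)
      have hS := S_le (6+m)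
      have hA := A_pos (6+m)
      have hB := B_pos (6+m)
      have hm : (0:ℝ) ≤ m := by positivity
      have e8 : 8 + m = 6 + m + 2 := by ring
      have key : G F (8+m) ≤ 4 - 10/(((8+m:ℕ):ℝ)+2) := by
        rw [e8]
        have key : 36*(((6+m:ℕ):ℝ)+2)*(((6+m:ℕ):ℝ)+3) * G F (6+m+2) ≤
            36*(((6+m:ℕ):ℝ)+2)*(((6+m:ℕ):ℝ)+3) * (4 - 10/(((6+m+2:ℕ):ℝ)+2)) := by
          rw [e]
          calc _ ≤ A (6+m) * (4 - 10/(((6+m:ℕ):ℝ)+2)) + B (6+m) * (6*(((6+m:ℕ):ℝ)+2)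
                * (4 - 10/(((6+m+1:ℕ):ℝ)+2)) + 16 * (2 + 8/(((6+m:ℕ):ℝ)+2))) := by
                gcongr
                linarith
            _ ≤ _ := by
              unfold A B
              push_cast
              rw [← sub_nonneg]
              have hpoly : ∀ x : ℝ, 0 ≤ x →
                  36*(6+x+2)*(6+x+3)*(4-10/(6+x+2+2)) -
                  (4*(6+x+2)*(3*(6+x+2)+2)*(3*(6+x+2)-2)/(6+x+2+1)*(4-10/(6+x+2)) +
                   4*(3*(6+x+2)+2)/(6+x+2+1)*(6*(6+x+2)*(4-10/(6+x+1+2))+16*(2+8/(6+x+2))))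
                  = (352*x^4+9768*x^3+92248*x^2+314432*x+168960)/((x+8)*(x+9)^2*(x+10)) := by
                intro x hx
                rw [show 6+x+2+2 = x+10 by ring, show 6+x+2+1 = x+9 by ring,
                  show 6+x+2 = x+8 by ring, show 6+x+1+2 = x+9 by ring]
                have : x+10 ≠ 0 := by positivity
                have : x+9 ≠ 0 := by positivity
                have : x+8 ≠ 0 := by positivity
                field_simp
                ring
              rw [hpoly _ hm]
              positivity
        exact le_of_mul_le_mul_left key (by positivity)
      refine ⟨key.trans ?_, fun _ => key⟩
      have : 0 ≤ 10/(((8+m:ℕ):ℝ)+2) := by positivity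
      linarith

lemma G_le {F : ℕ → ℝ} (h : IsF F) (n : ℕ) : G F n ≤ 4 := (G_le_aux h n).1

structure IsD (F D : ℕ → ℝ) : Prop where
  h0 : D 0 = 4
  h1 : D 1 = 65
  hr : ∀ n, D (n+2) = A n * D n + B n * (D (n+1) + F (n+1)
    + ∑ k ∈ range (n+1), (D k * F (n-k) + F k * D (n-k)))

lemma D_bounds {F D : ℕ → ℝ} (h : IsF F) (hd : IsD F D) (n : ℕ) :
    0 ≤ D n ∧ D n ≤ ((n:ℝ)+2) * F n := by
  induction n using Nat.strong_induction_on with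
  | _ n ih =>
    match n with
    | 0 => rw [hd.h0, h.h0]; norm_num
    | 1 => rw [hd.h1, h.h1]; norm_num
    | n+2 =>
      have hA := A_pos n
      have hB := B_pos n
      obtain ⟨p0, q0⟩ := ih n (by omega)
      obtain ⟨p1, q1⟩ := ih (n+1) (by omega)
      have f0 := F_pos h n
      have f1 := F_pos h (n+1)
      constructor
      · rw [hd.hr]
        have : 0 ≤ ∑ k ∈ range (n+1), (D k * F (n-k) + F k * D (n-k)) := by
          refine sum_nonneg fun k hk => ?_
          have hk := mem_range.1 hk
          have := (ih k (by omega)).1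
          have := (ih (n-k) (by omega)).1
          have := F_pos h k
          have := F_pos h (n-k)
          positivity
        positivity
      · rw [hd.hr, h.hr]
        have hs : ∑ k ∈ range (n+1), (D k * F (n-k) + F k * D (n-k)) ≤
            ((n:ℝ)+4) * ∑ k ∈ range (n+1), F k * F (n-k) := by
          rw [mul_sum]
          refine sum_le_sum fun k hk => ?_
          have hk := mem_range.1 hk
          have a1 := (ih k (by omega)).2
          have a2 := (ih (n-k) (by omega)).2
          have b1 := F_pos h k
          have b2 := F_pos h (n-k)
          have hc : ((n-k:ℕ):ℝ) = (n:ℝ) - k := by rw [Nat.cast_sub (by omega)]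
          rw [hc] at a2
          calc _ ≤ ((k:ℝ)+2) * F k * F (n-k) + F k * (((n:ℝ)-k+2) * F (n-k)) := by gcongr
            _ = _ := by ring
        calc _ ≤ A n * (((n:ℝ)+2) * F n) + B n * ((((n+1:ℕ):ℝ)+2) * F (n+1) + F (n+1)
            + ((n:ℝ)+4) * ∑ k ∈ range (n+1), F k * F (n-k)) := by gcongr
          _ ≤ _ := by
            push_cast
            have : 0 ≤ A n * F n := by positivity
            nlinarith

lemma delta_le {F : ℕ → ℝ} (h : IsF F) (n : ℕ) :
    B n * F (n+1) + B n * (((n:ℝ)+4) * ∑ k ∈ range (n+1), F k * F (n-k))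
      ≤ 26/((n:ℝ)+3) * F (n+2) := by
  rw [conv_eq, F_eq F (n+2), F_eq F (n+1), fac1, fac2]
  have hc := conv_le h n (fun k _ => G_le h k)
  have hS := S_le4 n
  have g1 := G_le h (n+1)
  have g2 := G_ge h (n+2)
  have hB := B_pos n
  have hB2 := B_le n
  have p : (0:ℝ) < 6^n * (n+1).factorial := by positivity
  have hn : (0:ℝ) ≤ n := by positivity
  set K : ℝ := ∑ k ∈ range (n+1), G F k * G F (n-k) * W n k
  have e1 : B n * (6*((n:ℝ)+2)*G F (n+1) + ((n:ℝ)+4) * K) ≤ 12 * (6*((n:ℝ)+2)*4 + ((n:ℝ)+4)*(16*4)) := by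
    have : K ≤ 16*4 := by linarith
    have g1' := G_ge h (n+1)
    calc _ ≤ B n * (6*((n:ℝ)+2)*4 + ((n:ℝ)+4)*(16*4)) := by gcongr
      _ ≤ _ := by gcongr
  have e2 : 26/((n:ℝ)+3) * (36 * (((n:ℝ)+2)*(n+3)) * 2) ≤
      26/((n:ℝ)+3) * (36 * (((n:ℝ)+2)*(n+3)) * G F (n+2)) := by gcongr
  have e3 : 26/((n:ℝ)+3) * (36 * (((n:ℝ)+2)*(n+3)) * 2) = 1872 * ((n:ℝ)+2) := by
    field_simp; ring
  have e4 : B n * (6*((n:ℝ)+2)*G F (n+1) + ((n:ℝ)+4) * K) ≤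
      26/((n:ℝ)+3) * (36 * (((n:ℝ)+2)*(n+3)) * G F (n+2)) := by
    linarith
  have := mul_le_mul_of_nonneg_left e4 p.le
  calc _ = 6^n * (n+1).factorial * (B n * (6*((n:ℝ)+2)*G F (n+1) + ((n:ℝ)+4) * K)) := by ring
    _ ≤ _ := this
    _ = _ := by ring

lemma D_le {F D : ℕ → ℝ} (h : IsF F) (hd : IsD F D) (n : ℕ) :
    D n ≤ 52 * √((n:ℝ)+1) * F n := by
  induction n using Nat.strong_induction_on with
  | _ n ih =>
    match n with
    | 0 => rw [hd.h0, h.h0]; norm_num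
    | 1 =>
      rw [hd.h1, h.h1]
      have : (1:ℝ) ≤ √(((1:ℕ):ℝ)+1) := by rw [Real.one_le_sqrt]; norm_num
      linarith
    | n+2 =>
      have hA := A_pos n
      have hB := B_pos n
      have q0 := ih n (by omega)
      have q1 := ih (n+1) (by omega)
      have f0 := F_pos h n
      have f1 := F_pos h (n+1)
      have f2 := F_pos h (n+2)
      have hs : ∑ k ∈ range (n+1), (D k * F (n-k) + F k * D (n-k)) ≤
          ((n:ℝ)+4) * ∑ k ∈ range (n+1), F k * F (n-k) := by
        rw [mul_sum]
        refine sum_le_sum fun k hk => ?_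
        have hk := mem_range.1 hk
        have a1 := (D_bounds h hd k).2
        have a2 := (D_bounds h hd (n-k)).2
        have b1 := F_pos h k
        have b2 := F_pos h (n-k)
        have hc : ((n-k:ℕ):ℝ) = (n:ℝ) - k := by rw [Nat.cast_sub (by omega)]
        rw [hc] at a2
        calc _ ≤ ((k:ℝ)+2) * F k * F (n-k) + F k * (((n:ℝ)-k+2) * F (n-k)) := by gcongr
          _ = _ := by ring
      have hcn : 0 ≤ ∑ k ∈ range (n+1), F k * F (n-k) :=
        sum_nonneg fun k _ => (mul_pos (F_pos h k) (F_pos h (n-k))).le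
      have hdel := delta_le h n
      have hF : A n * F n + B n * F (n+1) ≤ F (n+2) := by
        rw [h.hr n]
        have : 0 ≤ B n * ∑ k ∈ range (n+1), F k * F (n-k) := by positivity
        linarith
      set s := √((n:ℝ)+2) with hsd
      set t := √((n:ℝ)+3) with htd
      have hs0 : √((n:ℝ)+1) ≤ s := Real.sqrt_le_sqrt (by linarith)
      have hst : s ≤ t := Real.sqrt_le_sqrt (by linarith)
      have hss : s*s = (n:ℝ)+2 := Real.mul_self_sqrt (by positivity)
      have htt : t*t = (n:ℝ)+3 := Real.mul_self_sqrt (by positivity)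
      have hspos : 0 ≤ s := Real.sqrt_nonneg _
      have ht1 : 1 ≤ t := by rw [htd, Real.one_le_sqrt]; linarith [(Nat.cast_nonneg n : (0:ℝ) ≤ n)]
      have q0' : D n ≤ 52 * s * F n := q0.trans (by gcongr)
      have q1' : D (n+1) ≤ 52 * s * F (n+1) := by
        have : (((n+1:ℕ):ℝ)+1) = (n:ℝ)+2 := by push_cast; ring
        rw [this] at q1; exact q1
      have hgap : 52*s + 26/((n:ℝ)+3) ≤ 52*t := by
        rw [← htt]
        have h1 : 26/(t*t) ≤ 26/t := by
          apply div_le_div_of_nonneg_left (by norm_num) (by linarith)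
          nlinarith
        have h2 : 26/t ≤ 52*(t-s) := by
          rw [div_le_iff₀ (by linarith)]
          nlinarith
        linarith
      have e3 : (((n+2:ℕ):ℝ)+1) = (n:ℝ)+3 := by push_cast; ring
      rw [e3]
      calc D (n+2) = A n * D n + B n * (D (n+1) + F (n+1)
            + ∑ k ∈ range (n+1), (D k * F (n-k) + F k * D (n-k))) := hd.hr n
        _ ≤ A n * (52*s*F n) + B n * (52*s*F (n+1) + F (n+1)
            + ((n:ℝ)+4) * ∑ k ∈ range (n+1), F k * F (n-k)) := by gcongr
        _ = 52*s*(A n * F n + B n * F (n+1)) + (B n * F (n+1)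
            + B n * (((n:ℝ)+4) * ∑ k ∈ range (n+1), F k * F (n-k))) := by ring
        _ ≤ 52*s*F (n+2) + 26/((n:ℝ)+3) * F (n+2) := by gcongr
        _ = (52*s + 26/((n:ℝ)+3)) * F (n+2) := by ring
        _ ≤ 52*t*F (n+2) := by gcongr

lemma final_lim {F D : ℕ → ℝ} (h : IsF F) (hd : IsD F D) :
    Tendsto (fun n : ℕ => (((n:ℝ)+2 - D n / F n)/2) / (((n:ℝ) - Real.log n)/2)) atTop (nhds 1) := by
  have hlog : Tendsto (fun n : ℕ => Real.log n / (n:ℝ)) atTop (nhds 0) := by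
    have := Real.isLittleO_log_id_atTop.tendsto_div_nhds_zero
    exact this.comp tendsto_natCast_atTop_atTop
  have hinv : Tendsto (fun n : ℕ => 1 / (n:ℝ)) atTop (nhds 0) := tendsto_one_div_atTop_nhds_zero_nat
  have hm : Tendsto (fun n : ℕ => D n / F n / (n:ℝ)) atTop (nhds 0) := by
    have hup : Tendsto (fun n : ℕ => 104 * √(1/(n:ℝ))) atTop (nhds 0) := by
      have := (Real.continuous_sqrt.tendsto 0).comp hinv
      simpa using this.const_mul 104
    refine tendsto_of_tendsto_of_tendsto_of_le_of_le' tendsto_const_nhds hup ?_ ?_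
    · filter_upwards with n
      have := (D_bounds h hd n).1
      have := F_pos h n
      positivity
    · filter_upwards [eventually_ge_atTop 1] with n hn
      have hn' : (1:ℝ) ≤ n := by exact_mod_cast hn
      have hf := F_pos h n
      have h1 : D n / F n ≤ 52 * √((n:ℝ)+1) := by
        rw [div_le_iff₀ hf]; exact D_le h hd n
      have h2 : √((n:ℝ)+1) ≤ 2 * √n := by
        rw [show (2:ℝ) * √n = √(4*n) by
          rw [Real.sqrt_mul (by norm_num), show (4:ℝ) = 2^2 by norm_num, Real.sqrt_sq (by norm_num)]]
        exact Real.sqrt_le_sqrt (by linarith)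
      have h3 : √(1/(n:ℝ)) = √n / n := by
        rw [Real.sqrt_div_self', Real.sqrt_div (by norm_num), Real.sqrt_one]
      rw [h3, ← mul_div_assoc]
      gcongr
      linarith
  have hnum : Tendsto (fun n : ℕ => 1 + 2*(1/(n:ℝ)) - D n / F n / (n:ℝ)) atTop (nhds (1+2*0-0)) :=
    (tendsto_const_nhds.add (hinv.const_mul 2)).sub hm
  have hden : Tendsto (fun n : ℕ => 1 - Real.log n / (n:ℝ)) atTop (nhds (1-0)) :=
    tendsto_const_nhds.sub hlog
  have := hnum.div hden (by norm_num)
  norm_num at this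
  refine this.congr' ?_
  filter_upwards [eventually_ge_atTop 1] with n hn
  have hn' : (0:ℝ) < n := by exact_mod_cast hn
  have e1 : 1 + 2*((n:ℝ))⁻¹ - D n / F n / (n:ℝ) = ((n:ℝ)+2 - D n / F n)/n := by
    field_simp
  have e2 : 1 - Real.log n / (n:ℝ) = ((n:ℝ) - Real.log n)/n := by field_simp
  simp only [Pi.div_apply]
  rw [e1, e2, div_div_div_cancel_right₀ hn'.ne', div_div_div_cancel_right₀ (by norm_num)]

lemma sum_Icc_nat (f : ℤ → ℚ) (n : ℕ) :
    ∑ i ∈ Finset.Icc (0:ℤ) (n:ℤ), f i = ∑ i ∈ range (n+1), f (i:ℤ) := by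
  refine Finset.sum_bij' (fun i _ => i.toNat) (fun i _ => (i:ℤ)) ?_ ?_ ?_ ?_ ?_
  · intro a ha; have := Finset.mem_Icc.1 ha; apply mem_range.2; omega
  · intro a ha; have := mem_range.1 ha; apply Finset.mem_Icc.2; omega
  · intro a ha; have := Finset.mem_Icc.1 ha; simp; omega
  · intro a ha; simp
  · intro a ha
    have := Finset.mem_Icc.1 ha
    rw [Int.toNat_of_nonneg this.1]

lemma sum_Icc_neg (f : ℤ → ℚ) (n : ℕ) :
    ∑ i ∈ Finset.Icc (-1:ℤ) ((n:ℤ)+1), f i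
      = f (-1) + f ((n:ℤ)+1) + ∑ i ∈ range (n+1), f (i:ℤ) := by
  have : ∑ i ∈ Finset.Icc (-1:ℤ) ((n:ℤ)+1), f i = ∑ i ∈ range (n+3), f ((i:ℤ)-1) := by
    refine Finset.sum_bij' (fun i _ => (i+1).toNat) (fun i _ => (i:ℤ)-1) ?_ ?_ ?_ ?_ ?_
    · intro a ha; have := Finset.mem_Icc.1 ha; apply mem_range.2; omega
    · intro a ha; have := mem_range.1 ha; apply Finset.mem_Icc.2; omega
    · intro a ha; have := Finset.mem_Icc.1 ha; omega
    · intro a ha; simp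
    · intro a ha
      have := Finset.mem_Icc.1 ha
      congr 1; omega
  rw [this, sum_range_succ', sum_range_succ]
  simp only [Nat.cast_add, Nat.cast_one, add_sub_cancel_right, Nat.cast_zero, zero_sub]
  ring

structure IsH (H : ℤ → ℤ → ℚ) : Prop where
  hH1 : ∀ g : ℤ, H (-1) g = if g = 0 then 1/2 else 0
  hH2 : ∀ g : ℤ, H 0 g = if g = 0 then 2 else 0
  hH3 : ∀ n g : ℤ, g < 0 → H n g = 0
  hHrec : ∀ n g : ℤ, 1 ≤ n → 0 ≤ g →
      H n g = (4*n*(3*n+2)*(3*n-2)/(n+1)) * H (n-2) (g-1)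
        + (4*(3*n+2)/(n+1)) *
          ∑ k ∈ Finset.Icc (-1 : ℤ) (n-1), ∑ i ∈ Finset.Icc (0 : ℤ) g,
            H k i * H (n-2-k) (g-i)

lemma H_supp {H : ℤ → ℤ → ℚ} (h : IsH H) (n : ℕ) : ∀ g : ℤ, (n:ℤ) < g → H n g = 0 := by
  induction n using Nat.strong_induction_on with
  | _ n ih =>
    intro g hg
    have aux : ∀ k : ℤ, -1 ≤ k → k < n → ∀ i : ℤ, k < i → 0 < i → H k i = 0 := by
      intro k hk hkn i hi hi0
      rcases eq_or_lt_of_le hk with e | e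
      · rw [← e, h.hH1, if_neg (by omega)]
      · obtain ⟨m, rfl⟩ := Int.eq_ofNat_of_zero_le (show 0 ≤ k by omega)
        exact ih m (by exact_mod_cast hkn) i hi
    by_cases h0 : n = 0
    · subst h0
      have := h.hH2 g
      rw [if_neg (by push_cast at hg; omega)] at this
      exact_mod_cast this
    · rw [h.hHrec n g (by omega) (by omega), aux (n-2) (by omega) (by omega) (g-1) (by omega) (by omega)]
      rw [Finset.sum_eq_zero, mul_zero, mul_zero, add_zero]
      intro k hk
      have hk := Finset.mem_Icc.1 hk
      refine Finset.sum_eq_zero fun i hi => ?_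
      have hi := Finset.mem_Icc.1 hi
      by_cases hc : k < i ∧ 0 < i
      · rw [aux k (by omega) (by omega) i hc.1 hc.2, zero_mul]
      · rw [aux (n-2-k) (by omega) (by omega) (g-i) (by omega) (by omega), mul_zero]

lemma H_rec_nat {H : ℤ → ℤ → ℚ} (h : IsH H) (n g : ℕ) :
    H ((n+2:ℕ):ℤ) g = (4*((n:ℚ)+2)*(3*((n:ℚ)+2)+2)*(3*((n:ℚ)+2)-2)/((n:ℚ)+2+1)) * H n ((g:ℤ)-1)
      + (4*(3*((n:ℚ)+2)+2)/((n:ℚ)+2+1)) * (H ((n+1:ℕ):ℤ) g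
        + ∑ k ∈ range (n+1), ∑ i ∈ range (g+1), H (k:ℤ) (i:ℤ) * H ((n-k:ℕ):ℤ) ((g-i:ℕ):ℤ)) := by
  have e := h.hHrec ((n+2:ℕ):ℤ) g (by push_cast; omega) (by omega)
  rw [e]
  have e1 : (((n+2:ℕ):ℤ)) - 1 = (n:ℤ)+1 := by push_cast; ring
  have e2 : (((n+2:ℕ):ℤ)) - 2 = (n:ℤ) := by push_cast; ring
  rw [e1, e2, sum_Icc_neg]
  simp only [sum_Icc_nat]
  have a1 : ∑ i ∈ range (g+1), H (-1) (i:ℤ) * H ((n:ℤ) - -1) ((g:ℤ)-i) = 1/2 * H ((n+1:ℕ):ℤ) g := by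
    rw [Finset.sum_eq_single 0]
    · rw [h.hH1]; simp
    · intro b _ hb; rw [h.hH1, if_neg (by exact_mod_cast hb), zero_mul]
    · simp
  have a2 : ∑ i ∈ range (g+1), H ((n:ℤ)+1) (i:ℤ) * H ((n:ℤ) - ((n:ℤ)+1)) ((g:ℤ)-i)
      = 1/2 * H ((n+1:ℕ):ℤ) g := by
    rw [Finset.sum_eq_single g]
    · rw [show (n:ℤ) - ((n:ℤ)+1) = -1 by ring, h.hH1]; simp; ring
    · intro b hb hbg
      have := mem_range.1 hb
      rw [show (n:ℤ) - ((n:ℤ)+1) = -1 by ring, h.hH1, if_neg (by omega), mul_zero]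
    · simp
  have a3 : ∑ k ∈ range (n+1), ∑ i ∈ range (g+1), H (k:ℤ) (i:ℤ) * H ((n:ℤ)-k) ((g:ℤ)-i)
      = ∑ k ∈ range (n+1), ∑ i ∈ range (g+1), H (k:ℤ) (i:ℤ) * H ((n-k:ℕ):ℤ) ((g-i:ℕ):ℤ) := by
    refine sum_congr rfl fun k hk => sum_congr rfl fun i hi => ?_
    have := mem_range.1 hk
    have := mem_range.1 hi
    rw [Nat.cast_sub (by omega), Nat.cast_sub (by omega)]
  rw [a1, a2, a3]
  push_cast
  ring

open Polynomial in
noncomputable def P (H : ℤ → ℤ → ℚ) (n : ℕ) : ℝ[X] :=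
  ∑ g ∈ range (n+1), monomial g ((H (n:ℤ) (g:ℤ) : ℚ) : ℝ)

lemma P_coeff {H : ℤ → ℤ → ℚ} (h : IsH H) (n g : ℕ) :
    (P H n).coeff g = ((H (n:ℤ) (g:ℤ) : ℚ) : ℝ) := by
  unfold P
  rw [Polynomial.finsetSum_coeff]
  simp only [Polynomial.coeff_monomial]
  rw [Finset.sum_ite_eq' ]
  split_ifs with hg
  · rfl
  · rw [H_supp h n g (by have := mem_range.not.1 hg; omega)]; simp

open Polynomial in
lemma P_rec {H : ℤ → ℤ → ℚ} (h : IsH H) (n : ℕ) :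
    P H (n+2) = C (A n) * (X * P H n) + C (B n) * (P H (n+1)
      + ∑ k ∈ range (n+1), P H k * P H (n-k)) := by
  ext g
  rw [P_coeff h, H_rec_nat h]
  have hX : (X * P H n).coeff g = ((H n ((g:ℤ)-1) : ℚ) : ℝ) := by
    cases g with
    | zero => rw [h.hH3 _ _ (by norm_num)]; simp
    | succ g => rw [coeff_X_mul, P_coeff h]; congr 2; push_cast; ring
  have hM : ∀ k, (P H k * P H (n-k)).coeff g
      = ∑ i ∈ range (g+1), ((H (k:ℤ) (i:ℤ) : ℚ):ℝ) * ((H ((n-k:ℕ):ℤ) ((g-i:ℕ):ℤ) : ℚ) : ℝ) := by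
    intro k
    rw [coeff_mul, Finset.Nat.sum_antidiagonal_eq_sum_range_succ_mk]
    simp only [P_coeff h]
  simp only [coeff_add, coeff_C_mul, finsetSum_coeff, P_coeff h, hX, hM]
  unfold A B
  push_cast
  rfl

lemma P_one_zero {H : ℤ → ℤ → ℚ} (h : IsH H) : H 1 0 = 20 ∧ H 1 1 = 5 := by
  have i1 : Finset.Icc (-1:ℤ) (1-1) = {-1, 0} := by decide
  have i2 : Finset.Icc (0:ℤ) 0 = {0} := by decide
  have i3 : Finset.Icc (0:ℤ) 1 = {0, 1} := by decide
  have h1 := h.hH1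
  have h2 := h.hH2
  constructor
  · rw [h.hHrec 1 0 (by norm_num) (by norm_num), i1, i2]
    norm_num [h1, h2]
  · rw [h.hHrec 1 1 (by norm_num) (by norm_num), i1, i3]
    norm_num [h1, h2]

noncomputable def FF (H : ℤ → ℤ → ℚ) (n : ℕ) : ℝ := (P H n).eval 1
noncomputable def DD (H : ℤ → ℤ → ℚ) (n : ℕ) : ℝ :=
  ((n:ℝ)+2) * (P H n).eval 1 - 2 * (Polynomial.derivative (P H n)).eval 1

lemma isF {H : ℤ → ℤ → ℚ} (h : IsH H) : IsF (FF H) := by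
  refine ⟨?_, ?_, ?_⟩
  · simp [FF, P, h.hH2]
  · obtain ⟨a, b⟩ := P_one_zero h
    norm_num [FF, P, sum_range_succ, a, b]
  · intro n
    simp only [FF]
    rw [P_rec h]
    simp [Polynomial.eval_finsetSum]

lemma isD {H : ℤ → ℤ → ℚ} (h : IsH H) : IsD (FF H) (DD H) := by
  refine ⟨?_, ?_, ?_⟩
  · norm_num [DD, P, h.hH2]
  · obtain ⟨a, b⟩ := P_one_zero h
    norm_num [DD, P, sum_range_succ, a, b]
  · intro n
    simp only [FF, DD]
    rw [P_rec h]
    simp only [Polynomial.derivative_add, Polynomial.derivative_mul, Polynomial.derivative_C,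
      Polynomial.derivative_X, Polynomial.derivative_sum, Polynomial.eval_add, Polynomial.eval_mul,
      Polynomial.eval_C, Polynomial.eval_X, Polynomial.eval_finsetSum, zero_mul, zero_add, one_mul]
    have hs : ∑ k ∈ range (n+1), ((((k:ℝ)+2) * (P H k).eval 1
          - 2 * (Polynomial.derivative (P H k)).eval 1) * (P H (n-k)).eval 1
        + (P H k).eval 1 * ((((n-k:ℕ):ℝ)+2) * (P H (n-k)).eval 1
          - 2 * (Polynomial.derivative (P H (n-k))).eval 1))
      = ((n:ℝ)+4) * ∑ k ∈ range (n+1), (P H k).eval 1 * (P H (n-k)).eval 1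
        - 2 * ∑ k ∈ range (n+1), ((Polynomial.derivative (P H k)).eval 1 * (P H (n-k)).eval 1
          + (P H k).eval 1 * (Polynomial.derivative (P H (n-k))).eval 1) := by
      rw [mul_sum, mul_sum, ← sum_sub_distrib]
      refine sum_congr rfl fun k hk => ?_
      have := mem_range.1 hk
      rw [Nat.cast_sub (by omega)]
      ring
    rw [hs]
    push_cast
    ring

lemma sumH {H : ℤ → ℤ → ℚ} (n : ℕ) :
    ((∑ g ∈ Finset.Icc (0 : ℤ) (n : ℤ), H (n : ℤ) g / (3 * (n : ℚ) + 2) : ℚ) : ℝ)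
      = FF H n / (3*(n:ℝ)+2) := by
  rw [sum_Icc_nat, ← Finset.sum_div]
  simp [FF, P, Polynomial.eval_finsetSum]

lemma sumgH {H : ℤ → ℤ → ℚ} (n : ℕ) :
    ((∑ g ∈ Finset.Icc (0 : ℤ) (n : ℤ), (g:ℚ) * (H (n : ℤ) g / (3 * (n : ℚ) + 2)) : ℚ) : ℝ)
      = (((n:ℝ)+2) * FF H n - DD H n)/2 / (3*(n:ℝ)+2) := by
  rw [sum_Icc_nat]
  simp only [← mul_div_assoc]
  rw [← Finset.sum_div]
  have : (((n:ℝ)+2) * FF H n - DD H n)/2 = (Polynomial.derivative (P H n)).eval 1 := by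
    unfold FF DD; ring
  rw [this]
  simp [P, Polynomial.eval_finsetSum, Polynomial.derivative_monomial, mul_comm]

end MG

/-- The mean genus of a uniformly random rooted cubic map with `2n` vertices
is asymptotic to `(n - ln n)/2`. -/
theorem mean_genus_asymptotic
    (H : ℤ → ℤ → ℚ)
    (hH1 : ∀ g : ℤ, H (-1) g = if g = 0 then 1/2 else 0)
    (hH2 : ∀ g : ℤ, H 0 g = if g = 0 then 2 else 0)
    (hH3 : ∀ n g : ℤ, g < 0 → H n g = 0)
    (hHrec : ∀ n g : ℤ, 1 ≤ n → 0 ≤ g →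
      H n g = (4*n*(3*n+2)*(3*n-2)/(n+1)) * H (n-2) (g-1)
        + (4*(3*n+2)/(n+1)) *
          ∑ k ∈ Finset.Icc (-1 : ℤ) (n-1), ∑ i ∈ Finset.Icc (0 : ℤ) g,
            H k i * H (n-2-k) (g-i)) :
    Tendsto
      (fun n : ℕ =>
        (((∑ g ∈ Finset.Icc (0 : ℤ) (n : ℤ),
              (g : ℚ) * (H (n : ℤ) g / (3 * (n : ℚ) + 2))) /
            (∑ g ∈ Finset.Icc (0 : ℤ) (n : ℤ),
              H (n : ℤ) g / (3 * (n : ℚ) + 2)) : ℚ) : ℝ) /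
          (((n : ℝ) - Real.log n) / 2))
      atTop (nhds 1) := by
  have h : MG.IsH H := ⟨hH1, hH2, hH3, hHrec⟩
  have hF := MG.isF h
  refine (MG.final_lim hF (MG.isD h)).congr fun n => ?_
  rw [Rat.cast_div, MG.sumH, MG.sumgH]
  congr 1
  have := MG.F_pos hF n
  field_simp
end
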